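/- Let f be a non-wandering homeomorphism of 𝕋² homotopic to the identity, with lift F, and suppose f has no periodic points. Then f is rationally bounded (i.e. there exist v ∈ ℤ² \ {0} and λ ∈ ℚ with ρ(F) ⊆ λv + {v}^⊥ such that f has bounded mean motion parallel to v) if and only if f has a periodic circloid, i.e. there exist a circloid C ⊆ 𝕋² and q ≥ 1 with f^q(C) = C. -/

import Mathlib

open Filter Topology

local notation "⟪" x ", " y "⟫" => @inner ℝ _ _ x y

noncomputable section

/-- Euclidean space `ℝ^d`. -/
abbrev Rd (d : ℕ) := EuclideanSpace ℝ (Fin d)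

/-- The `d`-torus `𝕋^d = ℝ^d/ℤ^d`, realized as a product of circles. -/
abbrev Torus (d : ℕ) := Fin d → AddCircle (1 : ℝ)

/-- The quotient map `π : ℝ^d → 𝕋^d`. -/
def projT {d : ℕ} (z : Rd d) : Torus d := fun i => (z i : AddCircle (1 : ℝ))

/-- An integer vector viewed as an element of `ℝ^d`. -/
def intVec {d : ℕ} (m : Fin d → ℤ) : Rd d := WithLp.toLp 2 (fun i => (m i : ℝ))

/-- A real vector viewed as an element of `ℝ^k`. -/
def vecR {k : ℕ} (ρ : Fin k → ℝ) : Rd k := WithLp.toLp 2 (fun i => ρ i)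

/-- `F : ℝ^d → ℝ^d` is a lift of `f : 𝕋^d → 𝕋^d`:  `π ∘ F = f ∘ π` and
`F (z + m) = F z + m` for every integer vector `m`.  The existence of such a lift
expresses that `f` is homotopic to the identity. -/
def IsLift {d : ℕ} (f : Torus d ≃ₜ Torus d) (F : Rd d ≃ₜ Rd d) : Prop :=
  (∀ z : Rd d, projT (F z) = f (projT z)) ∧
  ∀ (z : Rd d) (m : Fin d → ℤ), F (z + intVec m) = F z + intVec m

/-- The `n`-th iterate (`n ∈ ℤ`) of a homeomorphism. -/
def iterZ {X : Type*} [TopologicalSpace X] (F : X ≃ₜ X) (n : ℤ) : X → X := ⇑(F.toEquiv ^ n)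

/-- `f` is non-wandering: no nonempty open set `U` satisfies `fⁿ(U) ∩ U = ∅` for all
`n ≥ 1`. -/
def NonWandering {X : Type*} [TopologicalSpace X] (f : X → X) : Prop :=
  ∀ U : Set X, IsOpen U → U.Nonempty → ∃ n : ℕ, 1 ≤ n ∧ (f^[n] '' U ∩ U).Nonempty

/-- `f` has a periodic point. -/
def HasPeriodicPoint {X : Type*} (f : X → X) : Prop :=
  ∃ (x : X) (q : ℕ), 1 ≤ q ∧ f^[q] x = x

/-- The rotation set of `F` on `K`:  all limits `(F^{nᵢ} xᵢ − xᵢ)/nᵢ → ρ` with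
`nᵢ ↗ ∞` and `xᵢ ∈ π⁻¹(K)`. -/
def rotSetOn {d : ℕ} (F : Rd d ≃ₜ Rd d) (K : Set (Torus d)) : Set (Rd d) :=
  {ρ | ∃ (n : ℕ → ℕ) (x : ℕ → Rd d), StrictMono n ∧ (∀ i, projT (x i) ∈ K) ∧
    Tendsto (fun i => (n i : ℝ)⁻¹ • ((⇑F)^[n i] (x i) - x i)) atTop (𝓝 ρ)}

/-- The affine hyperplane `lam • v + {v}^⊥`. -/
def affHyp {d : ℕ} (v : Rd d) (lam : ℝ) : Set (Rd d) :=
  {w | ∃ u : Rd d, ⟪u, v⟫ = 0 ∧ w = lam • v + u}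

/-- Bounded mean motion parallel to `v` on `K`:  `|⟨Fⁿ z − z − n ρ, v⟩| ≤ c` for all
`n ∈ ℤ` and `z ∈ π⁻¹(K)`, where `ρ = lam • v` is a point of the hyperplane
`lam • v + {v}^⊥` containing the rotation set (the value of the inner product does
not depend on the choice of `ρ` in this hyperplane). -/
def BddMeanMotionParallelOn {d : ℕ} (F : Rd d ≃ₜ Rd d) (v : Rd d) (lam : ℝ)
    (K : Set (Torus d)) : Prop :=
  ∃ c : ℝ, 0 < c ∧ ∀ (n : ℤ) (z : Rd d), projT z ∈ K →
    |⟪iterZ F n z - z - (n : ℝ) • (lam • v), v⟫| ≤ c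

/-- A subset of `𝕋²` is essential if it is not contained in any embedded topological
open disk (an open disk being homeomorphic to `ℝ²`, embedded disks in a surface are
exactly ranges of open embeddings of `ℝ²`). -/
def IsEssentialT2 (C : Set (Torus 2)) : Prop :=
  ¬ ∃ e : Rd 2 → Torus 2, IsOpenEmbedding e ∧ C ⊆ Set.range e

/-- A simple closed curve in `𝕋²`: a subset homeomorphic to the circle. -/
def IsSimpleClosedCurveT2 (Γ : Set (Torus 2)) : Prop :=
  ∃ e : AddCircle (1 : ℝ) → Torus 2, IsEmbedding e ∧ Γ = Set.range e

/-- Properties (i)–(iii) of a circloid in `𝕋²`: compact and connected, essential, and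
with connected complement containing an essential simple closed curve. -/
def CircloidPropsT2 (C : Set (Torus 2)) : Prop :=
  IsCompact C ∧ IsConnected C ∧ IsEssentialT2 C ∧ IsConnected Cᶜ ∧
  ∃ Γ : Set (Torus 2), Γ ⊆ Cᶜ ∧ IsSimpleClosedCurveT2 Γ ∧ IsEssentialT2 Γ

/-- A circloid in `𝕋²`: a set with properties (i)–(iii) containing no strictly smaller
subset with these properties. -/
def IsCircloidT2 (C : Set (Torus 2)) : Prop :=
  CircloidPropsT2 C ∧ ∀ C' ⊆ C, CircloidPropsT2 C' → C' = C

/-- `f` (with lift `F`) is rationally bounded: there are `v ∈ ℤ² \ {0}` and `λ ∈ ℚ`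
with `ρ(F) ⊆ λ v + {v}^⊥` such that `f` has bounded mean motion parallel to `v`. -/
def RationallyBounded (F : Rd 2 ≃ₜ Rd 2) : Prop :=
  ∃ (v : Fin 2 → ℤ) (lam : ℚ), v ≠ 0 ∧
    rotSetOn F Set.univ ⊆ affHyp (intVec v) (lam : ℝ) ∧
    BddMeanMotionParallelOn F (intVec v) (lam : ℝ) Set.univ

/-- A continuous integer-valued real function is constant on a preconnected set. -/
theorem IsPreconnected.eq_of_int_valued {X : Type*} [TopologicalSpace X] {S : Set X}
    (hS : IsPreconnected S) {φ : X → ℝ} (hφ : ContinuousOn φ S)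
    (hint : ∀ x ∈ S, ∃ n : ℤ, φ x = n) {x y : X} (hx : x ∈ S) (hy : y ∈ S) : φ x = φ y := by
  have key : ∀ x ∈ S, ∀ y ∈ S, ¬ φ x < φ y := by
    intro x hx y hy hlt
    have hord := (hS.image φ hφ).ordConnected
    obtain ⟨m, hm⟩ := hint x hx
    obtain ⟨n, hn⟩ := hint y hy
    have h1 : (m : ℝ) + 1 ≤ n := by
      rw [hm, hn] at hlt
      exact_mod_cast hlt
    have hmem : φ x + 1 / 2 ∈ φ '' S :=
      hord.out ⟨x, hx, rfl⟩ ⟨y, hy, rfl⟩ ⟨by linarith, by rw [hm, hn]; linarith⟩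
    obtain ⟨t, ht, hte⟩ := hmem
    obtain ⟨k, hk⟩ := hint t ht
    rw [hm, hk] at hte
    have h2 : (2 * k : ℝ) = 2 * m + 1 := by linarith
    have h3 : 2 * k = 2 * m + 1 := by exact_mod_cast h2
    omega
  exact le_antisymm (not_lt.1 (key y hy x hx)) (not_lt.1 (key x hx y hy))

/-- Two continuous logarithms of the same function differ by a constant on a preconnected set. -/
theorem IsPreconnected.sub_eq_sub_of_exp_eq {X : Type*} [TopologicalSpace X] {S : Set X}
    (hS : IsPreconnected S) {a b : X → ℂ} (ha : ContinuousOn a S) (hb : ContinuousOn b S)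
    (hab : ∀ x ∈ S, Complex.exp (a x) = Complex.exp (b x)) {x y : X} (hx : x ∈ S) (hy : y ∈ S) :
    a x - b x = a y - b y := by
  have hd : ∀ x ∈ S, ∃ n : ℤ, a x - b x = n * (2 * Real.pi * Complex.I) := by
    intro x hx
    obtain ⟨n, hn⟩ := Complex.exp_eq_exp_iff_exists_int.1 (hab x hx)
    exact ⟨n, by rw [hn]; ring⟩
  have him : ∀ x ∈ S, ∀ n : ℤ, a x - b x = n * (2 * Real.pi * Complex.I) →
      (a x - b x).im / (2 * Real.pi) = n := by
    intro x hx n hn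
    rw [hn]
    have : (2 * Real.pi : ℝ) ≠ 0 := by positivity
    have h : ((n : ℂ) * (2 * Real.pi * Complex.I)).im = n * (2 * Real.pi) := by simp
    rw [h]; field_simp
  have := hS.eq_of_int_valued (φ := fun x => (a x - b x).im / (2 * Real.pi))
    ((Complex.continuous_im.comp_continuousOn (ha.sub hb)).div_const _)
    (fun x hx => (hd x hx).imp fun n hn => him x hx n hn) hx hy
  obtain ⟨n, hn⟩ := hd x hx
  obtain ⟨m, hm⟩ := hd y hy
  have h1 := him x hx n hn
  have h2 := him y hy m hm
  have h3 : (n : ℝ) = m := by rw [← h1, ← h2]; exact this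
  have h4 : n = m := by exact_mod_cast h3
  rw [hn, hm, h4]

/-- Nowhere vanishing continuous functions on a normed space have continuous logarithms. -/
theorem exists_continuous_log {E : Type*} [NormedAddCommGroup E] [NormedSpace ℝ E] {g : E → ℂ}
    (hg : Continuous g) (h0 : ∀ x, g x ≠ 0) :
    ∃ h : E → ℂ, Continuous h ∧ ∀ x, Complex.exp (h x) = g x := by
  have hU : IsSimplyConnected (Set.univ : Set E) := by
    have : ContractibleSpace (Set.univ : Set E) := (Homeomorph.Set.univ E).contractibleSpace
    exact (inferInstance : SimplyConnectedSpace (Set.univ : Set E))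
  obtain ⟨h, hc, he⟩ := Complex.exists_continuousOn_eqOn_exp_comp hU isOpen_univ
    hg.continuousOn (by rintro ⟨x, -, hx⟩; exact h0 x hx)
  exact ⟨h, continuousOn_univ.1 hc, fun x => he (Set.mem_univ x)⟩

/-- A continuous injection of the plane, at bounded distance from the identity and without fixed
points, has no point of period two. -/
theorem apply_apply_ne_of_bounded_displacement {G : ℂ → ℂ} (hG : Continuous G)
    (hinj : Function.Injective G) {c : ℝ} (hc : ∀ z, ‖G z - z‖ ≤ c) (hfix : ∀ z, G z ≠ z) (x : ℂ) :
    G (G x) ≠ x := by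
  intro hx
  obtain ⟨θ, hθc, hθ⟩ := exists_continuous_log (g := fun z => G z - z) (by fun_prop)
    (fun z => sub_ne_zero.2 (hfix z))
  set Q : ℂ × ℂ → ℂ := fun p => (G (p.1 + Complex.exp p.2) - G p.1) / Complex.exp p.2 with hQ
  have hQc : Continuous Q := by
    apply Continuous.div (by fun_prop) (by fun_prop)
    intro p; exact Complex.exp_ne_zero _
  have hQ0 : ∀ p, Q p ≠ 0 := by
    intro p
    apply div_ne_zero _ (Complex.exp_ne_zero _)
    rw [sub_ne_zero]
    intro h
    have := hinj h
    simp at this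
  obtain ⟨h, hhc, hh⟩ := exists_continuous_log hQc hQ0
  set R : ℝ := 4 * c with hR
  have hc0 : 0 ≤ c := (norm_nonneg _).trans (hc 0)
  set W : Set (ℂ × ℂ) := {p | R ≤ p.2.re} with hW
  have hWpre : IsPreconnected W := by
    apply Convex.isPreconnected
    intro p hp q hq a b ha hb hab
    simp only [hW, Set.mem_ofPred_eq, Prod.snd_add, Prod.smul_snd, Complex.add_re,
      Complex.real_smul, Complex.mul_re, Complex.ofReal_re, Complex.ofReal_im, zero_mul,
      sub_zero] at hp hq ⊢
    nlinarith [mul_le_mul_of_nonneg_left hp ha, mul_le_mul_of_nonneg_left hq hb]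
  have hWQ : ∀ p ∈ W, Q p ∈ Complex.slitPlane := by
    intro p hp
    suffices hs : ‖Q p - 1‖ < 1 by simpa using Complex.mem_slitPlane_of_norm_lt_one hs
    have h1 : Q p - 1 = ((G (p.1 + Complex.exp p.2) - (p.1 + Complex.exp p.2)) - (G p.1 - p.1))
        / Complex.exp p.2 := by
      rw [hQ]
      field_simp [Complex.exp_ne_zero]
      ring
    rw [h1, norm_div, div_lt_one (by simp [Complex.exp_ne_zero]), Complex.norm_exp]
    have h2 : (4 * c) + 1 ≤ Real.exp p.2.re := by
      have := Real.add_one_le_exp p.2.re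
      have h3 : 4 * c ≤ p.2.re := hp
      linarith
    have := norm_sub_le (G (p.1 + Complex.exp p.2) - (p.1 + Complex.exp p.2)) (G p.1 - p.1)
    have := hc (p.1 + Complex.exp p.2)
    have := hc p.1
    linarith
  have hdiff : ∀ p ∈ W, ∀ q ∈ W, h p - Complex.log (Q p) = h q - Complex.log (Q q) := by
    intro p hp q hq
    refine hWpre.sub_eq_sub_of_exp_eq (b := fun p => Complex.log (Q p)) hhc.continuousOn
      (fun p hp => ((hQc.continuousAt).clog (hWQ p hp)).continuousWithinAt) ?_ hp hq
    intro p _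
    rw [hh, Complex.exp_log (hQ0 p)]
  have huniq : ∀ a : ℂ × ℂ → ℂ × ℂ, Continuous a → (∀ p, Q (a p) = Q p) →
      (∀ p ∈ W, a p ∈ W) → ∀ p, h (a p) = h p := by
    intro a ha hQa haW p
    have hw : ((0 : ℂ), (R : ℂ)) ∈ W := by simp [hW]
    have h1 := isPreconnected_univ.sub_eq_sub_of_exp_eq (a := fun p => h (a p)) (b := h)
      (by fun_prop) (by fun_prop) (by intro p _; rw [hh, hh, hQa]) (Set.mem_univ p)
      (Set.mem_univ ((0 : ℂ), (R : ℂ)))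
    have h2 := hdiff _ hw _ (haW _ hw)
    rw [hQa] at h2
    have h3 : h (a (0, R)) = h (0, R) := by linear_combination -h2
    simp only [h3, sub_self] at h1
    exact sub_eq_zero.1 h1
  have hper : ∀ (k : ℤ) z s, h (z, s + k * (2 * Real.pi * Complex.I)) = h (z, s) := by
    intro k z s
    refine huniq (fun p => (p.1, p.2 + k * (2 * Real.pi * Complex.I))) (by fun_prop) ?_ ?_ (z, s)
    · intro p
      have : Complex.exp (p.2 + k * (2 * Real.pi * Complex.I)) = Complex.exp p.2 :=
        Complex.exp_periodic.int_mul k p.2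
      simp only [hQ, this]
    · intro p hp
      simpa [hW] using hp
  have hflip : ∀ z s, h (z + Complex.exp s, s + Real.pi * Complex.I) = h (z, s) := by
    intro z s
    refine huniq (fun p => (p.1 + Complex.exp p.2, p.2 + Real.pi * Complex.I)) (by fun_prop) ?_ ?_
      (z, s)
    · intro p
      have : Complex.exp (p.2 + Real.pi * Complex.I) = - Complex.exp p.2 := by
        rw [Complex.exp_add, Complex.exp_pi_mul_I]; ring
      simp only [hQ, this]
      rw [add_neg_cancel_right, div_neg, ← neg_div, neg_sub]
    · intro p hp
      simpa [hW] using hp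
  have hconst : ∀ z w, h (z, θ z) - (θ (G z) - θ z) = h (w, θ w) - (θ (G w) - θ w) := by
    intro z w
    refine isPreconnected_univ.sub_eq_sub_of_exp_eq (a := fun z => h (z, θ z))
      (b := fun z => θ (G z) - θ z) (by fun_prop) (by fun_prop) ?_ (Set.mem_univ _)
      (Set.mem_univ _)
    intro z _
    rw [hh, Complex.exp_sub, hθ, hθ]
    simp only [hQ, hθ]
    rw [add_sub_cancel]
  have he : Complex.exp (θ (G x)) = Complex.exp (θ x + Real.pi * Complex.I) := by
    rw [hθ, Complex.exp_add, Complex.exp_pi_mul_I, hθ, hx]; ring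
  obtain ⟨k, hk⟩ := Complex.exp_eq_exp_iff_exists_int.1 he
  have h1 : h (G x, θ (G x)) = h (x, θ x) := by
    rw [hk, hper, ← hflip x (θ x), hθ, add_sub_cancel]
  have h2 := hconst x (G x)
  rw [h1, hx] at h2
  have h3 : θ (G x) = θ x := by linear_combination -h2 / 2
  have h4 : G (G x) - G x = G x - x := by rw [← hθ, ← hθ, h3]
  rw [hx] at h4
  apply hfix x
  linear_combination -h4 / 2

/-- A small push of the plane moving `a` to `b`, supported in a ball about `a`. -/
theorem exists_homeomorph_push_ball {a b : ℂ} {δ : ℝ} (hab : ‖b - a‖ < δ) :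
    ∃ φ : ℂ ≃ₜ ℂ, φ a = b ∧ ∀ z, z ∉ Metric.ball a δ → φ z = z := by
  have hδ : 0 < δ := (norm_nonneg _).trans_lt hab
  set φ : ℂ → ℂ := fun z => z + (max 0 (1 - ‖z - a‖ / δ) : ℝ) • (b - a) with hφ
  set c : NNReal := (‖b - a‖ / δ).toNNReal with hc
  have hcv : (c : ℝ) = ‖b - a‖ / δ := Real.coe_toNNReal _ (by positivity)
  have happ : ApproximatesLinearOn φ ((ContinuousLinearEquiv.refl ℝ ℂ : ℂ ≃L[ℝ] ℂ) : ℂ →L[ℝ] ℂ)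
      Set.univ c := by
    intro x _ y _
    have h1 : φ x - φ y - ((ContinuousLinearEquiv.refl ℝ ℂ : ℂ ≃L[ℝ] ℂ) : ℂ →L[ℝ] ℂ) (x - y)
        = (max 0 (1 - ‖x - a‖ / δ) - max 0 (1 - ‖y - a‖ / δ) : ℝ) • (b - a) := by
      simp only [hφ, ContinuousLinearEquiv.coe_coe, ContinuousLinearEquiv.coe_refl', id]
      rw [sub_smul]; ring
    rw [h1, norm_smul]
    have h2 : ‖max 0 (1 - ‖x - a‖ / δ) - max 0 (1 - ‖y - a‖ / δ)‖ ≤ ‖x - y‖ / δ := by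
      rw [Real.norm_eq_abs]
      have h3 := abs_max_sub_max_le_abs (1 - ‖x - a‖ / δ) (1 - ‖y - a‖ / δ) 0
      rw [max_comm _ (0:ℝ), max_comm _ (0:ℝ)] at h3
      refine h3.trans ?_
      have h4 : (1 - ‖x - a‖ / δ) - (1 - ‖y - a‖ / δ) = (‖y - a‖ - ‖x - a‖) / δ := by ring
      rw [h4, abs_div, abs_of_pos hδ]
      gcongr
      have := abs_norm_sub_norm_le (y - a) (x - a)
      rw [sub_sub_sub_cancel_right, norm_sub_rev y x] at this
      exact this
    calc _ ≤ ‖x - y‖ / δ * ‖b - a‖ := by gcongr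
      _ = _ := by
        rw [hcv]
        ring
  have hc1 : c < 1 := by
    rw [← NNReal.coe_lt_coe, hcv, NNReal.coe_one]
    exact (div_lt_one hδ).2 hab
  have hcond : Subsingleton ℂ ∨
      c < ‖((ContinuousLinearEquiv.refl ℝ ℂ : ℂ ≃L[ℝ] ℂ).symm : ℂ →L[ℝ] ℂ)‖₊⁻¹ := by
    right
    have : ‖((ContinuousLinearEquiv.refl ℝ ℂ : ℂ ≃L[ℝ] ℂ).symm : ℂ →L[ℝ] ℂ)‖₊ = 1 := by
      rw [← NNReal.coe_inj]
      simp only [coe_nnnorm, ContinuousLinearEquiv.refl_symm, ContinuousLinearEquiv.coe_refl,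
        ContinuousLinearMap.norm_id, NNReal.coe_one]
    rw [this, inv_one]
    exact hc1
  refine ⟨happ.toHomeomorph φ hcond, ?_, ?_⟩
  · change φ a = b
    simp [hφ]
  · intro z hz
    change φ z = z
    have : max 0 (1 - ‖z - a‖ / δ) = 0 := by
      apply max_eq_left
      rw [Metric.mem_ball, dist_eq_norm, not_lt] at hz
      rw [sub_nonpos, one_le_div hδ]
      exact hz
    simp [hφ, this]

/-- Points of a preconnected subset of an open set are exchanged by homeomorphisms supported
in the open set. -/
theorem exists_homeomorph_push {S O : Set ℂ} (hS : IsPreconnected S) (hO : IsOpen O) (hSO : S ⊆ O)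
    {a b : ℂ} (ha : a ∈ S) (hb : b ∈ S) :
    ∃ φ : ℂ ≃ₜ ℂ, φ a = b ∧ ∀ z, z ∉ O → φ z = z := by
  refine hS.induction₂ (fun a b => ∃ φ : ℂ ≃ₜ ℂ, φ a = b ∧ ∀ z, z ∉ O → φ z = z) ?_ ?_ ?_ ha hb
  · intro x hx
    obtain ⟨δ, hδ, hball⟩ := Metric.isOpen_iff.1 hO x (hSO hx)
    filter_upwards [mem_nhdsWithin_of_mem_nhds (Metric.ball_mem_nhds x hδ)] with y hy
    rw [Metric.mem_ball, dist_eq_norm] at hy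
    obtain ⟨φ, h1, h2⟩ := exists_homeomorph_push_ball hy
    exact ⟨φ, h1, fun z hz => h2 z fun h => hz (hball h)⟩
  · rintro x y z - - - ⟨φ, h1, h2⟩ ⟨ψ, h3, h4⟩
    refine ⟨φ.trans ψ, by simp [h1, h3], fun z hz => by simp [h2 z hz, h4 z hz]⟩
  · rintro x y - - ⟨φ, h1, h2⟩
    refine ⟨φ.symm, by simp [← h1], fun z hz => ?_⟩
    rw [Homeomorph.symm_apply_eq, h2 z hz]

/-- Homeomorphisms of the plane at bounded distance from the identity without fixed points. -/
structure FreeHomeo (G : ℂ ≃ₜ ℂ) : Prop where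
  bounded : ∃ c : ℝ, ∀ z, ‖G z - z‖ ≤ c
  ne_self : ∀ z, G z ≠ z

theorem exists_open_free_nhd {G : ℂ ≃ₜ ℂ} {K L : Set ℂ} (hK : IsCompact K) (hL : IsClosed L)
    (hKL : Disjoint K L) (hfree : ∀ z ∈ K, G z ∉ K) :
    ∃ O, IsOpen O ∧ K ⊆ O ∧ Disjoint O L ∧ Bornology.IsBounded O ∧ ∀ z ∈ O, G z ∉ O := by
  have hdisj : Disjoint K (G '' K) := by
    rw [Set.disjoint_left]
    rintro _ hz ⟨y, hy, rfl⟩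
    exact hfree y hy hz
  obtain ⟨U, V, hU, hV, hKU, hGV, hUV⟩ :=
    SeparatedNhds.of_isCompact_isCompact hK (hK.image G.continuous) hdisj
  refine ⟨(U ∩ G ⁻¹' V) ∩ (Lᶜ ∩ Metric.thickening 1 K),
    (hU.inter (hV.preimage G.continuous)).inter (hL.isOpen_compl.inter Metric.isOpen_thickening),
    ?_, ?_, ?_, ?_⟩
  · intro z hz
    exact ⟨⟨hKU hz, hGV ⟨z, hz, rfl⟩⟩, Set.disjoint_left.1 hKL hz,
      Metric.self_subset_thickening one_pos K hz⟩
  · rw [Set.disjoint_left]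
    intro z hz
    exact hz.2.1
  · exact (hK.isBounded.thickening (δ := 1)).subset fun z hz => hz.2.2
  · intro z hz hGz
    exact Set.disjoint_left.1 hUV hGz.1.1 hz.1.2

theorem FreeHomeo.exists_push {G : ℂ ≃ₜ ℂ} (hG : FreeHomeo G) {S L : Set ℂ} (hS : IsCompact S)
    (hS' : IsPreconnected S) (hL : IsClosed L) (hSL : Disjoint S L) (hfree : ∀ z ∈ S, G z ∉ S)
    {a b : ℂ} (ha : a ∈ S) (hb : b ∈ S) :
    ∃ φ : ℂ ≃ₜ ℂ, φ a = b ∧ (∀ z ∈ L, φ z = z) ∧ FreeHomeo (G.trans φ) := by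
  obtain ⟨O, hO, hSO, hOL, hOb, hOf⟩ := exists_open_free_nhd hS hL hSL hfree
  obtain ⟨φ, h1, h2⟩ := exists_homeomorph_push hS' hO hSO ha hb
  have hφO : ∀ z ∈ O, φ z ∈ O := by
    intro z hz
    by_contra h
    have := φ.injective (h2 _ h)
    exact h (this.symm ▸ hz)
  refine ⟨φ, h1, fun z hz => h2 z fun h => Set.disjoint_left.1 hOL h hz, ?_, ?_⟩
  · obtain ⟨c, hc⟩ := hG.bounded
    obtain ⟨D, hD⟩ := Metric.isBounded_iff.1 hOb
    refine ⟨max D 0 + c, fun z => ?_⟩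
    have h3 : ‖φ (G z) - G z‖ ≤ max D 0 := by
      by_cases h : G z ∈ O
      · rw [← dist_eq_norm]
        exact (hD (hφO _ h) h).trans (le_max_left _ _)
      · rw [h2 _ h]; simp
    have h4 : (G.trans φ) z - z = (φ (G z) - G z) + (G z - z) := by simp
    rw [h4]
    exact (norm_add_le _ _).trans (add_le_add h3 (hc z))
  · intro z hz
    change φ (G z) = z at hz
    by_cases h : G z ∈ O
    · have h5 := hφO _ h
      rw [hz] at h5
      exact hOf z h5 h
    · rw [h2 _ h] at hz
      exact hG.ne_self z hz

/-- A return to a free compact connected set can be closed up. -/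
theorem FreeHomeo.exists_periodic {G : ℂ ≃ₜ ℂ} (hG : FreeHomeo G) {S : Set ℂ} (hS : IsCompact S)
    (hS' : IsPreconnected S) (hfree : ∀ z ∈ S, G z ∉ S) {x : ℂ} (hx : x ∈ S) {j : ℕ} (hj : 1 ≤ j)
    (hjS : G^[j] x ∈ S) :
    ∃ G' : ℂ ≃ₜ ℂ, FreeHomeo G' ∧ ∃ i, 1 ≤ i ∧ i ≤ j ∧ G'^[i] x = x := by
  classical
  have hex : ∃ j, 1 ≤ j ∧ G^[j] x ∈ S := ⟨j, hj, hjS⟩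
  set i := Nat.find hex with hi
  obtain ⟨hi1, hiS⟩ := Nat.find_spec hex
  have hmin : ∀ k, 1 ≤ k → k < i → G^[k] x ∉ S := fun k h1 h2 h3 => Nat.find_min hex h2 ⟨h1, h3⟩
  set L : Set ℂ := (fun k => G^[k] x) '' (Finset.Ico 1 i : Set ℕ) with hL
  have hLfin : L.Finite := (Finset.finite_toSet _).image _
  obtain ⟨φ, h1, h2, h3⟩ := hG.exists_push hS hS' (L := L) hLfin.isClosed (by
    rw [Set.disjoint_left]
    rintro _ hz ⟨k, hk, rfl⟩
    simp only [Finset.coe_Ico, Set.mem_Ico] at hk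
    exact hmin k hk.1 hk.2 hz) hfree hiS hx
  refine ⟨G.trans φ, h3, i, hi1, Nat.find_min' hex ⟨hj, hjS⟩, ?_⟩
  have hit : ∀ k, k < i → (G.trans φ)^[k] x = G^[k] x := by
    intro k
    induction k with
    | zero => intro _; rfl
    | succ k ih =>
      intro hk
      rw [Function.iterate_succ_apply', ih (by omega), Homeomorph.trans_apply,
        ← Function.iterate_succ_apply' (⇑G)]
      exact h2 _ ⟨k + 1, by simp; omega, rfl⟩
  obtain ⟨k, hk⟩ : ∃ k, i = k + 1 := ⟨i - 1, by omega⟩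
  rw [hk, Function.iterate_succ_apply', hit k (by omega), Homeomorph.trans_apply,
    ← Function.iterate_succ_apply' (⇑G), Nat.succ_eq_add_one, ← hk]
  exact h1

theorem isCompact_segment_complex (a b : ℂ) : IsCompact (segment ℝ a b) := by
  rw [segment_eq_image]
  exact isCompact_Icc.image (by fun_prop)

/-- A segment in a closed ball meets the sphere at most in its endpoints. -/
theorem eq_or_eq_of_mem_segment_of_mem_sphere {a b o z : ℂ} {r : ℝ} (ha : a ∈ Metric.closedBall o r)
    (hb : b ∈ Metric.closedBall o r) (hz : z ∈ segment ℝ a b) (hs : z ∈ Metric.sphere o r) :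
    z = a ∨ z = b := by
  by_cases hab : a = b
  · subst hab
    rw [segment_same] at hz
    exact Or.inl hz
  rw [← insert_endpoints_openSegment] at hz
  rcases hz with h | h | h
  · exact Or.inl h
  · exact Or.inr h
  · have := openSegment_subset_ball_of_ne ha hb hab h
    rw [Metric.mem_ball] at this
    rw [Metric.mem_sphere] at hs
    exact absurd this (by linarith)

/-- A maximal free ball: its boundary contains a point and its image. -/
theorem FreeHomeo.exists_maximal_ball {G : ℂ ≃ₜ ℂ} (hG : FreeHomeo G) (o : ℂ) :
    ∃ (r : ℝ) (w : ℂ), 0 < r ∧ w ∈ Metric.sphere o r ∧ G w ∈ Metric.sphere o r ∧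
      ∀ z ∈ Metric.closedBall o r, G z ∈ Metric.closedBall o r →
        z ∈ Metric.sphere o r ∧ G z ∈ Metric.sphere o r := by
  set m : ℂ → ℝ := fun z => max (dist z o) (dist (G z) o) with hm
  have hmc : Continuous m := by
    have := G.continuous
    fun_prop
  obtain ⟨w, hw⟩ := hmc.exists_forall_le (tendsto_atTop_mono (fun z => le_max_left _ _)
    (tendsto_dist_right_cocompact_atTop o))
  set r := m w with hr
  have hfree : ∀ z ∈ Metric.ball o r, G z ∉ Metric.ball o r := by
    intro z hz hGz
    have : m z < r := max_lt hz hGz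
    exact absurd (hw z) (not_le.2 this)
  have hr0 : 0 < r := by
    by_contra h
    have h1 : dist w o ≤ 0 := (le_max_left _ _).trans (not_lt.1 h)
    have h2 : dist (G w) o ≤ 0 := (le_max_right _ _).trans (not_lt.1 h)
    have h3 := dist_le_zero.1 h1
    have h4 := dist_le_zero.1 h2
    exact hG.ne_self w (h4.trans h3.symm)
  have hcl : closure (Metric.ball o r) = Metric.closedBall o r := closure_ball o hr0.ne'
  have hA : ∀ z ∈ Metric.closedBall o r, G z ∉ Metric.ball o r := by
    intro z hz hGz
    rw [← hcl] at hz
    obtain ⟨y, hy1, hy2⟩ := mem_closure_iff.1 hz (G ⁻¹' Metric.ball o r)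
      (Metric.isOpen_ball.preimage G.continuous) hGz
    exact hfree y hy2 hy1
  have hB : ∀ z ∈ Metric.ball o r, G z ∉ Metric.closedBall o r := by
    intro z hz hGz
    rw [← hcl] at hGz
    obtain ⟨y, hy1, hy2⟩ := mem_closure_iff.1 hGz (G.symm ⁻¹' Metric.ball o r)
      (Metric.isOpen_ball.preimage G.symm.continuous) (by simpa using hz)
    exact hfree (G.symm y) hy1 (by simpa using hy2)
  have key : ∀ z ∈ Metric.closedBall o r, G z ∈ Metric.closedBall o r →
      z ∈ Metric.sphere o r ∧ G z ∈ Metric.sphere o r := by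
    intro z hz hGz
    constructor
    · by_contra h
      exact hB z (lt_of_le_of_ne hz h) hGz
    · by_contra h
      exact hA z hz (lt_of_le_of_ne hGz h)
  have := key w (le_max_left (dist w o) (dist (G w) o)) (le_max_right (dist w o) (dist (G w) o))
  exact ⟨r, w, hr0, this.1, this.2, key⟩

/-- Brouwer: a homeomorphism of the plane at bounded distance from the identity and without fixed
points has no periodic points. -/
theorem FreeHomeo.iterate_ne {G : ℂ ≃ₜ ℂ} (hG : FreeHomeo G) {n : ℕ} (hn : 1 ≤ n) (x : ℂ) :
    G^[n] x ≠ x := by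
  induction n using Nat.strong_induction_on generalizing G x with
  | _ n ih =>
  intro hx
  have htwo : ∀ {G : ℂ ≃ₜ ℂ}, FreeHomeo G → ∀ y, G (G y) ≠ y := by
    intro G hG y
    obtain ⟨c, hc⟩ := hG.bounded
    exact apply_apply_ne_of_bounded_displacement G.continuous G.injective hc hG.ne_self y
  obtain rfl | hn1 := hn.eq_or_lt
  · exact hG.ne_self x hx
  obtain rfl | hn2 := (Nat.succ_le_iff.2 hn1).eq_or_lt
  · exact htwo hG x hx
  have harc : ∀ S : Set ℂ, IsCompact S → IsPreconnected S → (∀ z ∈ S, G z ∉ S) → x ∈ S →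
      ∀ j, 1 ≤ j → j < n → G^[j] x ∉ S := by
    intro S h1 h2 h3 h4 j hj hjn hjS
    obtain ⟨G', hG', i, hi1, hij, hi⟩ := hG.exists_periodic h1 h2 h3 h4 hj hjS
    exact ih i (by omega) hG' hi1 x hi
  obtain ⟨r, w, hr, hw, hy, hball⟩ := hG.exists_maximal_ball x
  have hxB : x ∈ Metric.closedBall x r := Metric.mem_closedBall_self hr.le
  have hxS : x ∉ Metric.sphere x r := by simp [hr.ne]
  have hwB := Metric.sphere_subset_closedBall hw
  have hyB := Metric.sphere_subset_closedBall hy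
  have hsub : ∀ {a b : ℂ}, a ∈ Metric.closedBall x r → b ∈ Metric.closedBall x r →
      segment ℝ a b ⊆ Metric.closedBall x r :=
    fun ha hb => (convex_closedBall x r).segment_subset ha hb
  have hfree : ∀ b ∈ Metric.sphere x r, ∀ z ∈ segment ℝ x b, G z ∉ segment ℝ x b := by
    intro b hb z hz hGz
    have hbB := Metric.sphere_subset_closedBall hb
    obtain ⟨h1, h2⟩ := hball z (hsub hxB hbB hz) (hsub hxB hbB hGz)
    have h3 := (eq_or_eq_of_mem_segment_of_mem_sphere hxB hbB hz h1).resolve_left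
      fun h => hxS (h ▸ h1)
    have h4 := (eq_or_eq_of_mem_segment_of_mem_sphere hxB hbB hGz h2).resolve_left
      fun h => hxS (h ▸ h2)
    exact hG.ne_self z (h4.trans h3.symm)
  have hseg : ∀ a b : ℂ, IsPreconnected (segment ℝ a b) :=
    fun a b => (convex_segment a b).isPreconnected
  by_cases hcase : ∃ p ∈ segment ℝ x w, G (G p) ∈ segment ℝ x (G w)
  · obtain ⟨p, hp, hp'⟩ := hcase
    have hpB := hsub hxB hwB hp
    have hpB' := hsub hxB hyB hp'
    have hpfree : ∀ z ∈ segment ℝ p (G (G p)), G z ∉ segment ℝ p (G (G p)) := by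
      intro z hz hGz
      obtain ⟨h1, h2⟩ := hball z (hsub hpB hpB' hz) (hsub hpB hpB' hGz)
      have h3 := eq_or_eq_of_mem_segment_of_mem_sphere hpB hpB' hz h1
      have h4 := eq_or_eq_of_mem_segment_of_mem_sphere hpB hpB' hGz h2
      have h5 : p ∈ Metric.sphere x r ∧ G (G p) ∈ Metric.sphere x r := by
        rcases h3 with h3 | h3 <;> rcases h4 with h4 | h4
        · exact absurd (h4.trans h3.symm) (hG.ne_self z)
        · exact ⟨h3 ▸ h1, h4 ▸ h2⟩
        · exact ⟨h4 ▸ h2, h3 ▸ h1⟩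
        · exact absurd (h4.trans h3.symm) (hG.ne_self z)
      have h6 := (eq_or_eq_of_mem_segment_of_mem_sphere hxB hwB hp h5.1).resolve_left
        fun h => hxS (h ▸ h5.1)
      have h7 := (eq_or_eq_of_mem_segment_of_mem_sphere hxB hyB hp' h5.2).resolve_left
        fun h => hxS (h ▸ h5.2)
      rw [h6] at h7
      exact hG.ne_self _ h7
    obtain ⟨G', hG', i, hi1, hi2, hi⟩ := hG.exists_periodic (isCompact_segment_complex _ _)
      (hseg _ _) hpfree (left_mem_segment ℝ p (G (G p))) (j := 2) (by norm_num)
      (right_mem_segment ℝ p (G (G p)))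
    interval_cases i
    · exact hG'.ne_self p hi
    · exact htwo hG' p hi
  · push Not at hcase
    have harcw := harc _ (isCompact_segment_complex x w) (hseg _ _) (hfree w hw)
      (left_mem_segment ℝ _ _)
    have harcy := harc _ (isCompact_segment_complex x (G w)) (hseg _ _) (hfree (G w) hy)
      (left_mem_segment ℝ _ _)
    set L : Set ℂ := (fun k => G^[k] x) '' (Finset.Ico 1 n : Set ℕ) with hL
    have hLfin : L.Finite := (Finset.finite_toSet _).image _
    set T : Set ℂ := (fun z => G (G z)) '' segment ℝ x w with hT
    have hTc : IsCompact T := (isCompact_segment_complex x w).image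
      (G.continuous.comp G.continuous)
    obtain ⟨φ, hφ1, hφ2, hφ3⟩ := hG.exists_push (isCompact_segment_complex x (G w)) (hseg _ _)
      (L := L ∪ T) (hLfin.isClosed.union hTc.isClosed) (by
        rw [Set.disjoint_left]
        rintro z hz (⟨k, hk, rfl⟩ | ⟨p, hp, rfl⟩)
        · simp only [Finset.coe_Ico, Set.mem_Ico] at hk
          exact harcy k hk.1 hk.2 hz
        · exact hcase p hp hz) (hfree _ hy) (left_mem_segment ℝ _ _) (right_mem_segment ℝ _ _)
    set L' : Set ℂ := (fun k => G^[k] x) '' (Finset.Ico 2 n : Set ℕ) with hL'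
    have hLfin' : L'.Finite := (Finset.finite_toSet _).image _
    obtain ⟨ψ, hψ1, hψ2, hψ3⟩ := hφ3.exists_push (S := G '' segment ℝ x w)
      ((isCompact_segment_complex x w).image G.continuous)
      ((hseg _ _).image _ G.continuous.continuousOn) hLfin'.isClosed (by
        rw [Set.disjoint_left]
        rintro _ ⟨p, hp, rfl⟩ ⟨k, hk, hkp⟩
        simp only [Finset.coe_Ico, Set.mem_Ico] at hk
        obtain ⟨k', rfl⟩ : ∃ k', k = k' + 1 := ⟨k - 1, by omega⟩
        simp only [Function.iterate_succ_apply'] at hkp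
        have := G.injective hkp
        exact harcw k' (by omega) (by omega) (this ▸ hp))
      (by
        rintro _ ⟨p, hp, rfl⟩ ⟨p', hp', hpp⟩
        rw [Homeomorph.trans_apply, hφ2 (G (G p)) (Or.inr ⟨p, hp, rfl⟩)] at hpp
        have := G.injective hpp
        exact hfree w hw p hp (this ▸ hp'))
      (a := G w) (b := G x) ⟨w, right_mem_segment ℝ _ _, rfl⟩ ⟨x, left_mem_segment ℝ _ _, rfl⟩
    set G' := (G.trans φ).trans ψ with hG'
    have hit : ∀ k, k + 1 < n → G'^[k] (G x) = G^[k + 1] x := by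
      intro k
      induction k with
      | zero => intro _; rfl
      | succ k ihk =>
        intro hk
        rw [Function.iterate_succ_apply', ihk (by omega)]
        change ψ (φ (G (G^[k + 1] x))) = _
        rw [← Function.iterate_succ_apply' (⇑G), hφ2, hψ2]
        · exact ⟨k + 1 + 1, by simp; omega, rfl⟩
        · exact Or.inl ⟨k + 1 + 1, by simp; omega, rfl⟩
    obtain ⟨k, rfl⟩ : ∃ k, n = k + 2 := ⟨n - 2, by omega⟩
    refine ih (k + 1) (by omega) hψ3 (by omega) (G x) ?_
    rw [Function.iterate_succ_apply', hit k (by omega)]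
    change ψ (φ (G (G^[k + 1] x))) = _
    rw [← Function.iterate_succ_apply' (⇑G), hx, hφ1, hψ1]

/-- Such a homeomorphism has no recurrent points. -/
theorem FreeHomeo.not_recurrent {G : ℂ ≃ₜ ℂ} (hG : FreeHomeo G) (z : ℂ) :
    ∃ ε > 0, ∀ n, 1 ≤ n → ε ≤ ‖G^[n] z - z‖ := by
  obtain ⟨r, w, hr, -, -, hball⟩ := hG.exists_maximal_ball z
  refine ⟨r / 2, by positivity, fun n hn => ?_⟩
  by_contra h
  push Not at h
  have hsub : Metric.closedBall z (r / 2) ⊆ Metric.ball z r :=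
    Metric.closedBall_subset_ball (by linarith)
  obtain ⟨G', hG', i, hi1, -, hi⟩ := hG.exists_periodic (isCompact_closedBall z (r / 2))
    (convex_closedBall z (r / 2)).isPreconnected (by
      intro y hy hGy
      have h1 := hsub hy
      have h2 := (hball y (Metric.ball_subset_closedBall h1)
        (Metric.ball_subset_closedBall (hsub hGy))).1
      rw [Metric.mem_ball] at h1
      rw [Metric.mem_sphere] at h2
      linarith) (Metric.mem_closedBall_self (by positivity)) hn
    (by rw [Metric.mem_closedBall, dist_eq_norm]; exact h.le)
  exact hG'.iterate_ne hi1 z hi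

theorem continuousAt_mul_indicator {P Q : Set ℂ} (hP : IsOpen P) (hQ : IsOpen Q)
    (hPQ : Disjoint P Q) {v : ℂ → ℂ} (hv : Continuous v) {z : ℂ} (hz : z ∈ P ∨ z ∈ Q ∨ v z = 0) :
    ContinuousAt (fun z => v z * Q.indicator 1 z) z := by
  rcases hz with hz | hz | hz
  · refine (continuousAt_const (y := (0 : ℂ))).congr ?_
    filter_upwards [hP.mem_nhds hz] with w hw
    rw [Set.indicator_of_notMem (Set.disjoint_left.1 hPQ hw), mul_zero]
  · refine hv.continuousAt.congr ?_
    filter_upwards [hQ.mem_nhds hz] with w hw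
    rw [Set.indicator_of_mem hw, Pi.one_apply, mul_one]
  · rw [ContinuousAt, hz, zero_mul]
    have h0 : Tendsto (fun w => ‖v w‖) (𝓝 z) (𝓝 0) := by
      have := (hv.norm).tendsto z
      rwa [hz, norm_zero] at this
    refine squeeze_zero_norm (fun w => ?_) h0
    rw [norm_mul]
    refine mul_le_of_le_one_right (norm_nonneg _) ?_
    by_cases h : w ∈ Q <;> simp [h]

/-- Janiszewski: two points separated by the union of two disjoint closed sets are
separated by one of them. -/
theorem janiszewski {A B P Q : Set ℂ} (hA : IsClosed A) (hB : IsClosed B) (hAB : Disjoint A B)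
    (hP : IsOpen P) (hQ : IsOpen Q) (hPQ : Disjoint P Q) (hU : (A ∪ B)ᶜ ⊆ P ∪ Q)
    {S T : Set ℂ} (hS : IsPreconnected S) (hT : IsPreconnected T) (hSA : Disjoint S A)
    (hTB : Disjoint T B) {p q : ℂ} (hp : p ∈ P) (hq : q ∈ Q) (hpS : p ∈ S) (hqS : q ∈ S)
    (hpT : p ∈ T) (hqT : q ∈ T) : False := by
  obtain ⟨u, hu0, hu1, -⟩ := exists_continuous_zero_one_of_isClosed hA hB hAB
  set a : ℂ → ℂ := fun z => 2 * Real.pi * Complex.I * ((1 - (u z : ℂ)) * Q.indicator 1 z) with ha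
  set b : ℂ → ℂ := fun z => 2 * Real.pi * Complex.I * (-(u z : ℂ) * Q.indicator 1 z) with hb
  have hcase : ∀ z, z ∈ A ∨ z ∈ B ∨ z ∈ P ∨ z ∈ Q := by
    intro z
    by_cases h1 : z ∈ A ∪ B
    · rcases h1 with h | h
      · exact Or.inl h
      · exact Or.inr (Or.inl h)
    · exact Or.inr (Or.inr (hU h1))
  have huc : Continuous fun z => (u z : ℂ) := Complex.continuous_ofReal.comp u.continuous
  have hac : ∀ z, z ∉ A → ContinuousAt a z := by
    intro z hz
    refine continuousAt_const.mul (continuousAt_mul_indicator hP hQ hPQ (by fun_prop) ?_)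
    rcases hcase z with h | h | h | h
    · exact absurd h hz
    · right; right; simp [hu1 h]
    · exact Or.inl h
    · exact Or.inr (Or.inl h)
  have hbc : ∀ z, z ∉ B → ContinuousAt b z := by
    intro z hz
    refine continuousAt_const.mul (continuousAt_mul_indicator hP hQ hPQ (by fun_prop) ?_)
    rcases hcase z with h | h | h | h
    · right; right; simp [hu0 h]
    · exact absurd h hz
    · exact Or.inl h
    · exact Or.inr (Or.inl h)
  have hexp : ∀ z, Complex.exp (a z) = Complex.exp (b z) := by
    intro z
    by_cases h : z ∈ Q
    · have : a z = b z + 2 * Real.pi * Complex.I := by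
        simp only [ha, hb, Set.indicator_of_mem h, Pi.one_apply]
        ring
      rw [this, Complex.exp_periodic]
    · simp [ha, hb, h]
  have hgc : Continuous fun z => Complex.exp (a z) := by
    rw [continuous_iff_continuousAt]
    intro z
    by_cases h : z ∈ A
    · have h2 : (fun z => Complex.exp (a z)) = fun z => Complex.exp (b z) := funext hexp
      rw [h2]
      exact (hbc z (Set.disjoint_left.1 hAB h)).cexp
    · exact (hac z h).cexp
  obtain ⟨h, hc, hh⟩ := exists_continuous_log hgc (fun z => Complex.exp_ne_zero _)
  have h1 := hS.sub_eq_sub_of_exp_eq (a := a) (b := h)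
    (fun z hz => (hac z (Set.disjoint_left.1 hSA hz)).continuousWithinAt) hc.continuousOn
    (fun z _ => (hh z).symm) hpS hqS
  have h2 := hT.sub_eq_sub_of_exp_eq (a := b) (b := h)
    (fun z hz => (hbc z (Set.disjoint_left.1 hTB hz)).continuousWithinAt) hc.continuousOn
    (fun z _ => by rw [hh, hexp]) hpT hqT
  have hpQ : p ∉ Q := Set.disjoint_left.1 hPQ hp
  have h3 : a p - b p = a q - b q := by linear_combination h1 - h2
  simp only [ha, hb, Set.indicator_of_mem hq, Set.indicator_of_notMem hpQ, Pi.one_apply] at h3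
  have h4 : 2 * Real.pi * Complex.I = 0 := by linear_combination -h3
  exact Complex.two_pi_I_ne_zero h4

/-- The intersection of two connected open sets covering the plane is connected. -/
theorem IsPreconnected.inter_of_union_eq_univ {U V : Set ℂ} (hU : IsOpen U) (hV : IsOpen V)
    (hUc : IsPreconnected U) (hVc : IsPreconnected V) (hUV : U ∪ V = Set.univ) :
    IsPreconnected (U ∩ V) := by
  intro u v hu hv huv ⟨p, hp, hpu⟩ ⟨q, hq, hqv⟩
  by_contra hne
  rw [Set.not_nonempty_iff_eq_empty] at hne
  refine janiszewski (A := Uᶜ) (B := Vᶜ) (P := (U ∩ V) ∩ u) (Q := (U ∩ V) ∩ v) hU.isClosed_compl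
    hV.isClosed_compl ?_ ((hU.inter hV).inter hu) ((hU.inter hV).inter hv) ?_ ?_ hUc hVc
    disjoint_compl_right disjoint_compl_right ⟨hp, hpu⟩ ⟨hq, hqv⟩ hp.1 hq.1 hp.2 hq.2
  · rw [Set.disjoint_left]
    intro z h1 h2
    rcases (Set.eq_univ_iff_forall.1 hUV z) with h | h
    · exact h1 h
    · exact h2 h
  · rw [Set.disjoint_left]
    intro z h1 h2
    have : z ∈ (U ∩ V) ∩ (u ∩ v) := ⟨h1.1, h1.2, h2.2⟩
    rw [hne] at this
    exact this
  · intro z hz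
    simp only [Set.compl_union, compl_compl] at hz
    rcases huv hz with h | h
    · exact Or.inl ⟨hz, h⟩
    · exact Or.inr ⟨hz, h⟩

theorem one_sub_exp_mem_slitPlane {z w : ℂ} (h : w.im < z.im) :
    1 - Complex.exp (2 * Real.pi * Complex.I * (z - w)) ∈ Complex.slitPlane := by
  have h1 : ‖-Complex.exp (2 * Real.pi * Complex.I * (z - w))‖ < 1 := by
    rw [norm_neg, Complex.norm_exp, Real.exp_lt_one_iff]
    have : (2 * Real.pi * Complex.I * (z - w)).re = -(2 * Real.pi) * (z.im - w.im) := by simp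
    rw [this]
    have := Real.pi_pos
    nlinarith
  have := Complex.mem_slitPlane_of_norm_lt_one h1
  rwa [← sub_eq_add_neg] at this

theorem exp_two_pi_I_mul_add_int (z : ℂ) (n : ℤ) :
    Complex.exp (2 * Real.pi * Complex.I * (z + n)) = Complex.exp (2 * Real.pi * Complex.I * z) := by
  have : 2 * Real.pi * Complex.I * (z + n)
      = 2 * Real.pi * Complex.I * z + n * (2 * Real.pi * Complex.I) := by ring
  rw [this]
  exact Complex.exp_periodic.int_mul n _

theorem add_int_mem_iff {A : Set ℂ} (hA : ∀ z, z + 1 ∈ A ↔ z ∈ A) (n : ℤ) (z : ℂ) :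
    z + n ∈ A ↔ z ∈ A := by
  induction n using Int.induction_on with
  | zero => simp
  | succ k ih => rw [← ih, ← hA (z + (k : ℤ))]; push_cast; rw [add_assoc]
  | pred k ih => rw [← ih, ← hA (z + (-(k : ℤ) - 1 : ℤ))]; push_cast; rw [add_assoc]; ring_nf

/-- If a horizontally bounded, `1`-periodic set does not separate the top from the bottom of the
strip, then it carries a continuous integer-valued function measuring horizontal translation. -/
theorem exists_shift_coordinate {A : Set ℂ} (hA : ∀ z, z + 1 ∈ A ↔ z ∈ A) {M : ℝ}
    (hM : ∀ z ∈ A, |z.im| ≤ M) {x y : ℂ} (hx : M < x.im) (hy : y.im < -M) (hxy : JoinedIn Aᶜ x y) :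
    ∃ τ : ℂ → ℤ, ContinuousOn τ A ∧ ∀ z ∈ A, ∀ n : ℤ, τ (z + n) = τ z + n := by
  obtain ⟨δ, hδ⟩ := hxy
  set E : ℂ → ℂ := fun z => Complex.exp (2 * Real.pi * Complex.I * z) with hE
  have hEc : Continuous E := by fun_prop
  have hne : ∀ (t : unitInterval) (z : A), E z - E (δ t) ≠ 0 := by
    intro t z h
    rw [sub_eq_zero] at h
    obtain ⟨n, hn⟩ := Complex.exp_eq_exp_iff_exists_int.1 h
    have h2 : (z : ℂ) = δ t + n := by
      apply mul_left_cancel₀ Complex.two_pi_I_ne_zero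
      linear_combination hn
    apply hδ t
    rw [← add_int_mem_iff hA n, ← h2]
    exact z.2
  set H : C(unitInterval × A, {z : ℂ // z ≠ 0}) :=
    ⟨fun p => ⟨E p.2 - E (δ p.1), hne p.1 p.2⟩, by fun_prop⟩ with hH
  have hz1 : ∀ z : A, z.1.im < x.im := fun z => (le_abs_self _).trans_lt ((hM z z.2).trans_lt hx)
  have hz2 : ∀ z : A, y.im < z.1.im := fun z =>
    hy.trans_le (neg_le.1 ((neg_le_abs _).trans (hM z z.2)))
  set s : A → ℂ := fun z => 2 * Real.pi * Complex.I * z +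
    Complex.log (1 - Complex.exp (2 * Real.pi * Complex.I * (x - z))) with hs
  have hsc : Continuous s := by
    apply Continuous.add (by fun_prop)
    exact Continuous.clog (by fun_prop) fun z => one_sub_exp_mem_slitPlane (hz1 z)
  have hH0 : ∀ z : A, H (0, z) = (⟨_, (s z).exp_ne_zero⟩ : {z : ℂ // z ≠ 0}) := by
    intro z
    apply Subtype.ext
    simp only [hH, ContinuousMap.coe_mk, Path.source, hs, Complex.exp_add]
    rw [Complex.exp_log (Complex.slitPlane_ne_zero (one_sub_exp_mem_slitPlane (hz1 z))), mul_sub,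
      mul_one, ← Complex.exp_add, mul_sub, add_sub_cancel]
  set Λ := Complex.isCoveringMap_exp.liftHomotopy H ⟨s, hsc⟩ hH0 with hΛ
  have hΛ1 : ∀ t z, Complex.exp (Λ (t, z)) = E z - E (δ t) := by
    intro t z
    have := congrFun (Complex.isCoveringMap_exp.liftHomotopy_lifts H ⟨s, hsc⟩ hH0) (t, z)
    exact congrArg Subtype.val this
  have hΛ0 : ∀ z, Λ (0, z) = s z := Complex.isCoveringMap_exp.liftHomotopy_zero H ⟨s, hsc⟩ hH0
  set sh : ℤ → A → A := fun n z => ⟨z.1 + n, (add_int_mem_iff hA n z.1).2 z.2⟩ with hsh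
  have hΛs : ∀ (n : ℤ) (z : A), Λ (1, sh n z) = Λ (1, z) + n * (2 * Real.pi * Complex.I) := by
    intro n z
    have h1 := isPreconnected_univ.sub_eq_sub_of_exp_eq (a := fun t => Λ (t, sh n z))
      (b := fun t => Λ (t, z)) (by fun_prop) (by fun_prop) (by
        intro t _
        simp only [hΛ1, hsh, hE, exp_two_pi_I_mul_add_int]) (Set.mem_univ 1) (Set.mem_univ 0)
    have h2 : s (sh n z) - s z = n * (2 * Real.pi * Complex.I) := by
      simp only [hs, hsh]
      have : x - (z + n) = x - z + (-n : ℤ) := by push_cast; ring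
      rw [this, exp_two_pi_I_mul_add_int]
      ring
    simp only [hΛ0, h2] at h1
    linear_combination h1
  set κ : ℂ := 2 * Real.pi * Complex.I * y + Real.pi * Complex.I with hκ
  set μ : A → ℂ := fun z => κ + Complex.log (1 - Complex.exp (2 * Real.pi * Complex.I * (z - y)))
    with hμ
  have hμc : Continuous μ := by
    apply Continuous.add (by fun_prop)
    exact Continuous.clog (by fun_prop) fun z => one_sub_exp_mem_slitPlane (hz2 z)
  have hμe : ∀ z, Complex.exp (μ z) = Complex.exp (Λ (1, z)) := by
    intro z
    rw [hΛ1]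
    simp only [hμ, Complex.exp_add, hκ, Path.target, Complex.exp_pi_mul_I, hE]
    rw [Complex.exp_log (Complex.slitPlane_ne_zero (one_sub_exp_mem_slitPlane (hz2 z)))]
    have : Complex.exp (2 * Real.pi * Complex.I * z) = Complex.exp (2 * Real.pi * Complex.I * y)
        * Complex.exp (2 * Real.pi * Complex.I * (z - y)) := by
      rw [← Complex.exp_add]; ring_nf
    rw [this]; ring
  have hμs : ∀ n z, μ (sh n z) = μ z := by
    intro n z
    simp only [hμ, hsh]
    have : (z : ℂ) + n - y = z - y + n := by ring
    rw [this, exp_two_pi_I_mul_add_int]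
  have hex : ∀ z, ∃ n : ℤ, Λ (1, z) - μ z = n * (2 * Real.pi * Complex.I) := by
    intro z
    obtain ⟨n, hn⟩ := Complex.exp_eq_exp_iff_exists_int.1 (hμe z).symm
    exact ⟨n, by rw [hn]; ring⟩
  choose σ hσ using hex
  have hσc : Continuous σ := by
    have h1 : Continuous fun z => ((σ z : ℤ) : ℝ) := by
      have h2 : (fun z => ((σ z : ℤ) : ℝ)) = fun z => (Λ (1, z) - μ z).im / (2 * Real.pi) := by
        funext z
        rw [hσ z]
        have h : ((σ z : ℂ) * (2 * Real.pi * Complex.I)).im = σ z * (2 * Real.pi) := by simp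
        rw [h]
        have := Real.pi_ne_zero
        field_simp
      rw [h2]
      fun_prop
    exact (Int.isClosedEmbedding_coe_real.isInducing.continuous_iff).2 h1
  classical
  refine ⟨fun z => if h : z ∈ A then σ ⟨z, h⟩ else 0, ?_, ?_⟩
  · rw [continuousOn_iff_continuous_domRestrict]
    convert hσc using 1
    funext z
    simp
  · intro z hz n
    have h1 : z + n ∈ A := (add_int_mem_iff hA n z).2 hz
    simp only [hz, h1, dif_pos]
    have h2 := hσ (sh n ⟨z, hz⟩)
    rw [hΛs, hμs] at h2
    have h3 := hσ ⟨z, hz⟩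
    have h4 : ((σ (sh n ⟨z, hz⟩) : ℤ) : ℂ) = σ ⟨z, hz⟩ + n := by
      apply mul_right_cancel₀ Complex.two_pi_I_ne_zero
      linear_combination -h2 + h3
    exact_mod_cast h4

/-- A periodic set containing a connected set joining a point to a nontrivial horizontal translate
separates the top of the strip from its bottom. -/
theorem not_joinedIn_compl_of_isPreconnected {A S : Set ℂ} (hA : ∀ z, z + 1 ∈ A ↔ z ∈ A) {M : ℝ}
    (hM : ∀ z ∈ A, |z.im| ≤ M) {x y : ℂ} (hx : M < x.im) (hy : y.im < -M) (hS : IsPreconnected S)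
    (hSA : S ⊆ A) {z : ℂ} {k : ℤ} (hk : k ≠ 0) (hz : z ∈ S) (hzk : z + k ∈ S) :
    ¬ JoinedIn Aᶜ x y := by
  intro h
  obtain ⟨τ, hτ, hτs⟩ := exists_shift_coordinate hA hM hx hy h
  have h1 := hS.constant (hτ.mono hSA) hz hzk
  rw [hτs z (hSA hz)] at h1
  omega

/-- Adjacency in the triangular lattice on `ℤ × ℤ`. -/
def TriAdj (x y : ℤ × ℤ) : Prop :=
  y - x = (1, 0) ∨ y - x = (1, 1) ∨ y - x = (0, 1) ∨ y - x = (-1, 0) ∨ y - x = (-1, -1) ∨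
    y - x = (0, -1)

theorem TriAdj.symm {x y : ℤ × ℤ} (h : TriAdj x y) : TriAdj y x := by
  simp only [TriAdj, Prod.ext_iff, Prod.fst_sub, Prod.snd_sub] at h ⊢
  omega

theorem TriAdj.ne {x y : ℤ × ℤ} (h : TriAdj x y) : x ≠ y := by
  rintro rfl
  simp [TriAdj, Prod.ext_iff] at h

/-- The six directions of the triangular lattice in cyclic order. -/
def hexDir (i : ZMod 6) : ℤ × ℤ :=
  ![(1, 0), (1, 1), (0, 1), (-1, 0), (-1, -1), (0, -1)] i

theorem triAdj_iff_hexDir {x y : ℤ × ℤ} : TriAdj x y ↔ ∃ i, y = x + hexDir i := by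
  constructor
  · rintro (h | h | h | h | h | h)
    · exact ⟨0, by rw [← sub_eq_iff_eq_add', h]; rfl⟩
    · exact ⟨1, by rw [← sub_eq_iff_eq_add', h]; rfl⟩
    · exact ⟨2, by rw [← sub_eq_iff_eq_add', h]; rfl⟩
    · exact ⟨3, by rw [← sub_eq_iff_eq_add', h]; rfl⟩
    · exact ⟨4, by rw [← sub_eq_iff_eq_add', h]; rfl⟩
    · exact ⟨5, by rw [← sub_eq_iff_eq_add', h]; rfl⟩
  · rintro ⟨i, rfl⟩
    rw [TriAdj, add_sub_cancel_left]
    revert i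
    decide

theorem hexDir_sub_cases : ∀ s i j : ZMod 6, i ≠ s → j ≠ s →
    (∃ k, hexDir j = hexDir i + hexDir k) →
    (j = i + 1 ∧ (j - s).val = (i - s).val + 1) ∨ (i = j + 1 ∧ (i - s).val = (j - s).val + 1) := by
  decide

theorem hexDir_injective : Function.Injective hexDir := by
  intro i j
  revert i j
  decide

/-- A closed integer cochain on a set of vertices of the triangular lattice. -/
structure TriClosed (X : Set (ℤ × ℤ)) (j : ℤ × ℤ → ℤ × ℤ → ℤ) : Prop where
  antisymm : ∀ x ∈ X, ∀ y ∈ X, TriAdj x y → j y x = -j x y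
  triangle : ∀ x ∈ X, ∀ y ∈ X, ∀ z ∈ X, TriAdj x y → TriAdj y z → TriAdj x z →
    j x y + j y z = j x z

/-- A closed cochain has a potential on the link of a vertex with a missing neighbour. -/
theorem TriClosed.exists_link_potential {X : Set (ℤ × ℤ)} {j : ℤ × ℤ → ℤ × ℤ → ℤ}
    (hj : TriClosed X j) {y y' : ℤ × ℤ} (hyy' : TriAdj y y') (hy' : y' ∉ X) :
    ∃ c : ℤ × ℤ → ℤ, ∀ a ∈ X, ∀ b ∈ X, TriAdj y a → TriAdj y b → TriAdj a b →
      c a + j a b = c b := by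
  classical
  obtain ⟨s, rfl⟩ := triAdj_iff_hexDir.1 hyy'
  set C : ℕ → ℤ := fun n => ∑ t ∈ Finset.range n,
    j (y + hexDir (s + (t : ZMod 6))) (y + hexDir (s + (t : ZMod 6) + 1)) with hC
  have hCs : ∀ i : ZMod 6, C ((i - s).val + 1) =
      C (i - s).val + j (y + hexDir i) (y + hexDir (i + 1)) := by
    intro i
    simp only [hC, Finset.sum_range_succ, ZMod.natCast_val, ZMod.cast_id', id]
    rw [add_sub_cancel]
  have hinv : ∀ i, Function.invFun hexDir (hexDir i) = i :=
    Function.leftInverse_invFun hexDir_injective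
  refine ⟨fun a => C (Function.invFun hexDir (a - y) - s).val, ?_⟩
  intro a ha b hb hya hyb hab
  obtain ⟨i, rfl⟩ := triAdj_iff_hexDir.1 hya
  obtain ⟨k, rfl⟩ := triAdj_iff_hexDir.1 hyb
  have his : i ≠ s := by rintro rfl; exact hy' ha
  have hks : k ≠ s := by rintro rfl; exact hy' hb
  simp only [add_sub_cancel_left, hinv]
  obtain ⟨l, hl⟩ := triAdj_iff_hexDir.1 hab
  rcases hexDir_sub_cases s i k his hks ⟨l, by rw [add_assoc] at hl; exact add_left_cancel hl⟩ with
    ⟨h1, h2⟩ | ⟨h1, h2⟩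
  · rw [h2, hCs, h1]
  · have := hCs k
    rw [← h1] at this
    rw [h2, this, hj.antisymm _ ha _ hb hab]
    ring

theorem exists_int_primitive (f : ℤ → ℤ) : ∃ u : ℤ → ℤ, ∀ n, u n + f n = u (n + 1) := by
  refine ⟨fun n => ∑ i ∈ Finset.Ico 0 n, f i - ∑ i ∈ Finset.Ico n 0, f i, fun n => ?_⟩
  dsimp only
  rcases le_or_gt 0 n with h | h
  · rw [Finset.Ico_eq_empty (a := n) (b := 0) (by omega),
      Finset.Ico_eq_empty (a := n + 1) (b := 0) (by omega)]
    have : Finset.Ico 0 (n + 1) = insert n (Finset.Ico 0 n) := by ext; simp; omega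
    rw [this, Finset.sum_insert (by simp)]
    simp; ring
  · rw [Finset.Ico_eq_empty (a := 0) (b := n) (by omega),
      Finset.Ico_eq_empty (a := 0) (b := n + 1) (by omega)]
    have : Finset.Ico n 0 = insert n (Finset.Ico (n + 1) 0) := by ext; simp; omega
    rw [this, Finset.sum_insert (by simp)]
    simp

/-- The box `[-R, R]²` in the lattice. -/
def latticeBox (R : ℤ) : Finset (ℤ × ℤ) := Finset.Icc (-R) R ×ˢ Finset.Icc (-R) R

theorem mem_latticeBox {R : ℤ} {x : ℤ × ℤ} :
    x ∈ latticeBox R ↔ (-R ≤ x.1 ∧ x.1 ≤ R) ∧ -R ≤ x.2 ∧ x.2 ≤ R := by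
  simp [latticeBox]

/-- Closed cochains on a box have a potential. -/
theorem TriClosed.exists_potential_box {R : ℤ} {j : ℤ × ℤ → ℤ × ℤ → ℤ}
    (hj : TriClosed (latticeBox R) j) :
    ∃ k : ℤ × ℤ → ℤ, ∀ x ∈ latticeBox R, ∀ y ∈ latticeBox R, TriAdj x y → k x + j x y = k y := by
  obtain ⟨u, hu⟩ := exists_int_primitive fun a => j (a, -R) (a + 1, -R)
  choose v hv using fun a => exists_int_primitive fun b => j (a, b) (a, b + 1)
  set k : ℤ × ℤ → ℤ := fun x => u x.1 + (v x.1 x.2 - v x.1 (-R)) with hk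
  have hvert : ∀ a b, k (a, b) + j (a, b) (a, b + 1) = k (a, b + 1) := by
    intro a b
    have := hv a b
    simp only [hk]
    linarith
  have adj10 : ∀ a b : ℤ, TriAdj (a, b) (a + 1, b) := by intro a b; simp [TriAdj]
  have adj11 : ∀ a b : ℤ, TriAdj (a, b) (a + 1, b + 1) := by intro a b; simp [TriAdj]
  have adj01 : ∀ a b : ℤ, TriAdj (a, b) (a, b + 1) := by intro a b; simp [TriAdj]
  have htri1 : ∀ a b : ℤ, (a, b) ∈ latticeBox R → (a + 1, b + 1) ∈ latticeBox R →
      j (a, b) (a + 1, b) + j (a + 1, b) (a + 1, b + 1) = j (a, b) (a + 1, b + 1) := by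
    intro a b h1 h2
    refine hj.triangle _ h1 _ ?_ _ h2 (adj10 _ _) (adj01 _ _) (adj11 _ _)
    simp only [Finset.mem_coe, mem_latticeBox] at h1 h2 ⊢
    omega
  have htri2 : ∀ a b : ℤ, (a, b) ∈ latticeBox R → (a + 1, b + 1) ∈ latticeBox R →
      j (a, b) (a, b + 1) + j (a, b + 1) (a + 1, b + 1) = j (a, b) (a + 1, b + 1) := by
    intro a b h1 h2
    refine hj.triangle _ h1 _ ?_ _ h2 (adj01 _ _) (adj10 _ _) (adj11 _ _)
    simp only [Finset.mem_coe, mem_latticeBox] at h1 h2 ⊢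
    omega
  have hhor : ∀ a b, (a, b) ∈ latticeBox R → (a + 1, b) ∈ latticeBox R →
      k (a, b) + j (a, b) (a + 1, b) = k (a + 1, b) := by
    intro a b h1 h2
    have hb : -R ≤ b := (mem_latticeBox.1 h1).2.1
    induction b, hb using Int.leInduction with
    | base => simp only [hk]; linarith [hu a]
    | succ b hb ih =>
      have h1' : (a, b) ∈ latticeBox R := by
        simp only [mem_latticeBox] at h1 ⊢; omega
      have h2' : (a + 1, b) ∈ latticeBox R := by
        simp only [mem_latticeBox] at h2 ⊢; omega
      have := ih h1' h2'
      have := htri1 a b h1' h2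
      have := htri2 a b h1' h2
      have := hvert a b
      have := hvert (a + 1) b
      linarith
  have hdiag : ∀ a b, (a, b) ∈ latticeBox R → (a + 1, b + 1) ∈ latticeBox R →
      k (a, b) + j (a, b) (a + 1, b + 1) = k (a + 1, b + 1) := by
    intro a b h1 h2
    have h3 : (a + 1, b) ∈ latticeBox R := by
      simp only [mem_latticeBox] at h1 h2 ⊢; omega
    have := hhor a b h1 h3
    have := hvert (a + 1) b
    have := htri1 a b h1 h2
    linarith
  have hpos : ∀ x ∈ latticeBox R, ∀ y ∈ latticeBox R,
      (y - x = (1, 0) ∨ y - x = (1, 1) ∨ y - x = (0, 1)) → k x + j x y = k y := by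
    rintro ⟨a, b⟩ hx ⟨a', b'⟩ hy h
    simp only [Prod.ext_iff, Prod.fst_sub, Prod.snd_sub] at h
    rcases h with h | h | h
    · obtain ⟨rfl, rfl⟩ : a' = a + 1 ∧ b' = b := by omega
      exact hhor _ _ hx hy
    · obtain ⟨rfl, rfl⟩ : a' = a + 1 ∧ b' = b + 1 := by omega
      exact hdiag _ _ hx hy
    · obtain ⟨rfl, rfl⟩ : a' = a ∧ b' = b + 1 := by omega
      exact hvert _ _
  refine ⟨k, fun x hx y hy hxy => ?_⟩
  by_cases h : y - x = (1, 0) ∨ y - x = (1, 1) ∨ y - x = (0, 1)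
  · exact hpos x hx y hy h
  · have h1 := hpos y hy x hx (by
      simp only [TriAdj, Prod.ext_iff, Prod.fst_sub, Prod.snd_sub] at hxy h ⊢
      omega)
    have h2 := hj.antisymm x hx y hy hxy
    linarith

/-- Closed cochains have a potential if every missing vertex of a box escapes from the box. -/
theorem TriClosed.exists_potential {R : ℤ} {d : ℤ × ℤ → ℕ} {X : Finset (ℤ × ℤ)}
    (hX : X ⊆ latticeBox R)
    (hd : ∀ y ∈ latticeBox R, y ∉ X → ∃ y', TriAdj y y' ∧ y' ∉ X ∧ d y' < d y)
    {j : ℤ × ℤ → ℤ × ℤ → ℤ} (hj : TriClosed X j) :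
    ∃ k : ℤ × ℤ → ℤ, ∀ x ∈ X, ∀ y ∈ X, TriAdj x y → k x + j x y = k y := by
  classical
  induction hn : (latticeBox R \ X).card generalizing X j with
  | zero =>
    have : latticeBox R = X :=
      (Finset.sdiff_eq_empty_iff_subset.1 (Finset.card_eq_zero.1 hn)).antisymm hX
    subst this
    exact hj.exists_potential_box
  | succ n ih =>
    have hne : (latticeBox R \ X).Nonempty := by
      rw [← Finset.card_pos]; omega
    obtain ⟨y, hy, hmax⟩ := Finset.exists_max_image _ d hne
    rw [Finset.mem_sdiff] at hy
    obtain ⟨y', hyy', hy'X, hdy⟩ := hd y hy.1 hy.2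
    obtain ⟨c, hc⟩ := hj.exists_link_potential hyy' (by exact_mod_cast hy'X)
    set j' : ℤ × ℤ → ℤ × ℤ → ℤ := fun a b => if a = y then c b else if b = y then -c a else j a b
      with hj'
    have hj'j : ∀ a ∈ X, ∀ b ∈ X, j' a b = j a b := by
      intro a ha b hb
      have h1 : a ≠ y := by rintro rfl; exact hy.2 ha
      have h2 : b ≠ y := by rintro rfl; exact hy.2 hb
      simp [hj', h1, h2]
    have hjy : ∀ b, j' y b = c b := by intro b; simp [hj']
    have hjy' : ∀ a, a ≠ y → j' a y = -c a := by intro a ha; simp [hj', ha]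
    have hclosed : TriClosed (insert y X : Finset (ℤ × ℤ)) j' := by
      constructor
      · intro a ha b hb hab
        rw [Finset.mem_coe, Finset.mem_insert] at ha hb
        rcases ha with rfl | ha
        · rw [hjy, hjy' b hab.ne.symm]
        · rcases hb with rfl | hb
          · rw [hjy, hjy' a hab.ne, neg_neg]
          · rw [hj'j _ ha _ hb, hj'j _ hb _ ha]
            exact hj.antisymm a ha b hb hab
      · intro a ha b hb e he hab hbe hae
        rw [Finset.mem_coe, Finset.mem_insert] at ha hb he
        rcases ha with rfl | ha
        · have hb := hb.resolve_left hab.ne.symm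
          have he := he.resolve_left hae.ne.symm
          rw [hjy, hjy, hj'j _ hb _ he]
          exact hc b hb e he hab hae hbe
        · rcases hb with rfl | hb
          · have he := he.resolve_left hbe.ne.symm
            rw [hjy, hjy' a hab.ne, hj'j _ ha _ he]
            have := hc a ha e he hab.symm hbe hae
            linarith
          · rcases he with rfl | he
            · rw [hjy' a hae.ne, hjy' b hbe.ne, hj'j _ ha _ hb]
              have := hc a ha b hb hae.symm hbe.symm hab
              linarith
            · rw [hj'j _ ha _ hb, hj'j _ hb _ he, hj'j _ ha _ he]
              exact hj.triangle a ha b hb e he hab hbe hae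
    obtain ⟨k, hk⟩ := ih (X := insert y X) (j := j')
      (Finset.insert_subset_iff.2 ⟨hy.1, hX⟩) (by
        intro z hz hzX
        rw [Finset.mem_insert, not_or] at hzX
        obtain ⟨z', h1, h2, h3⟩ := hd z hz hzX.2
        refine ⟨z', h1, ?_, h3⟩
        rw [Finset.mem_insert, not_or]
        refine ⟨?_, h2⟩
        rintro rfl
        have := hmax z (Finset.mem_sdiff.2 ⟨hz, hzX.2⟩)
        omega) hclosed (by
        have h1 : latticeBox R \ insert y X = (latticeBox R \ X).erase y := by
          ext z; simp only [Finset.mem_sdiff, Finset.mem_insert, Finset.mem_erase]; tauto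
        rw [h1, Finset.card_erase_of_mem (Finset.mem_sdiff.2 hy), hn]
        rfl)
    refine ⟨k, fun a ha b hb hab => ?_⟩
    rw [← hj'j a ha b hb]
    exact hk a (Finset.mem_insert_of_mem ha) b (Finset.mem_insert_of_mem hb) hab

/-- The open star of a vertex of the triangular lattice. -/
def star₀ (x : ℤ × ℤ) : Set ℂ :=
  {z | |z.re - x.1| < 1 ∧ |z.im - x.2| < 1 ∧ |(z.re - x.1) - (z.im - x.2)| < 1}

theorem isOpen_star₀ (x : ℤ × ℤ) : IsOpen (star₀ x) := by
  have h1 : IsOpen {z : ℂ | |z.re - x.1| < 1} := isOpen_lt (by fun_prop) continuous_const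
  have h2 : IsOpen {z : ℂ | |z.im - x.2| < 1} := isOpen_lt (by fun_prop) continuous_const
  have h3 : IsOpen {z : ℂ | |(z.re - x.1) - (z.im - x.2)| < 1} :=
    isOpen_lt (by fun_prop) continuous_const
  exact h1.inter (h2.inter h3)

theorem convex_star₀ (x : ℤ × ℤ) : Convex ℝ (star₀ x) := by
  have key : ∀ p q a b : ℝ, |p| < 1 → |q| < 1 → 0 ≤ a → 0 ≤ b → a + b = 1 → |a * p + b * q| < 1 := by
    intro p q a b hp hq ha hb hab
    have := convex_ball (0 : ℝ) 1
      (x := p) (by simpa using hp) (y := q) (by simpa using hq) ha hb hab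
    simpa using this
  rintro z ⟨h1, h2, h3⟩ w ⟨h1', h2', h3'⟩ a b ha hb hab
  have hb' : b = 1 - a := by linarith
  simp only [star₀, Set.mem_ofPred_eq, Complex.add_re, Complex.add_im, Complex.smul_re,
    Complex.smul_im, smul_eq_mul]
  refine ⟨?_, ?_, ?_⟩
  · convert key _ _ a b h1 h1' ha hb hab using 2
    rw [hb']; ring
  · convert key _ _ a b h2 h2' ha hb hab using 2
    rw [hb']; ring
  · convert key _ _ a b h3 h3' ha hb hab using 2
    rw [hb']; ring

theorem center_mem_star₀ (x : ℤ × ℤ) : (⟨x.1, x.2⟩ : ℂ) ∈ star₀ x := by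
  simp [star₀]

theorem mem_star₀_floor (z : ℂ) : z ∈ star₀ (⌊z.re⌋, ⌊z.im⌋) := by
  have h1 := Int.floor_le z.re
  have h2 := Int.lt_floor_add_one z.re
  have h3 := Int.floor_le z.im
  have h4 := Int.lt_floor_add_one z.im
  refine ⟨?_, ?_, ?_⟩ <;> rw [abs_lt] <;> constructor <;> simp only <;> linarith

theorem eq_or_triAdj_of_mem_star₀ {x y : ℤ × ℤ} {z : ℂ} (hx : z ∈ star₀ x) (hy : z ∈ star₀ y) :
    x = y ∨ TriAdj x y := by
  obtain ⟨h1, h2, h3⟩ := hx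
  obtain ⟨h1', h2', h3'⟩ := hy
  rw [abs_lt] at h1 h2 h3 h1' h2' h3'
  have a1 : y.1 - x.1 < 2 := by
    have : (y.1 - x.1 : ℝ) < 2 := by linarith
    exact_mod_cast this
  have a2 : x.1 - y.1 < 2 := by
    have : (x.1 - y.1 : ℝ) < 2 := by linarith
    exact_mod_cast this
  have b1 : y.2 - x.2 < 2 := by
    have : (y.2 - x.2 : ℝ) < 2 := by linarith
    exact_mod_cast this
  have b2 : x.2 - y.2 < 2 := by
    have : (x.2 - y.2 : ℝ) < 2 := by linarith
    exact_mod_cast this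
  have c1 : (y.1 - x.1) - (y.2 - x.2) < 2 := by
    have : ((y.1 - x.1) - (y.2 - x.2) : ℝ) < 2 := by linarith
    exact_mod_cast this
  have c2 : (y.2 - x.2) - (y.1 - x.1) < 2 := by
    have : ((y.2 - x.2) - (y.1 - x.1) : ℝ) < 2 := by linarith
    exact_mod_cast this
  have h : (y.1 - x.1 = 0 ∧ y.2 - x.2 = 0) ∨ (y.1 - x.1 = 1 ∧ y.2 - x.2 = 0) ∨
      (y.1 - x.1 = 1 ∧ y.2 - x.2 = 1) ∨ (y.1 - x.1 = 0 ∧ y.2 - x.2 = 1) ∨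
      (y.1 - x.1 = -1 ∧ y.2 - x.2 = 0) ∨ (y.1 - x.1 = -1 ∧ y.2 - x.2 = -1) ∨
      (y.1 - x.1 = 0 ∧ y.2 - x.2 = -1) := by omega
  simp only [TriAdj, Prod.ext_iff, Prod.fst_sub, Prod.snd_sub]
  rcases h with h | h
  · left; omega
  · exact Or.inr h

theorem TriAdj.abs_le {x y : ℤ × ℤ} (h : TriAdj x y) :
    (|(y.1 : ℝ) - x.1| ≤ 1 ∧ |(y.2 : ℝ) - x.2| ≤ 1 ∧ |((y.1 : ℝ) - x.1) - (y.2 - x.2)| ≤ 1) := by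
  have h' : |y.1 - x.1| ≤ 1 ∧ |y.2 - x.2| ≤ 1 ∧ |(y.1 - x.1) - (y.2 - x.2)| ≤ 1 := by
    simp only [TriAdj, Prod.ext_iff, Prod.fst_sub, Prod.snd_sub] at h
    rcases h with ⟨h1, h2⟩ | ⟨h1, h2⟩ | ⟨h1, h2⟩ | ⟨h1, h2⟩ | ⟨h1, h2⟩ | ⟨h1, h2⟩ <;>
      rw [h1, h2] <;> decide
  exact_mod_cast h'

theorem centroid_mem_star₀ {x y z : ℤ × ℤ} (hxy : TriAdj x y) (hxz : TriAdj x z) :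
    (⟨(x.1 + y.1 + z.1) / 3, (x.2 + y.2 + z.2) / 3⟩ : ℂ) ∈ star₀ x := by
  obtain ⟨h1, h2, h3⟩ := hxy.abs_le
  obtain ⟨h1', h2', h3'⟩ := hxz.abs_le
  rw [abs_le] at h1 h2 h3 h1' h2' h3'
  refine ⟨?_, ?_, ?_⟩ <;> rw [abs_lt] <;> constructor <;> simp only <;> linarith

theorem midpoint_mem_star₀ {x y : ℤ × ℤ} (hxy : TriAdj x y) :
    (⟨(x.1 + y.1) / 2, (x.2 + y.2) / 2⟩ : ℂ) ∈ star₀ x := by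
  obtain ⟨h1, h2, h3⟩ := hxy.abs_le
  rw [abs_le] at h1 h2 h3
  refine ⟨?_, ?_, ?_⟩ <;> rw [abs_lt] <;> constructor <;> simp only <;> linarith

/-- The union of the open stars of a set of vertices. -/
def starUnion (X : Set (ℤ × ℤ)) : Set ℂ := ⋃ x ∈ X, star₀ x

theorem mem_starUnion {X : Set (ℤ × ℤ)} {z : ℂ} : z ∈ starUnion X ↔ ∃ x ∈ X, z ∈ star₀ x := by
  simp [starUnion]

theorem isOpen_starUnion (X : Set (ℤ × ℤ)) : IsOpen (starUnion X) :=
  isOpen_biUnion fun x _ => isOpen_star₀ x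

/-- If closed cochains on `X` have potentials, then nonvanishing continuous functions on the union
of the stars have logarithms. -/
theorem exists_log_starUnion {X : Set (ℤ × ℤ)}
    (hX : ∀ j : ℤ × ℤ → ℤ × ℤ → ℤ, TriClosed X j →
      ∃ k : ℤ × ℤ → ℤ, ∀ x ∈ X, ∀ y ∈ X, TriAdj x y → k x + j x y = k y)
    {g : ℂ → ℂ} (hg : ContinuousOn g (starUnion X)) (h0 : ∀ z ∈ starUnion X, g z ≠ 0) :
    ∃ h : ℂ → ℂ, ContinuousOn h (starUnion X) ∧ ∀ z ∈ starUnion X, Complex.exp (h z) = g z := by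
  classical
  have hsub : ∀ x ∈ X, star₀ x ⊆ starUnion X := fun x hx z hz => mem_starUnion.2 ⟨x, hx, hz⟩
  have hloc : ∀ x : ℤ × ℤ, ∃ h : ℂ → ℂ, x ∈ X →
      ContinuousOn h (star₀ x) ∧ ∀ z ∈ star₀ x, Complex.exp (h z) = g z := by
    intro x
    by_cases hx : x ∈ X
    · have : ContractibleSpace (star₀ x) :=
        (convex_star₀ x).contractibleSpace ⟨_, center_mem_star₀ x⟩
      have hs : IsSimplyConnected (star₀ x) := (inferInstance : SimplyConnectedSpace (star₀ x))
      obtain ⟨h, hc, he⟩ := Complex.exists_continuousOn_eqOn_exp_comp hs (isOpen_star₀ x)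
        (hg.mono (hsub x hx)) (by rintro ⟨z, hz, hz0⟩; exact h0 z (hsub x hx hz) hz0)
      exact ⟨h, fun _ => ⟨hc, fun z hz => he hz⟩⟩
    · exact ⟨0, fun h => absurd h hx⟩
  choose h hh using hloc
  have hjump : ∀ x y : ℤ × ℤ, ∃ n : ℤ, x ∈ X → y ∈ X →
      ∀ z ∈ star₀ x, z ∈ star₀ y → h x z - h y z = n * (2 * Real.pi * Complex.I) := by
    intro x y
    by_cases hne : x ∈ X ∧ y ∈ X ∧ (star₀ x ∩ star₀ y).Nonempty
    · obtain ⟨hx, hy, w, hw⟩ := hne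
      obtain ⟨n, hn⟩ := Complex.exp_eq_exp_iff_exists_int.1
        (((hh x hx).2 w hw.1).trans ((hh y hy).2 w hw.2).symm)
      refine ⟨n, fun _ _ z hzx hzy => ?_⟩
      have := ((convex_star₀ x).inter (convex_star₀ y)).isPreconnected.sub_eq_sub_of_exp_eq
        ((hh x hx).1.mono Set.inter_subset_left) ((hh y hy).1.mono Set.inter_subset_right)
        (fun z hz => ((hh x hx).2 z hz.1).trans ((hh y hy).2 z hz.2).symm) ⟨hzx, hzy⟩ hw
      rw [this, hn]; ring
    · refine ⟨0, fun hx hy z hzx hzy => absurd ⟨hx, hy, z, hzx, hzy⟩ hne⟩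
  choose j hj using hjump
  have hcancel : ∀ m n : ℤ, (m : ℂ) * (2 * Real.pi * Complex.I) = n * (2 * Real.pi * Complex.I) →
      m = n := by
    intro m n h
    exact_mod_cast mul_right_cancel₀ Complex.two_pi_I_ne_zero h
  obtain ⟨k, hk⟩ := hX j ⟨by
    intro x hx y hy hxy
    have h1 := midpoint_mem_star₀ hxy
    have h2 := midpoint_mem_star₀ hxy.symm
    rw [add_comm (y.1 : ℝ), add_comm (y.2 : ℝ)] at h2
    apply hcancel
    push_cast
    rw [neg_mul, ← hj x y hx hy _ h1 h2, ← hj y x hy hx _ h2 h1]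
    ring, by
    intro x hx y hy z hz hxy hyz hxz
    have h1 := centroid_mem_star₀ hxy hxz
    have h2 := centroid_mem_star₀ hxy.symm hyz
    have h3 := centroid_mem_star₀ hxz.symm hyz.symm
    have e2 : (⟨(y.1 + x.1 + z.1) / 3, (y.2 + x.2 + z.2) / 3⟩ : ℂ)
        = ⟨(x.1 + y.1 + z.1) / 3, (x.2 + y.2 + z.2) / 3⟩ := by congr 1 <;> ring
    have e3 : (⟨(z.1 + x.1 + y.1) / 3, (z.2 + x.2 + y.2) / 3⟩ : ℂ)
        = ⟨(x.1 + y.1 + z.1) / 3, (x.2 + y.2 + z.2) / 3⟩ := by congr 1 <;> ring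
    rw [e2] at h2
    rw [e3] at h3
    apply hcancel
    push_cast
    rw [add_mul, ← hj x y hx hy _ h1 h2, ← hj y z hy hz _ h2 h3, ← hj x z hx hz _ h1 h3]
    ring⟩
  have hglue : ∀ x ∈ X, ∀ y ∈ X, ∀ z ∈ star₀ x, z ∈ star₀ y →
      h x z + k x * (2 * Real.pi * Complex.I) = h y z + k y * (2 * Real.pi * Complex.I) := by
    intro x hx y hy z hzx hzy
    rcases eq_or_triAdj_of_mem_star₀ hzx hzy with rfl | hxy
    · rfl
    · rw [← hk x hx y hy hxy]
      have := hj x y hx hy z hzx hzy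
      push_cast
      linear_combination this
  have hcov : ∀ z, ∃ x, z ∈ starUnion X → x ∈ X ∧ z ∈ star₀ x := by
    intro z
    by_cases hz : z ∈ starUnion X
    · obtain ⟨x, hx⟩ := mem_starUnion.1 hz
      exact ⟨x, fun _ => hx⟩
    · exact ⟨0, fun h => absurd h hz⟩
  choose c hc using hcov
  refine ⟨fun z => h (c z) z + k (c z) * (2 * Real.pi * Complex.I), ?_, ?_⟩
  · intro z hz
    obtain ⟨hcX, hcs⟩ := hc z hz
    have h1 : ContinuousAt (fun w => h (c z) w + k (c z) * (2 * Real.pi * Complex.I)) z :=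
      (((hh _ hcX).1.continuousAt ((isOpen_star₀ _).mem_nhds hcs))).add continuousAt_const
    refine (h1.congr ?_).continuousWithinAt
    filter_upwards [(isOpen_star₀ _).mem_nhds hcs] with w hw
    obtain ⟨h2, h3⟩ := hc w (hsub _ hcX hw)
    exact hglue _ hcX _ h2 w hw h3
  · intro z hz
    obtain ⟨hcX, hcs⟩ := hc z hz
    have h2 : Complex.exp (h (c z) z + k (c z) * (2 * Real.pi * Complex.I)) =
        Complex.exp (h (c z) z) := Complex.exp_periodic.int_mul (k (c z)) _
    exact h2.trans ((hh _ hcX).2 z hcs)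

section

/-- Reachability in the triangular lattice by paths whose later vertices avoid `A`. -/
def LatReach (A : Set (ℤ × ℤ)) : ℤ × ℤ → ℤ × ℤ → Prop :=
  Relation.ReflTransGen fun a b => TriAdj a b ∧ b ∉ A

/-- The vertices outside `A` which can escape to the right in the complement of `A`. -/
def latOuter (A : Set (ℤ × ℤ)) : Set (ℤ × ℤ) :=
  {y | y ∉ A ∧ ∀ R : ℤ, ∃ w, R < w.1 ∧ LatReach A y w}

theorem triAdj_right (x : ℤ × ℤ) : TriAdj x (x + (1, 0)) := by
  simp [TriAdj]

theorem triAdj_up (x : ℤ × ℤ) : TriAdj x (x + (0, 1)) := by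
  simp [TriAdj]

theorem TriAdj.add_right {x y : ℤ × ℤ} (h : TriAdj x y) (v : ℤ × ℤ) : TriAdj (x + v) (y + v) := by
  simpa [TriAdj] using h

variable {A : Set (ℤ × ℤ)}

theorem latOuter_of_adj {y y' : ℤ × ℤ} (hy : y ∈ latOuter A) (h : TriAdj y y') (hy' : y' ∉ A) :
    y' ∈ latOuter A := by
  refine ⟨hy', fun R => ?_⟩
  obtain ⟨w, hw, hr⟩ := hy.2 R
  exact ⟨w, hw, Relation.ReflTransGen.head ⟨h.symm, hy.1⟩ hr⟩

theorem latReach_right {y : ℤ × ℤ} (h : ∀ i : ℕ, y + ((i : ℤ), 0) ∉ A) (n : ℕ) :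
    LatReach A y (y + ((n : ℤ), 0)) := by
  induction n with
  | zero => rw [Nat.cast_zero, Prod.mk_zero_zero, add_zero]; exact .refl
  | succ n ih =>
    refine ih.tail ⟨?_, h _⟩
    have := triAdj_right (y + ((n : ℤ), 0))
    simpa [add_assoc] using this

theorem mem_latOuter_of_right {y : ℤ × ℤ} (h : ∀ i : ℕ, y + ((i : ℤ), 0) ∉ A) : y ∈ latOuter A := by
  refine ⟨by simpa [Prod.mk_zero_zero] using h 0, fun R => ?_⟩
  refine ⟨_, ?_, latReach_right h (R - y.1 + 1).toNat⟩
  have := Int.self_le_toNat (R - y.1 + 1)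
  simp only [Prod.fst_add]
  lia

theorem mem_latOuter_of_notMem_box {R : ℤ} (hA : A ⊆ latticeBox R) {y : ℤ × ℤ}
    (hy : y ∉ latticeBox R) : y ∈ latOuter A := by
  have hA' : ∀ z ∈ A, (-R ≤ z.1 ∧ z.1 ≤ R) ∧ (-R ≤ z.2 ∧ z.2 ≤ R) := by
    intro z hz
    have := hA hz
    simp only [latticeBox, Finset.coe_product, Finset.coe_Icc, Set.mem_prod, Set.mem_Icc] at this
    exact this
  simp only [latticeBox, Finset.mem_product, Finset.mem_Icc] at hy
  by_cases h : R < y.1 ∨ R < y.2 ∨ y.2 < -R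
  · refine mem_latOuter_of_right fun i hi => ?_
    have := hA' _ hi
    simp only [Prod.fst_add, Prod.snd_add, add_zero] at this
    lia
  · have hy1 : y.1 < -R := by lia
    have key : ∀ n : ℕ, ∀ y : ℤ × ℤ, y.1 < -R → R - y.2 < n → y ∈ latOuter A := by
      intro n
      induction n with
      | zero =>
        intro y hy1 hy2
        refine mem_latOuter_of_right fun i hi => ?_
        have := hA' _ hi
        simp only [Prod.fst_add, Prod.snd_add, add_zero] at this
        push_cast at hy2
        lia
      | succ n ih =>
        intro y hy1 hy2
        refine latOuter_of_adj (ih (y + (0, 1)) (by simpa using hy1) ?_) (triAdj_up y).symm ?_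
        · simp only [Prod.snd_add]; push_cast at hy2; lia
        · intro hyA
          have := hA' _ hyA
          lia
    refine key (R - y.2 + 1).toNat y hy1 ?_
    have := Int.self_le_toNat (R - y.2 + 1)
    lia

theorem exists_right_mem {x : ℤ × ℤ} (hx : x ∉ latOuter A) :
    ∃ n : ℕ, x + ((n : ℤ), 0) ∈ A ∧ ∀ i : ℕ, i ≤ n → x + ((i : ℤ), 0) ∉ latOuter A := by
  classical
  have hex : ∃ n : ℕ, x + ((n : ℤ), 0) ∈ A := by
    by_contra! h
    exact hx (mem_latOuter_of_right h)
  refine ⟨Nat.find hex, Nat.find_spec hex, fun i => ?_⟩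
  induction i with
  | zero => intro _; simpa [Prod.mk_zero_zero] using hx
  | succ i ih =>
    intro hi hmem
    refine ih (by lia) (latOuter_of_adj hmem ?_ (Nat.find_min hex (by lia)))
    have := triAdj_right (x + ((i : ℤ), 0))
    refine TriAdj.symm ?_
    simpa [add_assoc] using this

theorem exists_latOuter_level {R : ℤ} :
    ∃ d : ℤ × ℤ → ℕ, ∀ y ∈ latticeBox R, y ∈ latOuter A →
      ∃ y', TriAdj y y' ∧ y' ∈ latOuter A ∧ d y' < d y := by
  classical
  let Lev : ℕ → Set (ℤ × ℤ) := fun n => Nat.rec {y | y ∉ latticeBox R}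
    (fun _ S => {y | ∃ y' ∈ latOuter A, TriAdj y y' ∧ y' ∈ S}) n
  refine ⟨fun y => sInf {n | y ∈ Lev n}, fun y hy hyO => ?_⟩
  have hne : ∃ n, y ∈ Lev n := by
    obtain ⟨w, hw, hr⟩ := hyO.2 R
    have hwb : w ∉ latticeBox R := by
      simp only [latticeBox, Finset.mem_product, Finset.mem_Icc]
      lia
    clear hy
    revert hyO
    refine Relation.ReflTransGen.head_induction_on hr ?_ ?_
    · exact fun _ => ⟨0, hwb⟩
    · intro a c hac _ ih ha
      have hc := latOuter_of_adj ha hac.1 hac.2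
      obtain ⟨n, hn⟩ := ih hc
      exact ⟨n + 1, c, hc, hac.1, hn⟩
  have hmem : sInf {n | y ∈ Lev n} ∈ {n | y ∈ Lev n} := Nat.sInf_mem hne
  rcases hm : sInf {n | y ∈ Lev n} with _ | n
  · rw [hm] at hmem
    exact absurd hy hmem
  · rw [hm] at hmem
    obtain ⟨y', hy', hadj, hL⟩ := hmem
    refine ⟨y', hadj, hy', ?_⟩
    show sInf {n | y' ∈ Lev n} < sInf {n | y ∈ Lev n}
    rw [hm]
    exact Nat.lt_succ_of_le (Nat.sInf_le hL)

theorem latReach_subset_latOuter {y w : ℤ × ℤ} (hy : y ∈ latOuter A) (h : LatReach A y w) :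
    Relation.ReflTransGen (fun a b => TriAdj a b ∧ b ∈ latOuter A) y w := by
  induction h using Relation.ReflTransGen.head_induction_on with
  | refl => exact .refl
  | head hac _ ih =>
    have hc := latOuter_of_adj hy hac.1 hac.2
    exact .head ⟨hac.1, hc⟩ (ih hc)

/-- A finite set cannot have a translate inside the region it encloses. -/
theorem not_forall_add_notMem_latOuter {R : ℤ} (hA : A ⊆ latticeBox R) (hne : A.Nonempty)
    {v : ℤ × ℤ} (hv : v ≠ 0) (h : ∀ a ∈ A, a + v ∉ latOuter A) : False := by
  have hsub : ∀ y ∈ latOuter A, y - v ∈ latOuter A := by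
    intro y hy
    refine ⟨fun hyA => h _ hyA (by simpa using hy), fun T => ?_⟩
    obtain ⟨w, hw, hr⟩ := hy.2 (T + v.1)
    refine ⟨w - v, by simp only [Prod.fst_sub]; lia, ?_⟩
    refine Relation.ReflTransGen.lift (p := fun a b => TriAdj a b ∧ b ∉ A) (fun z => z - v) ?_ _ _
      (latReach_subset_latOuter hy hr)
    intro a b hab
    refine ⟨by simpa [sub_eq_add_neg] using hab.1.add_right (-v), fun hbA => h _ hbA ?_⟩
    simpa using hab.2
  obtain ⟨a, ha⟩ := hne
  have hall : ∀ n : ℕ, a + (n : ℤ) • v ∉ latOuter A := by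
    intro n
    induction n with
    | zero => simpa using fun h' : a ∈ latOuter A => h'.1 ha
    | succ n ih =>
      intro hmem
      apply ih
      convert hsub _ hmem using 1
      push_cast
      rw [add_smul, one_smul]
      abel
  have hbox : ∀ n : ℕ, a + (n : ℤ) • v ∈ latticeBox R := fun n => by
    by_contra hb
    exact hall n (mem_latOuter_of_notMem_box hA hb)
  refine hv ?_
  have h0 := hbox 0
  have h1 := hbox (2 * R + 1).toNat
  have hR : ((2 * R + 1).toNat : ℤ) = 2 * R + 1 := Int.toNat_of_nonneg (by
    simp only [latticeBox, Finset.mem_product, Finset.mem_Icc] at h0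
    lia)
  rw [hR] at h1
  simp only [latticeBox, Finset.mem_product, Finset.mem_Icc, Prod.fst_add, Prod.snd_add,
    Prod.smul_fst, Prod.smul_snd, smul_eq_mul, Nat.cast_zero, zero_mul, add_zero] at h0 h1
  have hlem : ∀ t s : ℤ, -R ≤ s → s ≤ R → -R ≤ s + (2 * R + 1) * t → s + (2 * R + 1) * t ≤ R →
      t = 0 := by
    intro t s h1 h2 h3 h4
    by_contra ht
    rcases lt_or_gt_of_ne ht with ht | ht <;> nlinarith
  exact Prod.ext (hlem _ _ h0.1.1 h0.1.2 h1.1.1 h1.1.2) (hlem _ _ h0.2.1 h0.2.2 h1.2.1 h1.2.2)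

theorem add_mem_latOuter_of_forall {v : ℤ × ℤ} (h1 : ∀ a ∈ A, a + v ∈ latOuter A)
    (h2 : ∀ a ∈ A, a - v ∈ latOuter A) {x : ℤ × ℤ} (hx : x ∉ latOuter A) : x + v ∈ latOuter A := by
  obtain ⟨n, hn, hi⟩ := exists_right_mem hx
  have key : ∀ k : ℕ, k ≤ n → x + (((n - k : ℕ) : ℤ), 0) + v ∈ latOuter A := by
    intro k
    induction k with
    | zero => intro _; simpa using h1 _ hn
    | succ k ih =>
      intro hk
      refine latOuter_of_adj (ih (by lia)) (TriAdj.symm ?_) fun hmem => ?_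
      · have := (triAdj_right (x + (((n - (k + 1) : ℕ) : ℤ), 0))).add_right v
        have e : (((n - k : ℕ) : ℤ)) = ((n - (k + 1) : ℕ) : ℤ) + 1 := by lia
        rw [e]
        simpa [add_assoc] using this
      · have := h2 _ hmem
        rw [add_sub_cancel_right] at this
        exact hi _ (by lia) this
  simpa [Prod.mk_zero_zero] using key n le_rfl

/-- If a connected finite set of vertices is far from its translate, then so is the filled set. -/
theorem not_adj_add_of_notMem_latOuter {R : ℤ} (hA : A ⊆ latticeBox R) (hne : A.Nonempty)
    (hc : ∀ a ∈ A, ∀ b ∈ A, Relation.ReflTransGen (fun a b => TriAdj a b ∧ b ∈ A) a b)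
    {v : ℤ × ℤ} (hv : v ≠ 0) (hfar : ∀ a ∈ A, ∀ b ∈ A, a + v ≠ b ∧ ¬ TriAdj (a + v) b)
    {x y : ℤ × ℤ} (hx : x ∉ latOuter A) (hy : y ∉ latOuter A) :
    x + v ≠ y ∧ ¬ TriAdj (x + v) y := by
  have dich : ∀ v : ℤ × ℤ, v ≠ 0 → (∀ a ∈ A, ∀ b ∈ A, a + v ≠ b) → ∀ a ∈ A, a + v ∈ latOuter A := by
    intro v hv hfar
    have : ∃ a ∈ A, a + v ∈ latOuter A := by
      by_contra! h
      exact not_forall_add_notMem_latOuter hA hne hv h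
    obtain ⟨a, ha, hav⟩ := this
    intro b hb
    induction hc a ha b hb with
    | refl => exact hav
    | tail hab hbc ih =>
      rename_i b c
      have hbA : b ∈ A := by
        rcases Relation.ReflTransGen.cases_tail hab with h | ⟨_, _, h⟩
        · exact h ▸ ha
        · exact h.2
      exact latOuter_of_adj (ih hbA) (hbc.1.add_right v) fun h => hfar _ hb _ h rfl
  have h1 := dich v hv fun a ha b hb => (hfar a ha b hb).1
  have h2 : ∀ a ∈ A, a - v ∈ latOuter A := by
    intro a ha
    rw [sub_eq_add_neg]
    refine dich (-v) (neg_ne_zero.2 hv) (fun a ha b hb hab => (hfar b hb a ha).1 ?_) a ha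
    rw [← hab]; abel
  have hxv := add_mem_latOuter_of_forall h1 h2 hx
  refine ⟨fun h => hy (h ▸ hxv), fun hadj => ?_⟩
  have hyA : y ∈ A := by
    by_contra hyA
    exact hy (latOuter_of_adj hxv hadj hyA)
  have hyv := h2 y hyA
  have hadj' : TriAdj (y - v) x := by
    have := hadj.symm.add_right (-v)
    simpa [sub_eq_add_neg] using this
  have hxA : x ∈ A := by
    by_contra hxA
    exact hx (latOuter_of_adj hyv hadj' hxA)
  exact (hfar x hxA y hyA).2 hadj

/-- Reachability inside the filled set. -/
theorem reflTransGen_compl_latOuter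
    (hc : ∀ a ∈ A, ∀ b ∈ A, Relation.ReflTransGen (fun a b => TriAdj a b ∧ b ∈ A) a b)
    {x y : ℤ × ℤ} (hx : x ∉ latOuter A) (hy : y ∉ latOuter A) :
    Relation.ReflTransGen (fun a b => TriAdj a b ∧ a ∉ latOuter A ∧ b ∉ latOuter A) x y := by
  have hright : ∀ x, x ∉ latOuter A → ∃ a ∈ A,
      Relation.ReflTransGen (fun a b => TriAdj a b ∧ a ∉ latOuter A ∧ b ∉ latOuter A) x a := by
    intro x hx
    obtain ⟨n, hn, hi⟩ := exists_right_mem hx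
    refine ⟨_, hn, ?_⟩
    have key : ∀ k : ℕ, k ≤ n → Relation.ReflTransGen
        (fun a b => TriAdj a b ∧ a ∉ latOuter A ∧ b ∉ latOuter A) x (x + ((k : ℤ), 0)) := by
      intro k
      induction k with
      | zero => intro _; rw [Nat.cast_zero, Prod.mk_zero_zero, add_zero]
      | succ k ih =>
        intro hk
        refine (ih (by lia)).tail ⟨?_, hi k (by lia), hi _ hk⟩
        have := triAdj_right (x + ((k : ℤ), 0))
        simpa [add_assoc] using this
    exact key n le_rfl
  have hsymm : Std.Symm (fun a b => TriAdj a b ∧ a ∉ latOuter A ∧ b ∉ latOuter A) :=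
    ⟨fun a b h => ⟨h.1.symm, h.2.2, h.2.1⟩⟩
  obtain ⟨a, ha, hxa⟩ := hright x hx
  obtain ⟨b, hb, hyb⟩ := hright y hy
  refine (hxa.trans ?_).trans (Relation.ReflTransGen.stdSymm.symm _ _ hyb)
  clear hyb
  induction hc a ha b hb with
  | refl => exact .refl
  | tail hab hbc ih =>
    rename_i b c
    have hbA : b ∈ A := by
      rcases Relation.ReflTransGen.cases_tail hab with h | ⟨_, _, h⟩
      · exact h ▸ ha
      · exact h.2
    exact (ih hbA).tail ⟨hbc.1, fun h => h.1 hbA, fun h => h.1 hbc.2⟩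

/-- The vertices whose stars meet `K`. -/
def starHit (K : Set ℂ) : Set (ℤ × ℤ) := {x | (star₀ x ∩ K).Nonempty}

theorem starHit_connected {K : Set ℂ} (hK : IsPreconnected K) :
    ∀ a ∈ starHit K, ∀ b ∈ starHit K,
      Relation.ReflTransGen (fun a b => TriAdj a b ∧ b ∈ starHit K) a b := by
  intro a ha b hb
  by_contra hab
  let S : Set (ℤ × ℤ) :=
    {x | x ∈ starHit K ∧ Relation.ReflTransGen (fun a b => TriAdj a b ∧ b ∈ starHit K) a x}
  obtain ⟨z, hz⟩ := ha
  obtain ⟨w, hw⟩ := hb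
  obtain ⟨t, htK, ht1, ht2⟩ := hK (starUnion S) (starUnion (starHit K \ S)) (isOpen_starUnion _)
    (isOpen_starUnion _) (by
      intro z hz
      by_cases h : (⌊z.re⌋, ⌊z.im⌋) ∈ S
      · exact Or.inl (mem_starUnion.2 ⟨_, h, mem_star₀_floor z⟩)
      · exact Or.inr (mem_starUnion.2 ⟨_, ⟨⟨z, mem_star₀_floor z, hz⟩, h⟩, mem_star₀_floor z⟩))
    ⟨z, hz.2, mem_starUnion.2 ⟨a, ⟨⟨z, hz⟩, .refl⟩, hz.1⟩⟩
    ⟨w, hw.2, mem_starUnion.2 ⟨b, ⟨⟨w, hw⟩, fun h => hab h.2⟩, hw.1⟩⟩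
  obtain ⟨x, hx, htx⟩ := mem_starUnion.1 ht1
  obtain ⟨y, hy, hty⟩ := mem_starUnion.1 ht2
  rcases eq_or_triAdj_of_mem_star₀ htx hty with rfl | hadj
  · exact hy.2 hx
  · exact hy.2 ⟨hy.1, hx.2.tail ⟨hadj, hy.1⟩⟩

/-- A compact connected set has a bounded connected open neighbourhood on which nonvanishing
continuous functions have logarithms, and which is disjoint from its translates by those integer
vectors moving the compact set far away. -/
theorem exists_filled_neighbourhood {K : Set ℂ} (hK : IsCompact K) (hKc : IsConnected K) :
    ∃ V : Set ℂ, IsOpen V ∧ IsConnected V ∧ Bornology.IsBounded V ∧ K ⊆ V ∧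
      (∀ g : ℂ → ℂ, ContinuousOn g V → (∀ z ∈ V, g z ≠ 0) →
        ∃ h : ℂ → ℂ, ContinuousOn h V ∧ ∀ z ∈ V, Complex.exp (h z) = g z) ∧
      ∀ v : ℤ × ℤ, v ≠ 0 → (∀ z ∈ K, ∀ w ∈ K, 10 ≤ ‖z + ⟨v.1, v.2⟩ - w‖) →
        ∀ z ∈ V, z + ⟨v.1, v.2⟩ ∉ V := by
  classical
  obtain ⟨M, hM⟩ := hK.isBounded.exists_norm_le
  set A := starHit K with hA
  set R : ℤ := ⌈M⌉ + 1 with hR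
  have hAR : A ⊆ latticeBox R := by
    rintro x ⟨z, ⟨h1, h2, -⟩, hz⟩
    have hzM := hM z hz
    have hr := (Complex.abs_re_le_norm z).trans hzM
    have hi := (Complex.abs_im_le_norm z).trans hzM
    have hc := Int.le_ceil M
    rw [abs_lt] at h1 h2
    rw [abs_le] at hr hi
    simp only [latticeBox, Finset.coe_product, Finset.coe_Icc, Set.mem_prod, Set.mem_Icc, hR]
    have e1 : (-(⌈M⌉ + 1 : ℤ) : ℝ) ≤ x.1 := by push_cast; linarith
    have e2 : (x.1 : ℝ) ≤ (⌈M⌉ + 1 : ℤ) := by push_cast; linarith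
    have e3 : (-(⌈M⌉ + 1 : ℤ) : ℝ) ≤ x.2 := by push_cast; linarith
    have e4 : (x.2 : ℝ) ≤ (⌈M⌉ + 1 : ℤ) := by push_cast; linarith
    exact_mod_cast (⟨⟨e1, e2⟩, e3, e4⟩ :
      ((-(⌈M⌉ + 1 : ℤ) : ℝ) ≤ x.1 ∧ (x.1 : ℝ) ≤ (⌈M⌉ + 1 : ℤ)) ∧
      (-(⌈M⌉ + 1 : ℤ) : ℝ) ≤ x.2 ∧ (x.2 : ℝ) ≤ (⌈M⌉ + 1 : ℤ))
  have hKA : K ⊆ starUnion A := fun z hz =>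
    mem_starUnion.2 ⟨_, ⟨z, mem_star₀_floor z, hz⟩, mem_star₀_floor z⟩
  have hAne : A.Nonempty := by
    obtain ⟨z, hz⟩ := hKc.nonempty
    exact ⟨_, z, mem_star₀_floor z, hz⟩
  have hc := starHit_connected hKc.isPreconnected
  have hAsub : A ⊆ (latOuter A)ᶜ := fun a ha h => h.1 ha
  let X : Finset (ℤ × ℤ) := (latticeBox R).filter fun x => x ∉ latOuter A
  have hX : (X : Set (ℤ × ℤ)) = (latOuter A)ᶜ := by
    ext x
    simp only [X, Finset.coe_filter, Set.mem_ofPred_eq, Set.mem_compl_iff, and_iff_right_iff_imp]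
    intro hx
    by_contra hb
    exact hx (mem_latOuter_of_notMem_box hAR hb)
  refine ⟨starUnion (latOuter A)ᶜ, isOpen_starUnion _, ?_, ?_, ?_, ?_, ?_⟩
  · refine IsConnected.biUnion_of_reflTransGen (hAne.mono hAsub)
      (fun x _ => ⟨⟨_, center_mem_star₀ x⟩, (convex_star₀ x).isPreconnected⟩) fun x hx y hy => ?_
    refine Relation.ReflTransGen.mono (fun a b hab => ⟨⟨_, midpoint_mem_star₀ hab.1, ?_⟩, hab.2.1⟩)
      _ _ (reflTransGen_compl_latOuter hc hx hy)
    rw [add_comm (a.1 : ℝ), add_comm (a.2 : ℝ)]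
    exact midpoint_mem_star₀ hab.1.symm
  · rw [← hX, starUnion]
    refine (Bornology.isBounded_biUnion_finset X).2 fun x _ => ?_
    refine (Metric.isBounded_iff_subset_closedBall (⟨x.1, x.2⟩ : ℂ)).2 ⟨2, fun z hz => ?_⟩
    rw [mem_closedBall_iff_norm]
    refine (Complex.norm_le_abs_re_add_abs_im _).trans ?_
    have := hz.1
    have := hz.2.1
    simp only [Complex.sub_re, Complex.sub_im]
    linarith
  · intro z hz
    obtain ⟨x, hx, h⟩ := mem_starUnion.1 (hKA hz)
    exact mem_starUnion.2 ⟨x, hAsub hx, h⟩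
  · intro g hg h0
    refine exists_log_starUnion (fun j hj => ?_) hg h0
    obtain ⟨d, hd⟩ := exists_latOuter_level (A := A) (R := R)
    obtain ⟨k, hk⟩ := TriClosed.exists_potential (X := X) (R := R) (d := d)
      (Finset.filter_subset _ _) (fun y hy hyX => by
        have : y ∈ latOuter A := by
          by_contra h
          exact hyX (Finset.mem_filter.2 ⟨hy, h⟩)
        obtain ⟨y', h1, h2, h3⟩ := hd y hy this
        exact ⟨y', h1, fun h => (Finset.mem_filter.1 h).2 h2, h3⟩) (by rwa [hX])
    refine ⟨k, fun x hx y hy => hk x ?_ y ?_⟩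
    · rw [← hX] at hx; exact_mod_cast hx
    · rw [← hX] at hy; exact_mod_cast hy
  · intro v hv hfar z hz hzv
    obtain ⟨x, hx, hzx⟩ := mem_starUnion.1 hz
    obtain ⟨y, hy, hzy⟩ := mem_starUnion.1 hzv
    have hzx' : z + ⟨v.1, v.2⟩ ∈ star₀ (x + v) := by
      obtain ⟨h1, h2, h3⟩ := hzx
      simp only [star₀, Set.mem_ofPred_eq, Complex.add_re, Complex.add_im, Prod.fst_add,
        Prod.snd_add, Int.cast_add, add_sub_add_right_eq_sub]
      exact ⟨h1, h2, h3⟩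
    have hfar' : ∀ a ∈ A, ∀ b ∈ A, a + v ≠ b ∧ ¬ TriAdj (a + v) b := by
      rintro a ⟨z, hz, hzK⟩ b ⟨w, hw, hwK⟩
      have key : ¬ (|(b.1 : ℝ) - (a + v).1| ≤ 1 ∧ |(b.2 : ℝ) - (a + v).2| ≤ 1) := by
        rintro ⟨h1, h2⟩
        have h3 := hfar z hzK w hwK
        have h4 := Complex.norm_le_abs_re_add_abs_im (z + ⟨v.1, v.2⟩ - w)
        have z1 := hz.1
        have z2 := hz.2.1
        have w1 := hw.1
        have w2 := hw.2.1
        have e1 : |(z + ⟨v.1, v.2⟩ - w).re| ≤ 3 := by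
          simp only [Complex.sub_re, Complex.add_re]
          simp only [Prod.fst_add, Int.cast_add] at h1
          rw [abs_lt] at z1 w1
          rw [abs_le] at h1 ⊢
          constructor <;> linarith
        have e2 : |(z + ⟨v.1, v.2⟩ - w).im| ≤ 3 := by
          simp only [Complex.sub_im, Complex.add_im]
          simp only [Prod.snd_add, Int.cast_add] at h2
          rw [abs_lt] at z2 w2
          rw [abs_le] at h2 ⊢
          constructor <;> linarith
        linarith
      refine ⟨fun h => key ?_, fun h => key ⟨h.abs_le.1, h.abs_le.2.1⟩⟩
      rw [h]
      simp
    have := not_adj_add_of_notMem_latOuter hAR hAne hc hv hfar' hx hy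
    rcases eq_or_triAdj_of_mem_star₀ hzx' hzy with h | h
    · exact this.1 h
    · exact this.2 h

end

/-- The disc automorphism sending `w` to `0`. -/
def discShift (w z : ℂ) : ℂ := (z - w) / (1 - (starRingEnd ℂ) w * z)

theorem one_sub_conj_mul_ne_zero {w z : ℂ} (hw : ‖w‖ < 1) (hz : ‖z‖ < 1) :
    1 - (starRingEnd ℂ) w * z ≠ 0 := by
  intro h
  have h1 : (starRingEnd ℂ) w * z = 1 := (sub_eq_zero.1 h).symm
  have h2 : ‖w‖ * ‖z‖ = 1 := by simpa using congrArg norm h1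
  nlinarith [norm_nonneg w, norm_nonneg z]

theorem norm_discShift_lt_one {w z : ℂ} (hw : ‖w‖ < 1) (hz : ‖z‖ < 1) : ‖discShift w z‖ < 1 := by
  have hne := one_sub_conj_mul_ne_zero hw hz
  rw [discShift, norm_div, div_lt_one (norm_pos_iff.2 hne)]
  refine lt_of_pow_lt_pow_left₀ 2 (norm_nonneg _) ?_
  have hw2 : w.re * w.re + w.im * w.im < 1 := by
    rw [← Complex.normSq_apply, Complex.normSq_eq_norm_sq]
    nlinarith [norm_nonneg w]
  have hz2 : z.re * z.re + z.im * z.im < 1 := by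
    rw [← Complex.normSq_apply, Complex.normSq_eq_norm_sq]
    nlinarith [norm_nonneg z]
  rw [← Complex.normSq_eq_norm_sq, ← Complex.normSq_eq_norm_sq, Complex.normSq_apply,
    Complex.normSq_apply]
  simp only [Complex.sub_re, Complex.sub_im, Complex.one_re, Complex.one_im, Complex.mul_re,
    Complex.mul_im, Complex.conj_re, Complex.conj_im]
  nlinarith [mul_pos (sub_pos.2 hw2) (sub_pos.2 hz2)]

theorem discShift_neg_discShift {w z : ℂ} (hw : ‖w‖ < 1) (hz : ‖z‖ < 1) :
    discShift (-w) (discShift w z) = z := by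
  have h1 := one_sub_conj_mul_ne_zero hw hz
  have h3 := one_sub_conj_mul_ne_zero (w := -w) (by simpa using hw) (norm_discShift_lt_one hw hz)
  rw [discShift, div_eq_iff h3, discShift]
  rw [map_neg]
  have h4 : (z - w) / (1 - (starRingEnd ℂ) w * z) * (1 - (starRingEnd ℂ) w * z) = z - w :=
    div_mul_cancel₀ _ h1
  linear_combination h4

theorem discShift_self (w : ℂ) : discShift w w = 0 := by simp [discShift]

theorem differentiableOn_discShift {w : ℂ} (hw : ‖w‖ < 1) :
    DifferentiableOn ℂ (discShift w) (Metric.ball 0 1) := by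
  intro z hz
  have := one_sub_conj_mul_ne_zero hw (mem_ball_zero_iff.1 hz)
  unfold discShift
  fun_prop (disch := assumption)

theorem discShift_injOn {w : ℂ} (hw : ‖w‖ < 1) : Set.InjOn (discShift w) (Metric.ball 0 1) :=
  Set.LeftInvOn.injOn (f₁' := discShift (-w)) fun _ hz =>
    discShift_neg_discShift hw (mem_ball_zero_iff.1 hz)

/-- Strict Schwarz lemma for noninjective self-maps of the disc. -/
theorem norm_lt_of_not_injOn_ball {ψ : ℂ → ℂ} (hd : DifferentiableOn ℂ ψ (Metric.ball 0 1))
    (hm : Set.MapsTo ψ (Metric.ball 0 1) (Metric.ball 0 1)) (h0 : ψ 0 = 0)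
    (hni : ¬ Set.InjOn ψ (Metric.ball 0 1)) {z : ℂ} (hz : ‖z‖ < 1) (hz0 : z ≠ 0) :
    ‖ψ z‖ < ‖z‖ := by
  have hm' : Set.MapsTo ψ (Metric.ball 0 1) (Metric.closedBall (ψ 0) 1) := by
    rw [h0]; exact hm.mono_right Metric.ball_subset_closedBall
  have hzb : z ∈ Metric.ball (0 : ℂ) 1 := mem_ball_zero_iff.2 hz
  have hle := Complex.dist_le_div_mul_dist_of_mapsTo_ball hd hm' hzb
  rw [h0, dist_zero_right, dist_zero_right, div_one, one_mul] at hle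
  refine lt_of_le_of_ne hle fun heq => hni ?_
  obtain ⟨C, hC, hψ⟩ := Complex.affine_of_mapsTo_ball_of_exists_norm_dslope_eq_div' hd hm'
    ⟨z, hzb, by
      rw [dslope_of_ne _ hz0, slope_def_field, h0]
      simp [heq, hz0]⟩
  have hC0 : C ≠ 0 := by
    rintro rfl
    simp at hC
  intro x hx y hy hxy
  rw [hψ hx, hψ hy] at hxy
  simpa [hC0] using hxy

/-- A continuous logarithm of a holomorphic function is holomorphic. -/
theorem differentiableOn_of_exp_eq {V : Set ℂ} (hV : IsOpen V) {k l : ℂ → ℂ}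
    (hk : DifferentiableOn ℂ k V) (hl : ContinuousOn l V) (h : ∀ z ∈ V, Complex.exp (l z) = k z) :
    DifferentiableOn ℂ l V := by
  intro z hz
  refine DifferentiableAt.differentiableWithinAt ?_
  have hk0 : k z ≠ 0 := h z hz ▸ Complex.exp_ne_zero _
  have hkd : DifferentiableAt ℂ k z := hk.differentiableAt (hV.mem_nhds hz)
  have hd : DifferentiableAt ℂ (fun y => Complex.log (k y / k z) + l z) z := by
    refine DifferentiableAt.add_const _ (DifferentiableAt.clog (hkd.div_const _) ?_)
    rw [div_self hk0]
    exact Complex.one_mem_slitPlane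
  refine hd.congr_of_eventuallyEq ?_
  have hc : ContinuousAt l z := hl.continuousAt (hV.mem_nhds hz)
  filter_upwards [hV.mem_nhds hz, hc (Metric.ball_mem_nhds _ zero_lt_one)] with y hy hly
  have hlt : |(l y - l z).im| < 1 :=
    (Complex.abs_im_le_norm _).trans_lt (by simpa [dist_eq_norm] using hly)
  rw [abs_lt] at hlt
  have hpi := Real.pi_gt_three
  rw [← h y hy, ← h z hz, ← Complex.exp_sub, Complex.log_exp (by linarith) (by linarith)]
  ring

/-- The holomorphic injections of `V` into the disc sending `a` to `0`. -/
def discMaps (V : Set ℂ) (a : ℂ) : Set (ℂ → ℂ) :=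
  {h | DifferentiableOn ℂ h V ∧ Set.InjOn h V ∧ Set.MapsTo h V (Metric.ball 0 1) ∧ h a = 0}

theorem exists_discMaps_norm_lt {V : Set ℂ} {a b : ℂ} (hV : IsOpen V) (ha : a ∈ V) (hb : b ∈ V)
    (hab : a ≠ b)
    (hlog : ∀ g : ℂ → ℂ, ContinuousOn g V → (∀ z ∈ V, g z ≠ 0) →
      ∃ h : ℂ → ℂ, ContinuousOn h V ∧ ∀ z ∈ V, Complex.exp (h z) = g z)
    {h : ℂ → ℂ} (hh : h ∈ discMaps V a) {w : ℂ} (hw : ‖w‖ < 1) (hwh : w ∉ h '' V) :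
    ∃ h' ∈ discMaps V a, ‖h b‖ < ‖h' b‖ := by
  obtain ⟨hd, hinj, hm, h0⟩ := hh
  have hm' : ∀ z ∈ V, ‖h z‖ < 1 := fun z hz => mem_ball_zero_iff.1 (hm hz)
  have hkd : DifferentiableOn ℂ (fun z => discShift w (h z)) V :=
    (differentiableOn_discShift hw).comp hd hm
  obtain ⟨l, hl, hel⟩ := hlog _ hkd.continuousOn (by
    intro z hz hz0
    apply hwh
    refine ⟨z, hz, discShift_injOn hw (hm hz) (mem_ball_zero_iff.2 hw) ?_⟩
    rw [hz0, discShift_self])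
  have hld := differentiableOn_of_exp_eq hV hkd hl hel
  let g : ℂ → ℂ := fun z => Complex.exp (l z / 2)
  have hgd : DifferentiableOn ℂ g V := (hld.div_const 2).cexp
  have hg2 : ∀ z ∈ V, g z ^ 2 = discShift w (h z) := by
    intro z hz
    rw [← hel z hz, ← Complex.exp_nat_mul]
    congr 1
    push_cast
    ring
  have hg1 : ∀ z ∈ V, ‖g z‖ < 1 := by
    intro z hz
    have := norm_discShift_lt_one hw (hm' z hz)
    rw [← hg2 z hz, norm_pow] at this
    nlinarith [norm_nonneg (g z)]
  have hginj : Set.InjOn g V := by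
    intro x hx y hy hxy
    refine hinj hx hy (discShift_injOn hw (hm hx) (hm hy) ?_)
    rw [← hg2 x hx, ← hg2 y hy, hxy]
  set c := g a with hc
  have hc1 : ‖c‖ < 1 := hg1 a ha
  have hgm : Set.MapsTo g V (Metric.ball 0 1) := fun z hz => mem_ball_zero_iff.2 (hg1 z hz)
  have hnew : (fun z => discShift c (g z)) ∈ discMaps V a := by
    refine ⟨(differentiableOn_discShift hc1).comp hgd hgm, (discShift_injOn hc1).comp hginj hgm,
      fun z hz => mem_ball_zero_iff.2 (norm_discShift_lt_one hc1 (hg1 z hz)), discShift_self c⟩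
  refine ⟨_, hnew, ?_⟩
  let ψ : ℂ → ℂ := fun z => discShift (-w) (discShift (-c) z ^ 2)
  have hnw : ‖-w‖ < 1 := by simpa using hw
  have hnc : ‖-c‖ < 1 := by simpa using hc1
  have hsq : ∀ z : ℂ, ‖z‖ < 1 → ‖z ^ 2‖ < 1 := fun z hz => by
    rw [norm_pow]; nlinarith [norm_nonneg z]
  have hψh : ∀ z ∈ V, ψ (discShift c (g z)) = h z := by
    intro z hz
    simp only [ψ]
    rw [discShift_neg_discShift hc1 (hg1 z hz), hg2 z hz, discShift_neg_discShift hw (hm' z hz)]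
  have hψd : DifferentiableOn ℂ ψ (Metric.ball 0 1) := by
    refine (differentiableOn_discShift hnw).comp ((differentiableOn_discShift hnc).pow 2) ?_
    intro z hz
    exact mem_ball_zero_iff.2 (hsq _ (norm_discShift_lt_one hnc (mem_ball_zero_iff.1 hz)))
  have hψm : Set.MapsTo ψ (Metric.ball 0 1) (Metric.ball 0 1) := fun z hz =>
    mem_ball_zero_iff.2 (norm_discShift_lt_one hnw
      (hsq _ (norm_discShift_lt_one hnc (mem_ball_zero_iff.1 hz))))
  have hψ0 : ψ 0 = 0 := by
    have := hψh a ha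
    rwa [h0, ← hc, discShift_self] at this
  have hψni : ¬ Set.InjOn ψ (Metric.ball 0 1) := by
    intro hi
    have hhalf : ‖(1 / 2 : ℂ)‖ < 1 := by norm_num
    have hhalf' : ‖(-(1 / 2) : ℂ)‖ < 1 := by norm_num
    have e := hi (x₁ := discShift c (1 / 2)) (x₂ := discShift c (-(1 / 2)))
      (mem_ball_zero_iff.2 (norm_discShift_lt_one hc1 hhalf))
      (mem_ball_zero_iff.2 (norm_discShift_lt_one hc1 hhalf')) (by
        simp only [ψ]
        rw [discShift_neg_discShift hc1 hhalf, discShift_neg_discShift hc1 hhalf', neg_sq])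
    have := discShift_injOn hc1 (mem_ball_zero_iff.2 hhalf) (mem_ball_zero_iff.2 hhalf') e
    norm_num at this
  have hne : discShift c (g b) ≠ 0 := by
    intro h0'
    rw [← discShift_self c] at h0'
    exact hab (hginj ha hb (discShift_injOn hc1 (hgm hb) (hgm ha) h0').symm)
  have := norm_lt_of_not_injOn_ball hψd hψm hψ0 hψni (norm_discShift_lt_one hc1 (hg1 b hb)) hne
  rwa [hψh b hb] at this

/-- Compactness of families of holomorphic maps into the disc, along an ultrafilter. -/
theorem exists_limit_of_mapsTo_ball {V : Set ℂ} (hV : IsOpen V) (φ : Ultrafilter ℕ)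
    {H : ℕ → ℂ → ℂ} (hd : ∀ n, DifferentiableOn ℂ (H n) V)
    (hm : ∀ n, Set.MapsTo (H n) V (Metric.ball 0 1)) :
    ∃ h : ℂ → ℂ, (∀ z ∈ V, Tendsto (fun n => H n z) φ (𝓝 (h z))) ∧
      TendstoLocallyUniformlyOn H h φ V := by
  have hex : ∀ z, ∃ w, z ∈ V → Tendsto (fun n => H n z) φ (𝓝 w) := by
    intro z
    by_cases hz : z ∈ V
    · obtain ⟨w, -, hw⟩ := (isCompact_closedBall (0 : ℂ) 1).ultrafilter_le_nhds
        (φ.map fun n => H n z) (by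
          rw [le_principal_iff]
          exact Filter.mem_map.2 (Filter.univ_mem' fun n =>
            Metric.ball_subset_closedBall (hm n hz)))
      exact ⟨w, fun _ => hw⟩
    · exact ⟨0, fun h => absurd h hz⟩
  choose h hh using hex
  refine ⟨h, hh, ?_⟩
  rw [Metric.tendstoLocallyUniformlyOn_iff]
  intro ε hε x hx
  obtain ⟨R, hR, hRV⟩ := Metric.isOpen_iff.1 hV x hx
  have hlip : ∀ n, ∀ y ∈ Metric.ball x R, dist (H n y) (H n x) ≤ 2 / R * dist y x := by
    intro n y hy
    refine Complex.dist_le_div_mul_dist_of_mapsTo_ball ((hd n).mono hRV) (fun z hz => ?_) hy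
    have h1 := mem_ball_zero_iff.1 (hm n (hRV hz))
    have h2 := mem_ball_zero_iff.1 (hm n hx)
    rw [mem_closedBall_iff_norm]
    linarith [norm_sub_le (H n z) (H n x)]
  have hlip' : ∀ y ∈ Metric.ball x R, dist (h y) (h x) ≤ 2 / R * dist y x := fun y hy =>
    le_of_tendsto ((hh y (hRV hy)).dist (hh x hx)) (Filter.Eventually.of_forall fun n => hlip n y hy)
  refine ⟨Metric.ball x (min R (R * ε / 8)), mem_nhdsWithin_of_mem_nhds
    (Metric.ball_mem_nhds _ (by positivity)), ?_⟩
  filter_upwards [(hh x hx) (Metric.ball_mem_nhds _ (show 0 < ε / 4 by positivity))] with n hn y hy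
  have hyR : y ∈ Metric.ball x R := Metric.ball_subset_ball (min_le_left _ _) hy
  have hyε : dist y x < R * ε / 8 := Metric.ball_subset_ball (min_le_right _ _) hy
  have hs : 2 / R * dist y x < ε / 4 := by
    rw [div_mul_eq_mul_div, div_lt_iff₀ hR]
    nlinarith
  have h1 := hlip n y hyR
  have h2 := hlip' y hyR
  have h3 : dist (H n x) (h x) < ε / 4 := hn
  have h4 := dist_triangle4 (h y) (h x) (H n x) (H n y)
  rw [dist_comm (h x), dist_comm (H n x) (H n y)] at h4
  linarith

/-- Hurwitz: nonconstant limits of injective holomorphic maps are injective. -/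
theorem injOn_of_tendstoLocallyUniformlyOn {V : Set ℂ} (hV : IsOpen V) (hVc : IsPreconnected V)
    {φ : Filter ℕ} [φ.NeBot] {H : ℕ → ℂ → ℂ} {h : ℂ → ℂ} (hd : ∀ n, DifferentiableOn ℂ (H n) V)
    (hinj : ∀ n, Set.InjOn (H n) V) (hlim : TendstoLocallyUniformlyOn H h φ V)
    (hnc : ¬ ∃ w, ∀ z ∈ V, h z = w) : Set.InjOn h V := by
  have hhd : DifferentiableOn ℂ h V := hlim.differentiableOn (Filter.Eventually.of_forall hd) hV
  have han : AnalyticOnNhd ℂ h V := hhd.analyticOnNhd hV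
  intro x hx y hy hxy
  by_contra hne
  have hev : ∀ᶠ z in 𝓝[≠] y, h z ≠ h y := by
    rcases (han y hy).eventually_eq_or_eventually_ne (analyticAt_const (v := h y)) with h' | h'
    · exact absurd ⟨h y, han.eqOn_of_preconnected_of_eventuallyEq analyticOnNhd_const hVc hy h'⟩ hnc
    · exact h'
  have hnb : {z | z ≠ y → h z ≠ h y} ∩ (V ∩ {x}ᶜ) ∈ 𝓝 y :=
    inter_mem (eventually_nhdsWithin_iff.1 hev)
      (inter_mem (hV.mem_nhds hy) (isOpen_compl_singleton.mem_nhds (Ne.symm hne)))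
  obtain ⟨r, hr, hrs⟩ := Metric.nhds_basis_closedBall.mem_iff.1 hnb
  have hrV : Metric.closedBall y r ⊆ V := fun z hz => (hrs hz).2.1
  have hcs : IsCompact (Metric.sphere y r) := isCompact_sphere y r
  have hun := (tendstoLocallyUniformlyOn_iff_forall_isCompact hV).1 hlim _ hrV
    (isCompact_closedBall y r)
  have hsp : (Metric.sphere y r).Nonempty := (NormedSpace.sphere_nonempty).2 hr.le
  obtain ⟨z₀, hz₀, hmin⟩ := hcs.exists_isMinOn hsp (f := fun z => ‖h z - h y‖)
    ((hhd.continuousOn.mono (Metric.sphere_subset_closedBall.trans hrV)).sub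
      continuousOn_const).norm
  set m := ‖h z₀ - h y‖ with hm
  have hm0 : 0 < m := norm_pos_iff.2 (sub_ne_zero.2 ((hrs (Metric.sphere_subset_closedBall hz₀)).1
    (Metric.ne_of_mem_sphere hz₀ hr.ne')))
  have hx' : Tendsto (fun n => H n x) φ (𝓝 (h x)) := hlim.tendsto_at hx
  have hev1 := Metric.tendstoUniformlyOn_iff.1 hun (m / 16) (by positivity)
  have hev2 := hx' (Metric.ball_mem_nhds _ (show 0 < m / 16 by positivity))
  obtain ⟨n, hn1, hn2⟩ := (hev1.and hev2).exists
  have hyn := hn1 y (Metric.mem_closedBall_self hr.le)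
  have hn2' : dist (H n x) (h x) < m / 16 := hn2
  have hsub := DiffContOnCl.ball_subset_image_closedBall (f := H n) (z₀ := y) (r := r) (ε := m / 2)
    (((hd n).mono hrV).diffContOnCl_ball subset_rfl) hr (by
      intro z hz
      have h1 := hn1 z (Metric.sphere_subset_closedBall hz)
      have h2 : m ≤ ‖h z - h y‖ := hmin hz
      rw [dist_eq_norm] at h1 hyn
      have h3 : h z - h y = (h z - H n z) + (H n z - H n y) - (h y - H n y) := by ring
      have h4 := norm_sub_le ((h z - H n z) + (H n z - H n y)) (h y - H n y)
      have h5 := norm_add_le (h z - H n z) (H n z - H n y)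
      rw [← h3] at h4
      linarith) (by
      have : ∀ᶠ z in 𝓝[≠] y, H n z ≠ H n y := by
        filter_upwards [self_mem_nhdsWithin, mem_nhdsWithin_of_mem_nhds (hV.mem_nhds hy)] with z h1 h2 h3
        exact h1 (hinj n h2 hy h3)
      exact this.frequently.filter_mono nhdsWithin_le_nhds)
  obtain ⟨z, hz, hzx⟩ := hsub (show H n x ∈ Metric.ball (H n y) (m / 2 / 2) by
    rw [Metric.mem_ball]
    have h4 := dist_triangle (H n x) (h x) (H n y)
    rw [hxy] at h4 hn2'
    linarith)
  exact (hrs hz).2.2 (hinj n (hrV hz) hx hzx)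

/-- The Riemann mapping theorem, topologically: a bounded connected open set on which nonvanishing
continuous functions have logarithms is an open disc. -/
theorem exists_isOpenEmbedding_range_eq {V : Set ℂ} (hV : IsOpen V) (hVc : IsConnected V)
    (hb : Bornology.IsBounded V)
    (hlog : ∀ g : ℂ → ℂ, ContinuousOn g V → (∀ z ∈ V, g z ≠ 0) →
      ∃ h : ℂ → ℂ, ContinuousOn h V ∧ ∀ z ∈ V, Complex.exp (h z) = g z) :
    ∃ e : ℂ → ℂ, IsOpenEmbedding e ∧ Set.range e = V := by
  obtain ⟨a, ha⟩ := hVc.nonempty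
  obtain ⟨b, hbV, hab⟩ : ∃ b ∈ V, a ≠ b := by
    have : (𝓝[≠] a).NeBot := inferInstance
    obtain ⟨b, hb1, hb2⟩ := ((self_mem_nhdsWithin : {a}ᶜ ∈ 𝓝[≠] a) |> fun h =>
      (Filter.Eventually.and h (mem_nhdsWithin_of_mem_nhds (hV.mem_nhds ha))).exists)
    exact ⟨b, hb2, Ne.symm hb1⟩
  obtain ⟨M, hM⟩ := hb.exists_norm_le
  have hM0 : 0 ≤ M := (norm_nonneg a).trans (hM a ha)
  let h₀ : ℂ → ℂ := fun z => (z - a) / (2 * M + 1 : ℝ)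
  have hMne : ((2 * M + 1 : ℝ) : ℂ) ≠ 0 := by
    rw [Complex.ofReal_ne_zero]; positivity
  have hh₀ : h₀ ∈ discMaps V a := by
    refine ⟨by fun_prop, ?_, ?_, by simp [h₀]⟩
    · intro x _ y _ hxy
      exact sub_left_injective ((div_left_inj' hMne).1 hxy)
    · intro z hz
      rw [mem_ball_zero_iff, norm_div, Complex.norm_real, Real.norm_of_nonneg (by positivity),
        div_lt_one (by positivity)]
      linarith [norm_sub_le z a, hM z hz, hM a ha]
  let S : Set ℝ := (fun h : ℂ → ℂ => ‖h b‖) '' discMaps V a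
  have hSb : BddAbove S := ⟨1, by
    rintro _ ⟨h, hh, rfl⟩
    exact (mem_ball_zero_iff.1 (hh.2.2.1 hbV)).le⟩
  have hSne : S.Nonempty := ⟨_, h₀, hh₀, rfl⟩
  obtain ⟨u, -, hu, huS⟩ := exists_seq_tendsto_sSup hSne hSb
  choose H hH hHu using huS
  let φ : Ultrafilter ℕ := Filter.hyperfilter ℕ
  have hφ : (φ : Filter ℕ) ≤ atTop := by
    rw [← Nat.cofinite_eq_atTop]; exact Filter.hyperfilter_le_cofinite
  obtain ⟨h, hpt, hlu⟩ := exists_limit_of_mapsTo_ball hV φ (fun n => (hH n).1)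
    (fun n => (hH n).2.2.1)
  have hhd : DifferentiableOn ℂ h V :=
    hlu.differentiableOn (Filter.Eventually.of_forall fun n => (hH n).1) hV
  have hha : h a = 0 := by
    refine tendsto_nhds_unique (hpt a ha) ?_
    simp [(hH _).2.2.2]
  have hhb : ‖h b‖ = sSup S := by
    refine tendsto_nhds_unique (hpt b hbV).norm ?_
    have : (fun n => ‖H n b‖) = u := funext hHu
    rw [this]
    exact hu.mono_left hφ
  have hpos : 0 < ‖h b‖ := by
    rw [hhb]
    refine lt_of_lt_of_le ?_ (le_csSup hSb ⟨h₀, hh₀, rfl⟩)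
    refine norm_pos_iff.2 fun h0 => hab ?_
    exact hh₀.2.1 ha hbV (by rw [h0, hh₀.2.2.2])
  have hnc : ¬ ∃ w, ∀ z ∈ V, h z = w := by
    rintro ⟨w, hw⟩
    rw [hw b hbV, ← hw a ha, hha, norm_zero] at hpos
    exact lt_irrefl _ hpos
  have hinj := injOn_of_tendstoLocallyUniformlyOn hV hVc.isPreconnected (fun n => (hH n).1)
    (fun n => (hH n).2.1) hlu hnc
  have hopen := ((hhd.analyticOnNhd hV).is_constant_or_isOpen hVc.isPreconnected).resolve_left hnc
  have hmaps : Set.MapsTo h V (Metric.ball 0 1) := by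
    have hcl : h '' V ⊆ Metric.closedBall 0 1 := by
      rintro _ ⟨z, hz, rfl⟩
      exact Metric.isClosed_closedBall.mem_of_tendsto (hpt z hz)
        (Filter.Eventually.of_forall fun n => Metric.ball_subset_closedBall ((hH n).2.2.1 hz))
    have := interior_maximal hcl (hopen V subset_rfl hV)
    rw [interior_closedBall _ one_ne_zero] at this
    exact fun z hz => this ⟨z, hz, rfl⟩
  have hsurj : h '' V = Metric.ball 0 1 := by
    refine (Set.mapsTo_iff_image_subset.1 hmaps).antisymm fun w hw => ?_
    by_contra hwh
    obtain ⟨h', hh', hlt⟩ := exists_discMaps_norm_lt hV ha hbV hab hlog ⟨hhd, hinj, hmaps, hha⟩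
      (mem_ball_zero_iff.1 hw) hwh
    have := le_csSup hSb ⟨h', hh', rfl⟩
    rw [← hhb] at this
    exact not_lt.2 this hlt
  have hemb : IsOpenEmbedding (V.domRestrict h) := by
    refine IsOpenEmbedding.of_continuous_injective_isOpenMap
      (continuousOn_iff_continuous_domRestrict.1 hhd.continuousOn) hinj.injective ?_
    intro s hs
    have : V.domRestrict h '' s = h '' (Subtype.val '' s) := by
      rw [Set.image_image]; rfl
    rw [this]
    exact hopen _ (Subtype.coe_image_subset _ _) (hV.isOpenMap_subtype_val s hs)
  have hrange : Set.range (V.domRestrict h) = Metric.ball 0 1 := by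
    rw [Set.range_domRestrict, hsurj]
  let e : ℂ ≃ₜ V := (Homeomorph.unitBall.trans (Homeomorph.setCongr hrange.symm)).trans
    hemb.isEmbedding.toHomeomorph.symm
  refine ⟨fun z => e z, hV.isOpenEmbedding_subtypeVal.comp e.isOpenEmbedding, ?_⟩
  change Set.range (Subtype.val ∘ e) = V
  rw [Set.range_comp, e.surjective.range_eq, Set.image_univ, Subtype.range_coe]

section

/-- The Gaussian integer with given real and imaginary part. -/
def lat (v : ℤ × ℤ) : ℂ := ⟨v.1, v.2⟩

@[simp] theorem lat_re (v : ℤ × ℤ) : (lat v).re = v.1 := rfl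

@[simp] theorem lat_im (v : ℤ × ℤ) : (lat v).im = v.2 := rfl

@[simp] theorem lat_zero : lat 0 = 0 := by
  apply Complex.ext <;> simp

theorem lat_add (v w : ℤ × ℤ) : lat (v + w) = lat v + lat w := by
  apply Complex.ext <;> simp

theorem lat_neg (v : ℤ × ℤ) : lat (-v) = -lat v := by
  apply Complex.ext <;> simp

theorem lat_sub (v w : ℤ × ℤ) : lat (v - w) = lat v - lat w := by
  apply Complex.ext <;> simp

theorem lat_injective : Function.Injective lat := by
  intro v w h
  have h1 := congrArg Complex.re h
  have h2 := congrArg Complex.im h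
  simp only [lat_re, lat_im, Int.cast_inj] at h1 h2
  exact Prod.ext h1 h2

theorem lat_eq_zero {v : ℤ × ℤ} : lat v = 0 ↔ v = 0 := by
  rw [← lat_zero, lat_injective.eq_iff]

theorem one_le_norm_lat {v : ℤ × ℤ} (hv : v ≠ 0) : 1 ≤ ‖lat v‖ := by
  by_cases h : v.1 = 0
  · have h2 : v.2 ≠ 0 := fun h2 => hv (Prod.ext h h2)
    refine le_trans ?_ (Complex.abs_im_le_norm _)
    rw [lat_im]
    exact_mod_cast Int.one_le_abs h2
  · refine le_trans ?_ (Complex.abs_re_le_norm _)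
    rw [lat_re]
    exact_mod_cast Int.one_le_abs h

theorem IsPreconnected.eq_of_lat_valued {α : Type*} [TopologicalSpace α] {S : Set α}
    (hS : IsPreconnected S) {g : α → ℂ} (hg : ContinuousOn g S) (h : ∀ x ∈ S, ∃ v, g x = lat v)
    {x y : α} (hx : x ∈ S) (hy : y ∈ S) : g x = g y := by
  apply Complex.ext
  · refine hS.eq_of_int_valued (Complex.continuous_re.comp_continuousOn hg) (fun z hz => ?_) hx hy
    obtain ⟨v, hv⟩ := h z hz
    exact ⟨v.1, by simp [hv]⟩
  · refine hS.eq_of_int_valued (Complex.continuous_im.comp_continuousOn hg) (fun z hz => ?_) hx hy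
    obtain ⟨v, hv⟩ := h z hz
    exact ⟨v.2, by simp [hv]⟩

variable {X : Type*} [TopologicalSpace X]

/-- `p` presents `X` as the quotient of the plane by the Gaussian integers. -/
structure TorusCover (p : ℂ → X) : Prop where
  covering : IsCoveringMap p
  surj : Function.Surjective p
  eq_iff : ∀ z w, p z = p w ↔ ∃ v : ℤ × ℤ, w = z + lat v

/-- The set is contained in an embedded open disc. -/
def Inessential (C : Set X) : Prop := ∃ e : ℂ → X, IsOpenEmbedding e ∧ C ⊆ Set.range e

namespace TorusCover

variable {p : ℂ → X}

theorem continuous (hp : TorusCover p) : Continuous p := hp.covering.continuous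

theorem isOpenMap (hp : TorusCover p) : IsOpenMap p := hp.covering.isOpenMap

theorem apply_add_lat (hp : TorusCover p) (z : ℂ) (v : ℤ × ℤ) : p (z + lat v) = p z :=
  ((hp.eq_iff _ _).2 ⟨v, rfl⟩).symm

/-- A compact connected set over which the covering has a section is inessential. -/
theorem inessential_of_section (hp : TorusCover p) [T1Space X] {C : Set X}
    (hC : IsCompact C) (hCc : IsConnected C)
    {s : X → ℂ} (hs : ContinuousOn s C) (hps : ∀ x ∈ C, p (s x) = x) : Inessential C := by
  have hK : IsCompact (s '' C) := hC.image_of_continuousOn hs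
  have hKc : IsConnected (s '' C) := hCc.image s hs
  have hsep : ∀ z ∈ s '' C, ∀ w ∈ s '' C, ∀ v, z + lat v = w → v = 0 := by
    rintro _ ⟨x, hx, rfl⟩ _ ⟨y, hy, rfl⟩ v h
    have := congrArg p h
    rw [hp.apply_add_lat, hps x hx, hps y hy] at this
    subst this
    exact lat_eq_zero.1 (by simpa using h)
  let D : Set ℂ := (fun q : ℂ × ℂ => q.2 - q.1) '' ((s '' C) ×ˢ (s '' C))
  have hD : IsCompact D := (hK.prod hK).image (by fun_prop)
  let S : Set ℂ := p ⁻¹' {p 0} ∩ (Metric.ball 0 1)ᶜ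
  have hS : IsClosed S :=
    (isClosed_singleton.preimage hp.continuous).inter Metric.isOpen_ball.isClosed_compl
  have hlatS : ∀ v : ℤ × ℤ, v ≠ 0 → lat v ∈ S := by
    intro v hv
    refine ⟨?_, ?_⟩
    · have := hp.apply_add_lat 0 v
      rwa [zero_add] at this
    · rw [Set.mem_compl_iff, mem_ball_zero_iff, not_lt]
      exact one_le_norm_lat hv
  have hDS : Disjoint D S := by
    rw [Set.disjoint_left]
    rintro _ ⟨⟨z, w⟩, ⟨hz, hw⟩, rfl⟩ ⟨h1, h2⟩
    obtain ⟨v, hv⟩ := (hp.eq_iff _ _).1 (show p (w - z) = p 0 from h1)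
    have := hsep z hz w hw (-v) (by rw [lat_neg]; linear_combination hv)
    apply h2
    rw [neg_eq_zero] at this
    subst this
    have : w - z = 0 := by simpa using hv.symm
    simp [this]
  obtain ⟨r, hr, hrd⟩ := Metric.exists_pos_forall_lt_edist hD hS hDS
  have hr' : (0 : ℝ) < r := hr
  obtain ⟨N, hN⟩ := exists_nat_gt (10 / (r : ℝ))
  have hNpos : (0 : ℝ) < N := lt_of_le_of_lt (by positivity) hN
  have hN0 : (N : ℂ) ≠ 0 := by
    have : (N : ℝ) ≠ 0 := hNpos.ne'
    exact_mod_cast this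
  rw [div_lt_iff₀ hr'] at hN
  let K' : Set ℂ := (fun z => (N : ℂ) * z) '' (s '' C)
  have hK' : IsCompact K' := hK.image (by fun_prop)
  have hKc' : IsConnected K' := hKc.image _ (by fun_prop)
  obtain ⟨V, hV, hVc, hVb, hKV, hlog, hfar⟩ := exists_filled_neighbourhood hK' hKc'
  obtain ⟨e, he, her⟩ := exists_isOpenEmbedding_range_eq hV hVc hVb hlog
  have hVfar : ∀ v : ℤ × ℤ, v ≠ 0 → ∀ z ∈ V, z + N * lat v ∉ V := by
    intro v hv
    have e1 : (N : ℂ) * lat v = ⟨(((N : ℤ) • v).1 : ℤ), (((N : ℤ) • v).2 : ℤ)⟩ := by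
      apply Complex.ext <;> simp
    rw [e1]
    refine hfar ((N : ℤ) • v) (smul_ne_zero (by
      intro h; exact hN0 (by exact_mod_cast h)) hv) ?_
    rintro _ ⟨z, hz, rfl⟩ _ ⟨w, hw, rfl⟩
    rw [← e1]
    have h1 := hrd (w - z) ⟨(z, w), ⟨hz, hw⟩, rfl⟩ (lat v) (hlatS v hv)
    rw [edist_dist, ENNReal.lt_ofReal_iff_toReal_lt ENNReal.coe_ne_top, ENNReal.coe_toReal,
      dist_eq_norm] at h1
    have h2 : (N : ℂ) * z + N * lat v - N * w = -((N : ℂ) * (w - z - lat v)) := by ring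
    simp only
    rw [h2, norm_neg, norm_mul, Complex.norm_natCast]
    nlinarith
  refine ⟨fun z => p ((N : ℂ)⁻¹ * e z), ?_, ?_⟩
  · refine IsOpenEmbedding.of_continuous_injective_isOpenMap ?_ ?_ ?_
    · exact hp.continuous.comp (he.continuous.const_mul _)
    · intro z w hzw
      obtain ⟨v, hv⟩ := (hp.eq_iff _ _).1 hzw
      have hv' : e w = e z + N * lat v := by
        field_simp at hv
        exact hv
      by_cases h0 : v = 0
      · subst h0
        exact he.injective (by simpa using hv'.symm)
      · exact absurd (hv' ▸ her ▸ Set.mem_range_self w) (hVfar v h0 _ (her ▸ Set.mem_range_self z))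
    · have hmul : IsOpenMap fun z : ℂ => (N : ℂ)⁻¹ * z :=
        (Homeomorph.mulLeft₀ (N : ℂ)⁻¹ (inv_ne_zero hN0)).isOpenMap
      exact (hp.isOpenMap.comp hmul).comp he.isOpenMap
  · intro x hx
    have : (N : ℂ) * s x ∈ Set.range e := her ▸ hKV ⟨_, ⟨x, hx, rfl⟩, rfl⟩
    obtain ⟨z, hz⟩ := this
    refine ⟨z, ?_⟩
    simp only
    rw [hz, inv_mul_cancel_left₀ hN0, hps x hx]

theorem exists_lift (hp : TorusCover p) {e : ℂ → X} (he : Continuous e) :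
    ∃ E : ℂ → ℂ, Continuous E ∧ ∀ z, p (E z) = e z := by
  obtain ⟨z₀, hz₀⟩ := hp.surj (e 0)
  obtain ⟨E, ⟨-, hE⟩, -⟩ := hp.covering.existsUnique_continuousMap_lifts ⟨e, he⟩ 0 z₀ hz₀
  exact ⟨E, E.continuous, fun z => congrFun hE z⟩

theorem exists_lift_real (hp : TorusCover p) {e : ℝ → X} (he : Continuous e) :
    ∃ E : ℝ → ℂ, Continuous E ∧ ∀ z, p (E z) = e z := by
  obtain ⟨z₀, hz₀⟩ := hp.surj (e 0)
  obtain ⟨E, ⟨-, hE⟩, -⟩ := hp.covering.existsUnique_continuousMap_lifts ⟨e, he⟩ 0 z₀ hz₀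
  exact ⟨E, E.continuous, fun z => congrFun hE z⟩

/-- Two maps on a preconnected set with the same projection differ by a constant. -/
theorem sub_eq_sub_of_proj_eq (hp : TorusCover p) {α : Type*} [TopologicalSpace α] {S : Set α}
    (hS : IsPreconnected S) {g h : α → ℂ} (hg : ContinuousOn g S) (hh : ContinuousOn h S)
    (hgh : ∀ x ∈ S, p (g x) = p (h x)) {x y : α} (hx : x ∈ S) (hy : y ∈ S) :
    h x - g x = h y - g y :=
  hS.eq_of_lat_valued (g := fun x => h x - g x) (hh.sub hg) (fun z hz => by
    obtain ⟨v, hv⟩ := (hp.eq_iff _ _).1 (hgh z hz)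
    exact ⟨v, by rw [hv]; ring⟩) hx hy

/-- A loop whose lift is not closed is not contained in a disc. -/
theorem not_inessential_of_loop (hp : TorusCover p) {γ : ℝ → ℂ} (hγ : Continuous γ)
    {v : ℤ × ℤ} (hv : v ≠ 0)
    (hper : ∀ t, γ (t + 1) = γ t + lat v) {C : Set X} (hC : ∀ t, p (γ t) ∈ C) :
    ¬ Inessential C := by
  rintro ⟨e, he, hCe⟩
  obtain ⟨E, hE, hpE⟩ := hp.exists_lift he.continuous
  have hex : ∀ t, ∃ x, e x = p (γ t) := fun t => hCe (hC t)
  choose x hx using hex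
  have hxc : Continuous x := by
    rw [he.isEmbedding.continuous_iff]
    have : e ∘ x = p ∘ γ := funext hx
    rw [this]
    exact hp.continuous.comp hγ
  have h01 : x 1 = x 0 := by
    apply he.injective
    have := hper 0
    rw [zero_add] at this
    rw [hx, hx, this, hp.apply_add_lat]
  have := hp.sub_eq_sub_of_proj_eq isPreconnected_univ (hE.comp hxc).continuousOn hγ.continuousOn
    (fun t _ => by rw [Function.comp, hpE, hx]) (Set.mem_univ 0) (Set.mem_univ 1)
  rw [Function.comp, Function.comp, h01] at this
  have h2 := hper 0
  rw [zero_add] at h2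
  apply hv
  rw [← lat_eq_zero]
  linear_combination -this - h2

/-- The preimage of an inessential compact set does not separate high points from low points. -/
theorem exists_joinedIn_compl_of_inessential (hp : TorusCover p) [T2Space X] {C : Set X}
    (hC : IsCompact C)
    (hi : Inessential C) (M : ℝ) :
    ∃ x y : ℂ, M < x.im ∧ y.im < -M ∧ JoinedIn (p ⁻¹' C)ᶜ x y := by
  obtain ⟨e, he, hCe⟩ := hi
  obtain ⟨E, hE, hpE⟩ := hp.exists_lift he.continuous
  have hEo : IsOpenMap E := (hp.covering.isLocalHomeomorph.isOpenEmbedding_of_comp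
    (by rwa [show p ∘ E = e from funext hpE]) hE).isOpenMap
  obtain ⟨R₀, hR₀⟩ : ∃ R, e ⁻¹' C ⊆ Metric.closedBall 0 R :=
    (he.isInducing.isCompact_preimage_iff hCe |>.2 hC).isBounded.subset_closedBall 0
  set R := max R₀ 1 with hR
  have hR0 : 0 < R := lt_of_lt_of_le one_pos (le_max_right _ _)
  have hRC : C ⊆ e '' Metric.closedBall 0 R := by
    intro c hc
    obtain ⟨z, rfl⟩ := hCe hc
    exact ⟨z, Metric.closedBall_subset_closedBall (le_max_left _ _) (hR₀ hc), rfl⟩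
  let B : Set ℂ := Metric.closedBall 0 R
  have hext : IsPreconnected Bᶜ := by
    have : Bᶜ = Complex.exp '' {z | Real.log R < z.re} := by
      ext z
      simp only [B, Set.mem_compl_iff, mem_closedBall_zero_iff, not_le, Set.mem_image,
        Set.mem_ofPred_eq]
      constructor
      · intro hz
        have hz0 : z ≠ 0 := by rintro rfl; simp at hz; linarith
        refine ⟨Complex.log z, ?_, Complex.exp_log hz0⟩
        rw [Complex.log_re]
        exact Real.log_lt_log hR0 hz
      · rintro ⟨w, hw, rfl⟩
        rw [Complex.norm_exp]
        exact (Real.log_lt_iff_lt_exp hR0).1 hw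
    rw [this]
    exact (convex_halfSpace_re_gt _).isPreconnected.image _ Complex.continuous_exp.continuousOn
  have hcl : IsClosed (p ⁻¹' (e '' B)) :=
    ((isCompact_closedBall (0 : ℂ) R).image he.continuous).isClosed.preimage hp.continuous
  let W : Set ℂ := (p ⁻¹' (e '' B))ᶜ
  have hW : IsOpen W := hcl.isOpen_compl
  have hrep : ∀ z, z ∈ p ⁻¹' (Set.range e) → ∃ (v : ℤ × ℤ) (x : ℂ), z = E x + lat v := by
    rintro z ⟨x, hx⟩
    obtain ⟨v, hv⟩ := (hp.eq_iff _ _).1 ((hpE x).trans hx)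
    exact ⟨v, x, hv⟩
  have hinj : ∀ (v w : ℤ × ℤ) (x y : ℂ), E x + lat v = E y + lat w → v = w ∧ x = y := by
    intro v w x y h
    have h1 := congrArg p h
    rw [hp.apply_add_lat, hp.apply_add_lat, hpE, hpE] at h1
    have h2 := he.injective h1
    subst h2
    exact ⟨lat_injective (add_left_cancel h), rfl⟩
  have hmemW : ∀ (v : ℤ × ℤ) (x : ℂ), E x + lat v ∈ W ↔ x ∉ B := by
    intro v x
    simp only [W, Set.mem_compl_iff, Set.mem_preimage, hp.apply_add_lat, hpE]
    rw [he.injective.mem_set_image]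
  have hWc : IsPreconnected W := by
    rw [isPreconnected_iff_subset_of_disjoint]
    intro P Q hP hQ hWPQ hPQ
    have hcollar : ∀ v : ℤ × ℤ, (fun x => E x + lat v) '' Bᶜ ⊆ P ∨
        (fun x => E x + lat v) '' Bᶜ ⊆ Q := by
      intro v
      have hsub : (fun x => E x + lat v) '' Bᶜ ⊆ W := by
        rintro _ ⟨x, hx, rfl⟩
        exact (hmemW v x).2 hx
      refine (isPreconnected_iff_subset_of_disjoint.1
        (hext.image _ (hE.add_const _).continuousOn)) P Q hP hQ (hsub.trans hWPQ) ?_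
      exact Set.subset_eq_empty (Set.inter_subset_inter_left _ hsub) hPQ
    have hopen : ∀ v : ℤ × ℤ, IsOpen (Set.range fun x => E x + lat v) := by
      intro v
      have : IsOpenMap fun x => E x + lat v := (Homeomorph.addRight (lat v)).isOpenMap.comp hEo
      exact this.isOpen_range
    let side : Set ℂ → Set ℂ := fun T => (W ∩ T) ∪
      ⋃ v ∈ {v : ℤ × ℤ | (fun x => E x + lat v) '' Bᶜ ⊆ T}, Set.range fun x => E x + lat v
    have hside : ∀ T, IsOpen T → IsOpen (side T) := fun T hT =>
      (hW.inter hT).union (isOpen_biUnion fun v _ => hopen v)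
    have hBne : (Bᶜ).Nonempty := by
      refine ⟨((R + 1 : ℝ) : ℂ), ?_⟩
      simp only [B, Set.mem_compl_iff, mem_closedBall_zero_iff, Complex.norm_real, not_le]
      rw [Real.norm_of_nonneg (by positivity)]
      linarith
    have hnot : ∀ z, ¬ (z ∈ W ∧ z ∈ P ∧ z ∈ Q) := fun z h => by
      have : z ∈ W ∩ (P ∩ Q) := h
      rw [hPQ] at this
      exact this
    have hWside : ∀ T, ∀ z ∈ W, z ∈ side T → z ∈ T := by
      rintro T z hz (h | h)
      · exact h.2
      · obtain ⟨v, hv, x, rfl⟩ := Set.mem_iUnion₂.1 h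
        exact hv ⟨x, (hmemW v x).1 hz, rfl⟩
    have hdisj : Disjoint (side P) (side Q) := by
      rw [Set.disjoint_left]
      intro z h1 h2
      by_cases hz : z ∈ W
      · exact hnot z ⟨hz, hWside P z hz h1, hWside Q z hz h2⟩
      · rcases h1 with h1 | h1
        · exact hz h1.1
        rcases h2 with h2 | h2
        · exact hz h2.1
        obtain ⟨v, hv, x, hvx⟩ := Set.mem_iUnion₂.1 h1
        obtain ⟨w, hw, y, hwy⟩ := Set.mem_iUnion₂.1 h2
        obtain ⟨rfl, -⟩ := hinj v w x y (hvx.trans hwy.symm)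
        obtain ⟨u, hu⟩ := hBne
        exact hnot _ ⟨(hmemW v u).2 hu, hv ⟨u, hu, rfl⟩, hw ⟨u, hu, rfl⟩⟩
    have hcover : (Set.univ : Set ℂ) ⊆ side P ∪ side Q := by
      intro z _
      by_cases hz : z ∈ W
      · exact (hWPQ hz).imp (fun h => Or.inl ⟨hz, h⟩) fun h => Or.inl ⟨hz, h⟩
      · obtain ⟨v, x, rfl⟩ := hrep z (by
          have := Set.notMem_compl_iff.1 hz
          exact Set.image_subset_range _ _ this)
        exact (hcollar v).imp (fun h => Or.inr (Set.mem_iUnion₂.2 ⟨v, h, x, rfl⟩))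
          fun h => Or.inr (Set.mem_iUnion₂.2 ⟨v, h, x, rfl⟩)
    rcases isPreconnected_iff_subset_of_disjoint.1 isPreconnected_univ _ _ (hside P hP)
      (hside Q hQ) hcover (by rw [Set.univ_inter]; exact hdisj.inter_eq) with h | h
    · exact Or.inl fun z hz => hWside P z hz (h (Set.mem_univ z))
    · exact Or.inr fun z hz => hWside Q z hz (h (Set.mem_univ z))
  obtain ⟨z, hz⟩ : ∃ z, z ∈ W := by
    refine ⟨E ((R + 1 : ℝ) : ℂ) + lat 0, (hmemW 0 _).2 ?_⟩
    simp only [B, mem_closedBall_zero_iff, Complex.norm_real, not_le]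
    rw [Real.norm_of_nonneg (by positivity)]
    linarith
  have hWinv : ∀ v : ℤ × ℤ, z + lat v ∈ W := by
    intro v
    simp only [W, Set.mem_compl_iff, Set.mem_preimage, hp.apply_add_lat]
    exact hz
  obtain ⟨n, hn⟩ := exists_int_gt (M - z.im)
  obtain ⟨k, hk⟩ := exists_int_lt (-M - z.im)
  refine ⟨z + lat (0, n), z + lat (0, k), by simp; linarith, by simp; linarith, ?_⟩
  have hpath : IsPathConnected W := hW.isConnected_iff_isPathConnected.1 ⟨⟨z, hz⟩, hWc⟩
  refine (hpath.joinedIn _ (hWinv _) _ (hWinv _)).mono ?_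
  exact Set.compl_subset_compl.2 (Set.preimage_mono hRC)

end TorusCover

end

/-- `b` is one of the four neighbours of the origin in the square lattice. -/
def IsUnitStep (d : ℤ × ℤ) : Prop := d = (1, 0) ∨ d = (-1, 0) ∨ d = (0, 1) ∨ d = (0, -1)

/-- Two half-open lattice edges meet only in the obvious ways. -/
theorem IsUnitStep.eq_or_reverse {A A' d d' : ℤ × ℤ} (hd : IsUnitStep d) (hd' : IsUnitStep d')
    {a a' : ℝ} (ha : 0 ≤ a) (ha1 : a < 1) (ha' : 0 ≤ a') (ha1' : a' < 1)
    (h : lat A + a * lat d = lat A' + a' * lat d') :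
    (A = A' ∧ a = a') ∨ (A' = A + d ∧ A = A' + d') := by
  obtain ⟨x, y⟩ := A
  obtain ⟨x', y'⟩ := A'
  have hre := congrArg Complex.re h
  have him := congrArg Complex.im h
  simp only [Complex.add_re, Complex.add_im, Complex.re_ofReal_mul, Complex.im_ofReal_mul, lat_re,
    lat_im] at hre him
  have key : ∀ (m n : ℤ), (m : ℝ) < n + 1 → m ≤ n := fun m n hmn => by
    have : m < n + 1 := by exact_mod_cast hmn
    omega
  rcases hd with rfl | rfl | rfl | rfl <;> rcases hd' with rfl | rfl | rfl | rfl <;>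
    simp only [Int.cast_one, Int.cast_zero, Int.cast_neg, mul_one, mul_zero, mul_neg, add_zero]
      at hre him <;>
    simp only [Prod.mk.injEq, Prod.mk_add_mk]
  all_goals first
    | (have h1 := key x x' (by linarith)
       have h2 := key x' x (by linarith)
       have h3 := key y y' (by linarith)
       have h4 := key y' y (by linarith)
       have e1 : x = x' := le_antisymm h1 h2
       have e2 : y = y' := le_antisymm h3 h4
       subst e1 e2
       exact Or.inl ⟨⟨rfl, rfl⟩, by linarith⟩)
    | (have h1 := key x (x' + 1) (by push_cast; linarith)
       have h2 := key x' (x + 1) (by push_cast; linarith)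
       have h3 := key y (y' + 1) (by push_cast; linarith)
       have h4 := key y' (y + 1) (by push_cast; linarith)
       by_cases e1 : x = x'
       · by_cases e2 : y = y'
         · subst e1 e2
           exact Or.inl ⟨⟨rfl, rfl⟩, by linarith⟩
         · subst e1
           right
           rcases le_total y y' with h6 | h6
           · have : y' = y + 1 := by omega
             subst this
             push_cast at him
             first
               | (exfalso; linarith)
               | omega
           · have : y = y' + 1 := by omega
             subst this
             push_cast at him
             first
               | (exfalso; linarith)
               | omega
       · have e2 : y = y' := by
           first
             | exact absurd (by exact_mod_cast hre) e1
             | exact_mod_cast him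
         subst e2
         right
         rcases le_total x x' with h6 | h6
         · have : x' = x + 1 := by omega
           subst this
           push_cast at hre
           first
             | (exfalso; linarith)
             | omega
         · have : x = x' + 1 := by omega
           subst this
           push_cast at hre
           first
             | (exfalso; linarith)
             | omega)

/-- A finite walk along a relation, listed by its vertices. -/
theorem Relation.ReflTransGen.exists_walk {α : Type*} {r : α → α → Prop} {a b : α}
    (h : Relation.ReflTransGen r a b) :
    ∃ (L : ℕ) (y : ℕ → α), y 0 = a ∧ y L = b ∧ ∀ i < L, r (y i) (y (i + 1)) := by
  induction h using Relation.ReflTransGen.head_induction_on with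
  | refl => exact ⟨0, fun _ => b, rfl, rfl, by simp⟩
  | @head a c hac _ ih =>
    obtain ⟨L, y, h0, hL, hy⟩ := ih
    refine ⟨L + 1, fun i => Nat.casesOn i a y, rfl, hL, fun i hi => ?_⟩
    rcases i with _ | i
    · simpa [h0] using hac
    · exact hy i (by omega)

/-- A shortest walk from a point to a nontrivial translate of it by a multiple of `w` extends to a
periodic bi-infinite walk which is injective modulo translations. -/
theorem exists_periodic_walk {r : ℤ × ℤ → ℤ × ℤ → Prop} {w : ℤ × ℤ} (hw : w ≠ 0)
    (htrans : ∀ a b (j : ℤ), r a b → r (a + j • w) (b + j • w)) {a : ℤ × ℤ}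
    (ha : Relation.ReflTransGen r a (a + w)) :
    ∃ (L : ℕ) (k : ℤ) (Y : ℤ → ℤ × ℤ), L ≠ 0 ∧ k ≠ 0 ∧ (∀ n, Y (n + L) = Y n + k • w) ∧
      (∀ n, r (Y n) (Y (n + 1))) ∧
      ∀ n n' (j : ℤ), Y n' = Y n + j • w → (L : ℤ) ∣ n' - n := by
  classical
  let Q : ℕ → Prop := fun L => ∃ (y : ℕ → ℤ × ℤ) (k : ℤ), k ≠ 0 ∧ y L = y 0 + k • w ∧
    ∀ i < L, r (y i) (y (i + 1))
  have hQ : ∃ L, Q L := by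
    obtain ⟨L, y, h0, hL, hy⟩ := ha.exists_walk
    exact ⟨L, y, 1, one_ne_zero, by rw [hL, h0, one_smul], hy⟩
  obtain ⟨y, k, hk, hyL, hy⟩ := Nat.find_spec hQ
  have hmin : ∀ L, Q L → Nat.find hQ ≤ L := fun L hL => Nat.find_min' hQ hL
  generalize Nat.find hQ = L at *
  have hL : L ≠ 0 := by
    rintro rfl
    have : k • w = 0 := by simpa using hyL
    exact (smul_ne_zero hk hw) this
  have hinj : ∀ i j, i < j → j < L → ∀ m : ℤ, y j ≠ y i + m • w := by
    intro i j hij hj m h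
    by_cases hm : m = 0
    · subst hm
      rw [zero_smul, add_zero] at h
      have : Q (L - (j - i)) := by
        refine ⟨fun n => if n ≤ i then y n else y (n + (j - i)), k, hk, ?_, fun n hn => ?_⟩
        · beta_reduce
          rw [if_neg (by omega), if_pos (Nat.zero_le _), show L - (j - i) + (j - i) = L by omega,
            hyL]
        · beta_reduce
          rcases lt_trichotomy n i with hni | hni | hni
          · rw [if_pos hni.le, if_pos (by omega)]
            exact hy n (by omega)
          · subst hni
            rw [if_pos le_rfl, if_neg (by omega), ← h,
              show n + 1 + (j - n) = j + 1 by omega]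
            exact hy j hj
          · rw [if_neg (by omega), if_neg (by omega), show n + 1 + (j - i) = n + (j - i) + 1 by omega]
            exact hy _ (by omega)
      have := hmin _ this
      omega
    · have : Q (j - i) := by
        refine ⟨fun n => y (i + n), m, hm, ?_, fun n hn => hy (i + n) (by omega)⟩
        simp only [add_zero]
        rw [show i + (j - i) = j by omega, h]
      have := hmin _ this
      omega
  have hLZ : (L : ℤ) ≠ 0 := by exact_mod_cast hL
  have hLpos : 0 < (L : ℤ) := by omega
  refine ⟨L, k, fun n => y (n % L).toNat + ((n / L) * k) • w, hL, hk, fun n => ?_, fun n => ?_,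
    fun n n' j h => ?_⟩
  · simp only
    rw [Int.add_emod_right, Int.add_ediv_of_dvd_right (dvd_refl _), Int.ediv_self hLZ, add_mul,
      one_mul, add_smul, add_assoc]
  · have h0 := Int.emod_nonneg n hLZ
    have h1 := Int.emod_lt_of_pos n hLpos
    have h2 := Int.mul_ediv_add_emod n L
    simp only
    by_cases hlast : n % L + 1 = L
    · have e1 : (n + 1) / L = n / L + 1 := by
        have : n + 1 = L * (n / L + 1) := by linarith
        rw [this, Int.mul_ediv_cancel_left _ hLZ]
      have e2 : (n + 1) % L = 0 := by
        apply Int.emod_eq_zero_of_dvd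
        exact ⟨n / L + 1, by linarith⟩
      rw [e1, e2, Int.toNat_zero, add_mul, one_mul, add_smul]
      have := htrans _ _ (n / L * k) (hy (n % L).toNat (by omega))
      rw [show (n % L).toNat + 1 = L by omega, hyL] at this
      convert this using 1
      abel
    · have e1 : (n + 1) / L = n / L := by
        rw [Int.ediv_eq_iff_of_pos hLpos]
        have : n % L + 1 < L := by omega
        constructor <;> nlinarith
      have e2 : (n + 1) % L = n % L + 1 := by
        have := Int.mul_ediv_add_emod (n + 1) L
        rw [e1] at this
        linarith
      rw [e1, e2, show (n % L + 1).toNat = (n % L).toNat + 1 by omega]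
      exact htrans _ _ _ (hy _ (by omega))
  · have h0 := Int.emod_nonneg n hLZ
    have h1 := Int.emod_lt_of_pos n hLpos
    have h0' := Int.emod_nonneg n' hLZ
    have h1' := Int.emod_lt_of_pos n' hLpos
    simp only at h
    have key : n' % L = n % L := by
      rcases lt_trichotomy (n' % L) (n % L) with hlt | heq | hlt
      · refine absurd ?_ (hinj (n' % L).toNat (n % L).toNat (by omega) (by omega)
          (n' / L * k - j - n / L * k))
        rw [sub_smul, sub_smul]
        rw [← sub_eq_iff_eq_add] at h
        rw [← sub_eq_zero]
        rw [← sub_eq_zero] at h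
        rw [← neg_eq_zero, ← h]
        abel
      · exact heq
      · refine absurd ?_ (hinj (n % L).toNat (n' % L).toNat (by omega) (by omega)
          (n / L * k + j - n' / L * k))
        rw [sub_smul, add_smul]
        rw [← sub_eq_zero] at h ⊢
        rw [← h]
        abel
    exact Int.ModEq.dvd key.symm

/-- Adjacency in the part of the square grid of mesh `1 / N` lying inside `E`. -/
def GridAdj (E : Set ℂ) (N : ℕ) (a b : ℤ × ℤ) : Prop :=
  IsUnitStep (b - a) ∧ segment ℝ (lat a / N) (lat b / N) ⊆ E

/-- The vertex of the grid of mesh `1 / N` closest to `w`. -/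
def gridRound (N : ℕ) (w : ℂ) : ℤ × ℤ := (round (N * w.re), round (N * w.im))

theorem gridAdj_of_near {E : Set ℂ} {N : ℕ} {w : ℂ} {δ : ℝ} (hδ : Metric.ball w δ ⊆ E)
    {a b : ℤ × ℤ} (hab : IsUnitStep (b - a)) (ha : lat a / N ∈ Metric.ball w δ)
    (hb : lat b / N ∈ Metric.ball w δ) : GridAdj E N a b :=
  ⟨hab, ((convex_ball w δ).segment_subset ha hb).trans hδ⟩

theorem div_mem_ball_of_near {N : ℕ} (hN : 0 < N) {w : ℂ} {δ : ℝ} (hNδ : 2 / N < δ) {a : ℤ × ℤ}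
    (h1 : |N * w.re - a.1| ≤ 1) (h2 : |N * w.im - a.2| ≤ 1) :
    lat a / N ∈ Metric.ball w δ := by
  have hN' : (0 : ℝ) < N := by exact_mod_cast hN
  have hNc : (N : ℂ) ≠ 0 := by exact_mod_cast hN.ne'
  rw [Metric.mem_ball, dist_comm, dist_eq_norm]
  have : w - lat a / N = (N * w - lat a) / N := by field_simp
  rw [this, norm_div, Complex.norm_natCast]
  refine lt_of_le_of_lt ?_ hNδ
  gcongr
  refine (Complex.norm_le_abs_re_add_abs_im _).trans ?_
  simp only [Complex.sub_re, Complex.sub_im, Complex.mul_re, Complex.mul_im, Complex.natCast_re,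
    Complex.natCast_im, lat_re, lat_im, zero_mul, sub_zero, add_zero]
  linarith

theorem reflTransGen_gridRound {E : Set ℂ} {N : ℕ} (hN : 0 < N) {w w' : ℂ} {δ : ℝ}
    (hδ : Metric.ball w δ ⊆ E) (hNδ : 2 / N < δ) (hw : ‖w' - w‖ < 1 / (2 * N)) :
    Relation.ReflTransGen (GridAdj E N) (gridRound N w) (gridRound N w') := by
  have hN' : (0 : ℝ) < N := by exact_mod_cast hN
  have key : ∀ x x' : ℝ, |x' - x| < 1 / (2 * N) → |(N : ℝ) * x - round (N * x)| ≤ 1 ∧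
      |(N : ℝ) * x - round (N * x')| ≤ 1 ∧ |round ((N : ℝ) * x') - round (N * x)| ≤ 1 := by
    intro x x' h
    have h1 := abs_sub_round ((N : ℝ) * x)
    have h2 := abs_sub_round ((N : ℝ) * x')
    have h3 : |(N : ℝ) * x' - N * x| < 1 / 2 := by
      rw [← mul_sub, abs_mul, abs_of_pos hN']
      calc (N : ℝ) * |x' - x| < N * (1 / (2 * N)) := by gcongr
        _ = 1 / 2 := by field_simp
    rw [abs_le] at h1 h2
    rw [abs_lt] at h3
    refine ⟨?_, ?_, ?_⟩
    · rw [abs_le]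
      constructor <;> linarith
    · rw [abs_le]
      constructor <;> linarith
    · have h4 : (round ((N : ℝ) * x') : ℝ) - round (N * x) < 2 := by linarith
      have h5 : (-2 : ℝ) < (round ((N : ℝ) * x') : ℝ) - round (N * x) := by linarith
      have h4' : round ((N : ℝ) * x') - round (N * x) < 2 := by exact_mod_cast h4
      have h5' : -2 < round ((N : ℝ) * x') - round (N * x) := by exact_mod_cast h5
      rw [abs_le]
      omega
  obtain ⟨hr1, hr2, hr3⟩ := key w.re w'.re (by
    rw [← Complex.sub_re]; exact (Complex.abs_re_le_norm _).trans_lt hw)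
  obtain ⟨hi1, hi2, hi3⟩ := key w.im w'.im (by
    rw [← Complex.sub_im]; exact (Complex.abs_im_le_norm _).trans_lt hw)
  unfold gridRound
  generalize round ((N : ℝ) * w.re) = x at *
  generalize round ((N : ℝ) * w.im) = y at *
  generalize round ((N : ℝ) * w'.re) = x' at *
  generalize round ((N : ℝ) * w'.im) = y' at *
  have hA := div_mem_ball_of_near (a := (x, y)) hN hNδ hr1 hi1
  have hB := div_mem_ball_of_near (a := (x', y)) hN hNδ hr2 hi1
  have hC := div_mem_ball_of_near (a := (x', y')) hN hNδ hr2 hi2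
  rw [abs_le] at hr3 hi3
  refine Relation.ReflTransGen.trans (b := (x', y)) ?_ ?_
  · by_cases h : x' = x
    · subst h; exact .refl
    · refine .single (gridAdj_of_near hδ ?_ hA hB)
      have : x' - x = 1 ∨ x' - x = -1 := by omega
      rcases this with h | h <;> simp [IsUnitStep, h]
  · by_cases h : y' = y
    · subst h; exact .refl
    · refine .single (gridAdj_of_near hδ ?_ hB hC)
      have : y' - y = 1 ∨ y' - y = -1 := by omega
      rcases this with h | h <;> simp [IsUnitStep, h]

theorem exists_grid_walk {E : Set ℂ} (hE : IsOpen E) (hEc : IsConnected E)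
    (h1 : ∀ z, z + 1 ∈ E ↔ z ∈ E) :
    ∃ (N : ℕ) (a : ℤ × ℤ), 3 ≤ N ∧
      Relation.ReflTransGen (GridAdj E N) a (a + ((N : ℤ), 0)) := by
  obtain ⟨z, hz⟩ := hEc.nonempty
  obtain ⟨γ, hγ⟩ := (hE.isConnected_iff_isPathConnected.1 hEc).joinedIn z hz (z + 1) ((h1 z).2 hz)
  have hK : IsCompact (Set.range γ) := isCompact_range γ.continuous
  obtain ⟨δ, hδ, hδE⟩ := hK.exists_thickening_subset_open hE (Set.range_subset_iff.2 hγ)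
  obtain ⟨N, hN⟩ := exists_nat_gt (max 3 (2 / δ))
  have hN3 : 3 ≤ N := by
    have : (3 : ℝ) < N := (le_max_left _ _).trans_lt hN
    exact_mod_cast this.le
  have hN0 : (0 : ℝ) < N := by
    have : 0 < N := by omega
    exact_mod_cast this
  have hNδ : 2 / (N : ℝ) < δ := by
    have : 2 / δ < N := (le_max_right _ _).trans_lt hN
    rw [div_lt_iff₀ hδ] at this
    rw [div_lt_iff₀ hN0]
    linarith
  have hball : ∀ w ∈ Set.range γ, Metric.ball w δ ⊆ E := fun w hw =>
    (Metric.ball_subset_thickening hw δ).trans hδE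
  have hr := (isPreconnected_range γ.continuous).induction₂'
    (fun w w' => Relation.ReflTransGen (GridAdj E N) (gridRound N w) (gridRound N w')) ?_
    (fun _ _ _ _ _ _ => Relation.ReflTransGen.trans) (x := z) (y := z + 1)
    ⟨0, γ.source⟩ ⟨1, γ.target⟩
  · refine ⟨N, gridRound N z, hN3, ?_⟩
    convert hr using 1
    have : (N : ℝ) * (z + 1).re = N * z.re + ((N : ℤ) : ℝ) := by
      rw [Complex.add_re, Complex.one_re]; push_cast; ring
    simp only [gridRound]
    rw [this, round_add_intCast]
    simp
  · intro w hw
    have : ∀ᶠ w' in 𝓝[Set.range γ] w, ‖w' - w‖ < 1 / (2 * N) := by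
      apply mem_nhdsWithin_of_mem_nhds
      have := Metric.ball_mem_nhds w (show (0 : ℝ) < 1 / (2 * N) by positivity)
      filter_upwards [this] with w' hw'
      rwa [← dist_eq_norm]
    filter_upwards [this, self_mem_nhdsWithin] with w' hw' hmem
    exact ⟨reflTransGen_gridRound (by omega) (hball w hw) hNδ hw',
      reflTransGen_gridRound (by omega) (hball w' hmem) hNδ (by rwa [norm_sub_rev])⟩

/-- The piecewise affine curve through a sequence of points. -/
def polygonal (c : ℤ → ℂ) (t : ℝ) : ℂ := c ⌊t⌋ + Int.fract t * (c (⌊t⌋ + 1) - c ⌊t⌋)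

theorem continuous_polygonal (c : ℤ → ℂ) : Continuous (polygonal c) := by
  have hfin : LocallyFinite fun n : ℤ => Set.Icc (n : ℝ) (n + 1) := by
    intro t
    refine ⟨Set.Ioo (t - 1) (t + 1), Ioo_mem_nhds (by linarith) (by linarith), ?_⟩
    refine (Set.finite_Icc (⌊t⌋ - 2) (⌊t⌋ + 2)).subset ?_
    rintro n ⟨s, ⟨hs1, hs2⟩, hs3, hs4⟩
    have h1 := Int.floor_le t
    have h2 := Int.lt_floor_add_one t
    have h3 : (n : ℝ) < ⌊t⌋ + 2 := by linarith
    have h4 : (⌊t⌋ : ℝ) - 2 < n := by linarith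
    have h3' : n < ⌊t⌋ + 2 := by exact_mod_cast h3
    have h4' : ⌊t⌋ - 2 < n := by exact_mod_cast h4
    exact ⟨h4'.le, h3'.le⟩
  refine hfin.continuous ?_ (fun n => isClosed_Icc) (fun n => ?_)
  · refine Set.eq_univ_of_forall fun t => Set.mem_iUnion.2 ⟨⌊t⌋, Int.floor_le t, ?_⟩
    exact (Int.lt_floor_add_one t).le
  · have : ContinuousOn (fun t : ℝ => c n + ((t - n : ℝ) : ℂ) * (c (n + 1) - c n))
        (Set.Icc (n : ℝ) (n + 1)) := by fun_prop
    refine this.congr fun t ht => ?_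
    rcases ht.2.lt_or_eq with h | h
    · have : ⌊t⌋ = n := Int.floor_eq_iff.2 ⟨ht.1, h⟩
      simp only [polygonal, Int.fract, this]
    · have : t = ((n + 1 : ℤ) : ℝ) := by rw [h]; push_cast; rfl
      simp only [polygonal]
      rw [this, Int.floor_intCast, Int.fract_intCast]
      push_cast
      ring

theorem polygonal_add_nat {c : ℤ → ℂ} {L : ℕ} {b : ℂ} (hc : ∀ n, c (n + L) = c n + b) (t : ℝ) :
    polygonal c (t + L) = polygonal c t + b := by
  have h1 : ⌊t + (L : ℝ)⌋ = ⌊t⌋ + L := Int.floor_add_natCast t L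
  have h2 : Int.fract (t + (L : ℝ)) = Int.fract t := Int.fract_add_natCast t L
  simp only [polygonal, h1, h2]
  rw [show ⌊t⌋ + (L : ℤ) + 1 = ⌊t⌋ + 1 + L by ring, hc, hc]
  ring

/-- The image of a connected open annular set contains an essential simple closed curve. -/
theorem TorusCover.exists_essential_curve {X : Type*} [TopologicalSpace X] [T2Space X] {p : ℂ → X}
    (hp : TorusCover p) {E : Set ℂ} (hE : IsOpen E) (hEc : IsConnected E)
    (h1 : ∀ z, z + 1 ∈ E ↔ z ∈ E) (hdisj : ∀ z ∈ E, ∀ v, z + lat v ∈ E → v.2 = 0) :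
    ∃ e : AddCircle (1 : ℝ) → X, IsEmbedding e ∧ Set.range e ⊆ p '' E ∧
      ¬ Inessential (Set.range e) := by
  obtain ⟨N, a, hN, ha⟩ := exists_grid_walk hE hEc h1
  have hN0 : (N : ℂ) ≠ 0 := by
    have : N ≠ 0 := by omega
    exact_mod_cast this
  have hNZ : (3 : ℤ) ≤ N := by exact_mod_cast hN
  have hdiv : ∀ (b : ℤ × ℤ) (j : ℤ), lat (b + j • ((N : ℤ), (0 : ℤ))) / N = lat b / N + j := by
    intro b j
    have : lat (b + j • ((N : ℤ), (0 : ℤ))) = lat b + j * N := by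
      apply Complex.ext <;> simp
    rw [this, add_div, mul_div_cancel_right₀ _ hN0]
  obtain ⟨L, k, Y, hL, hk, hper, hadj, hinj⟩ := exists_periodic_walk
    (w := ((N : ℤ), (0 : ℤ))) (r := GridAdj E N)
    (by simp only [ne_eq, Prod.mk_eq_zero]; omega)
    (by
      rintro b b' j ⟨h2, h3⟩
      refine ⟨by simpa using h2, ?_⟩
      rw [hdiv, hdiv]
      intro x hx
      have : x - j ∈ segment ℝ (lat b / N) (lat b' / N) := by
        rw [← mem_segment_translate ℝ (j : ℂ)]
        simpa [add_comm] using hx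
      have := (add_int_mem_iff h1 j _).2 (h3 this)
      simpa using this) ha
  have hL3 : ¬ (L : ℤ) ∣ 2 := by
    intro h2
    have hle := Int.le_of_dvd (by norm_num) h2
    have hone : ∀ n, |(Y (n + 1)).1 - (Y n).1| ≤ 1 := by
      intro n
      rcases (hadj n).1 with h | h | h | h <;>
      · have := congrArg Prod.fst h
        simp only [Prod.fst_sub] at this
        rw [this]
        simp
    have hp0 := congrArg Prod.fst (hper 0)
    have h01 := hone 0
    have h12 := hone 1
    simp only [Prod.fst_add, Prod.smul_fst, smul_eq_mul] at hp0
    have hkN : 3 ≤ |k * N| := by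
      rw [abs_mul]
      have := Int.one_le_abs hk
      have h4 : |(N : ℤ)| = N := abs_of_nonneg (by omega)
      rw [h4]
      nlinarith
    rw [abs_le] at h01 h12
    rw [le_abs] at hkN
    have : L = 1 ∨ L = 2 := by omega
    rcases this with rfl | rfl <;> norm_num at * <;> omega
  set c : ℤ → ℂ := fun n => lat (Y n) / N with hc
  have hcper : ∀ n, c (n + L) = c n + (k : ℂ) := by
    intro n
    simp only [hc]
    rw [hper, hdiv]
  have hmemE : ∀ t, polygonal c t ∈ E := by
    intro t
    apply (hadj ⌊t⌋).2
    rw [segment_eq_image']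
    refine ⟨Int.fract t, ⟨Int.fract_nonneg t, (Int.fract_lt_one t).le⟩, ?_⟩
    simp [polygonal, hc]
  have hmain : ∀ s t, p (polygonal c s) = p (polygonal c t) → ∃ j : ℤ, t = s + j * L := by
    intro s t h
    obtain ⟨v, hv⟩ := (hp.eq_iff _ _).1 h
    have hv2 : v.2 = 0 := hdisj _ (hmemE s) v (hv ▸ hmemE t)
    have hlat : lat v = v.1 := by apply Complex.ext <;> simp [hv2]
    have hY : ∀ r, N * polygonal c r =
        lat (Y ⌊r⌋) + Int.fract r * lat (Y (⌊r⌋ + 1) - Y ⌊r⌋) := by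
      intro r
      simp only [polygonal, hc, lat_sub]
      field_simp
    have hrel : lat (Y ⌊t⌋) + Int.fract t * lat (Y (⌊t⌋ + 1) - Y ⌊t⌋) =
        lat (Y ⌊s⌋ + v.1 • ((N : ℤ), (0 : ℤ))) +
          Int.fract s * lat (Y (⌊s⌋ + 1) - Y ⌊s⌋) := by
      have h3 := hdiv (Y ⌊s⌋) v.1
      rw [div_eq_iff hN0] at h3
      rw [h3, ← hY t, hv, hlat, mul_add, hY s]
      field_simp
      ring
    rcases IsUnitStep.eq_or_reverse (hadj _).1 (hadj _).1 (Int.fract_nonneg t)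
      (Int.fract_lt_one t) (Int.fract_nonneg s) (Int.fract_lt_one s) hrel with
      ⟨h4, h5⟩ | ⟨h4, h5⟩
    · obtain ⟨j, hj⟩ := hinj _ _ _ h4
      refine ⟨j, ?_⟩
      rw [← Int.floor_add_fract t, ← Int.floor_add_fract s, h5]
      have : (⌊t⌋ : ℝ) = ⌊s⌋ + L * j := by
        have : ⌊t⌋ = ⌊s⌋ + L * j := by linarith
        exact_mod_cast this
      rw [this]
      ring
    · exfalso
      have h6 : Y (⌊t⌋ + 1) = Y ⌊s⌋ + v.1 • ((N : ℤ), (0 : ℤ)) := by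
        rw [h4]; abel
      have h7 : Y ⌊t⌋ = Y (⌊s⌋ + 1) + v.1 • ((N : ℤ), (0 : ℤ)) := by
        rw [h5]; abel
      have d1 := hinj _ _ _ h6
      have d2 := hinj _ _ _ h7
      apply hL3
      have := dvd_sub d1 d2
      ring_nf at this
      exact this
  have hLR : (L : ℝ) ≠ 0 := by exact_mod_cast hL
  have hγper : ∀ t : ℝ, polygonal c (L * (t + 1)) = polygonal c (L * t) + lat (k, 0) := by
    intro t
    rw [mul_add, mul_one, polygonal_add_nat hcper]
    congr 1
    apply Complex.ext <;> simp
  have hγc : Continuous fun t : ℝ => polygonal c (L * t) :=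
    (continuous_polygonal c).comp (continuous_const.mul continuous_id)
  have hperiodic : Function.Periodic (fun t : ℝ => p (polygonal c (L * t))) 1 := fun t => by
    simp only [hγper, hp.apply_add_lat]
  have hlift : ∀ t : ℝ, hperiodic.lift (t : AddCircle (1 : ℝ)) = p (polygonal c (L * t)) :=
    fun t => hperiodic.lift_coe t
  have hcont : Continuous hperiodic.lift :=
    (QuotientAddGroup.isQuotientMap_mk (AddSubgroup.zmultiples (1 : ℝ))).continuous_iff.2
      (hp.continuous.comp hγc)
  refine ⟨hperiodic.lift, ?_, ?_, ?_⟩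
  · refine (hcont.isClosedEmbedding ?_).isEmbedding
    intro x y
    induction x using QuotientAddGroup.induction_on with | _ s
    induction y using QuotientAddGroup.induction_on with | _ t
    intro hxy
    change hperiodic.lift (s : AddCircle (1 : ℝ)) = hperiodic.lift (t : AddCircle (1 : ℝ)) at hxy
    rw [hlift, hlift] at hxy
    obtain ⟨j, hj⟩ := hmain _ _ hxy
    have : t = s + j := by
      have : (L : ℝ) * t = L * (s + j) := by rw [hj]; ring
      exact mul_left_cancel₀ hLR this
    change (s : AddCircle (1 : ℝ)) = (t : AddCircle (1 : ℝ))
    rw [this, AddCircle.coe_add]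
    have : ((j : ℝ) : AddCircle (1 : ℝ)) = 0 := by
      rw [AddCircle.coe_eq_zero_iff]
      exact ⟨j, by simp⟩
    rw [this, add_zero]
  · rintro _ ⟨x, rfl⟩
    induction x using QuotientAddGroup.induction_on with | _ s
    exact ⟨_, hmemE _, (hlift s).symm⟩
  · refine hp.not_inessential_of_loop hγc (v := (k, 0)) (by simp [hk]) hγper fun t => ?_
    exact ⟨(t : AddCircle (1 : ℝ)), hlift t⟩

/-- The complement of a component of the complement of a connected set is connected. -/
theorem IsPreconnected.compl_of_maximal {α : Type*} [TopologicalSpace α] [LocallyConnectedSpace α]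
    [PreconnectedSpace α] {S V : Set α} (hS : IsPreconnected S) (hSne : S.Nonempty)
    (hVS : Disjoint V S) (hV : IsOpen V)
    (hmax : ∀ W, IsOpen W → IsPreconnected W → Disjoint W S → (W ∩ V).Nonempty → W ⊆ V) :
    IsPreconnected Vᶜ := by
  have hVS' : Disjoint V (closure S) := hVS.closure_right hV
  obtain ⟨s₀, hs₀⟩ := hSne
  have hsub : ∀ x ∈ Vᶜ, ∃ t ⊆ Vᶜ, s₀ ∈ t ∧ x ∈ t ∧ IsPreconnected t := by
    intro x hx
    have hcl : closure S ⊆ Vᶜ := hVS'.subset_compl_left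
    by_cases hxS : x ∈ closure S
    · exact ⟨closure S, hcl, subset_closure hs₀, hxS, hS.closure⟩
    set W := _root_.connectedComponentIn (closure S)ᶜ x with hWdef
    have hWo : IsOpen W := isClosed_closure.isOpen_compl.connectedComponentIn
    have hxW : x ∈ W := mem_connectedComponentIn hxS
    have hWS : W ⊆ (closure S)ᶜ := connectedComponentIn_subset _ _
    have hWp : IsPreconnected W := isPreconnected_connectedComponentIn
    have hWV : W ⊆ Vᶜ := by
      intro y hy hyV
      refine hx (hmax W hWo hWp ?_ ⟨y, hy, hyV⟩ hxW)
      exact (Set.disjoint_left.2 fun z hz hzS => hWS hz (subset_closure hzS))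
    have hmeet : (closure W ∩ closure S).Nonempty := by
      by_contra hne
      rw [Set.not_nonempty_iff_eq_empty] at hne
      have hclW : IsClosed W := by
        refine isClosed_of_closure_subset fun y hy => ?_
        have hyS : y ∈ (closure S)ᶜ := fun h => by
          have : y ∈ closure W ∩ closure S := ⟨hy, h⟩
          rw [hne] at this
          exact this
        have ho : IsOpen (_root_.connectedComponentIn (closure S)ᶜ y) :=
          isClosed_closure.isOpen_compl.connectedComponentIn
        obtain ⟨z, hz1, hz2⟩ := mem_closure_iff.1 hy _ ho (mem_connectedComponentIn hyS)
        have e1 := connectedComponentIn_eq hz1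
        have e2 := connectedComponentIn_eq hz2
        rw [hWdef, e2, ← e1]
        exact mem_connectedComponentIn hyS
      have := IsClopen.eq_univ ⟨hclW, hWo⟩ ⟨x, hxW⟩
      exact hWS (this ▸ Set.mem_univ s₀) (subset_closure hs₀)
    obtain ⟨s, hsW, hsS⟩ := hmeet
    refine ⟨insert s W ∪ closure S, ?_, Or.inr (subset_closure hs₀), Or.inl (Or.inr hxW), ?_⟩
    · rintro y ((rfl | hy) | hy)
      · exact hcl hsS
      · exact hWV hy
      · exact hcl hy
    · exact IsPreconnected.union s (Or.inl rfl) hsS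
        (hWp.subset_closure (Set.subset_insert _ _)
          (Set.insert_subset hsW subset_closure)) hS.closure
  exact isPreconnected_of_forall s₀ hsub

/-- A pair of complementary domains, unbounded below and above, of a periodic separating set. -/
structure AnnularPair (U V : Set ℂ) (M : ℝ) : Prop where
  isOpen_lower : IsOpen U
  isOpen_upper : IsOpen V
  isPreconnected_lower : IsPreconnected U
  isPreconnected_upper : IsPreconnected V
  disjoint : Disjoint U V
  low : ∀ z : ℂ, z.im < -M → z ∈ U
  high : ∀ z : ℂ, M < z.im → z ∈ V
  max_lower : ∀ W, IsOpen W → IsPreconnected W → Disjoint W V → (W ∩ U).Nonempty → W ⊆ U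
  max_upper : ∀ W, IsOpen W → IsPreconnected W → Disjoint W U → (W ∩ V).Nonempty → W ⊆ V
  lower_add_one : ∀ z, z + 1 ∈ U ↔ z ∈ U
  upper_add_one : ∀ z, z + 1 ∈ V ↔ z ∈ V
  lower_sub_I : ∀ z ∈ U, z - Complex.I ∈ U
  upper_add_I : ∀ z ∈ V, z + Complex.I ∈ V

namespace AnnularPair

variable {U V : Set ℂ} {M : ℝ}

theorem upper_add_lat (h : AnnularPair U V M) {z : ℂ} (hz : z ∈ V) {w : ℤ × ℤ} (hw : 0 ≤ w.2) :
    z + lat w ∈ V := by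
  have key : ∀ n : ℕ, z + n * Complex.I ∈ V := by
    intro n
    induction n with
    | zero => simpa using hz
    | succ n ih =>
      convert h.upper_add_I _ ih using 1
      push_cast
      ring
  have := (add_int_mem_iff h.upper_add_one w.1 _).2 (key w.2.toNat)
  convert this using 1
  have h2 : ((w.2.toNat : ℤ) : ℝ) = (w.2 : ℝ) := by rw [Int.toNat_of_nonneg hw]
  rw [Int.cast_natCast] at h2
  apply Complex.ext <;> simp [h2]

theorem lower_add_lat (h : AnnularPair U V M) {z : ℂ} (hz : z ∈ U) {w : ℤ × ℤ} (hw : w.2 ≤ 0) :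
    z + lat w ∈ U := by
  have key : ∀ n : ℕ, z - n * Complex.I ∈ U := by
    intro n
    induction n with
    | zero => simpa using hz
    | succ n ih =>
      convert h.lower_sub_I _ ih using 1
      push_cast
      ring
  have := (add_int_mem_iff h.lower_add_one w.1 _).2 (key (-w.2).toNat)
  convert this using 1
  have h2 : (((-w.2).toNat : ℤ) : ℝ) = ((-w.2 : ℤ) : ℝ) := by rw [Int.toNat_of_nonneg (by omega)]
  rw [Int.cast_natCast] at h2
  apply Complex.ext <;> simp [h2]

theorem isPreconnected_compl_upper (h : AnnularPair U V M) : IsPreconnected Vᶜ :=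
  h.isPreconnected_lower.compl_of_maximal
    ⟨⟨0, -M - 1⟩, h.low _ (by simp only; linarith)⟩ h.disjoint.symm h.isOpen_upper h.max_upper

theorem isPreconnected_compl_lower (h : AnnularPair U V M) : IsPreconnected Uᶜ :=
  h.isPreconnected_upper.compl_of_maximal
    ⟨⟨0, M + 1⟩, h.high _ (by simp only; linarith)⟩ h.disjoint h.isOpen_lower h.max_lower

theorem abs_im_le (h : AnnularPair U V M) {z : ℂ} (hz : z ∈ (U ∪ V)ᶜ) : |z.im| ≤ M := by
  rw [abs_le]
  constructor
  · by_contra hlt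
    exact hz (Or.inl (h.low z (by linarith)))
  · by_contra hlt
    exact hz (Or.inr (h.high z (by linarith)))

theorem add_one_mem_compl (h : AnnularPair U V M) (z : ℂ) :
    z + 1 ∈ (U ∪ V)ᶜ ↔ z ∈ (U ∪ V)ᶜ := by
  simp only [Set.mem_compl_iff, Set.mem_union, h.lower_add_one, h.upper_add_one]

/-- The region between the pair and its upward translate. -/
theorem inter_shift_nonempty (h : AnnularPair U V M) :
    (V ∩ {z | z - Complex.I ∈ U}).Nonempty := by
  by_contra hne
  rw [Set.not_nonempty_iff_eq_empty] at hne
  have hc : Continuous fun z : ℂ => z - Complex.I := by fun_prop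
  have himg : {z | z - Complex.I ∈ U} = (fun z => z + Complex.I) '' U := by
    ext z
    constructor
    · intro hz
      exact ⟨z - Complex.I, hz, by ring⟩
    · rintro ⟨w, hw, rfl⟩
      simpa using hw
  have hsub : {z | z - Complex.I ∈ U} ⊆ U := by
    refine h.max_lower _ (h.isOpen_lower.preimage hc) ?_ ?_ ?_
    · rw [himg]
      exact h.isPreconnected_lower.image _ (by fun_prop)
    · rw [Set.disjoint_iff_inter_eq_empty, Set.inter_comm]
      exact hne
    · refine ⟨⟨0, -M - 1⟩, h.lower_sub_I _ (h.low _ ?_), h.low _ ?_⟩ <;>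
      · simp only
        linarith
  have hup : ∀ n : ℕ, ∀ z ∈ U, z + n * Complex.I ∈ U := by
    intro n z hz
    induction n with
    | zero => simpa using hz
    | succ n ih =>
      apply hsub
      rw [Set.mem_ofPred_eq]
      convert ih using 1
      push_cast
      ring
  obtain ⟨n, hn⟩ := exists_nat_gt (2 * M + 1)
  have h1 := hup n ⟨0, -M - 1⟩ (h.low _ (by simp only; linarith))
  refine Set.disjoint_left.1 h.disjoint h1 (h.high _ ?_)
  simp
  linarith

theorem not_joinedIn (h : AnnularPair U V M) {x y : ℂ} (hx : x ∈ V) (hy : y ∈ U) :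
    ¬ JoinedIn (U ∪ V) x y := by
  rintro ⟨γ, hγ⟩
  obtain ⟨z, -, hz1, hz2⟩ := (isPreconnected_range γ.continuous) U V h.isOpen_lower
    h.isOpen_upper (Set.range_subset_iff.2 hγ) ⟨y, ⟨1, γ.target⟩, hy⟩ ⟨x, ⟨0, γ.source⟩, hx⟩
  exact Set.disjoint_left.1 h.disjoint hz1 hz2

/-- Removing from the separating set a closed separating subset leaves an open set. -/
theorem isOpen_diff (h : AnnularPair U V M) {A : Set ℂ} (hA : IsClosed A) (hAC : A ⊆ (U ∪ V)ᶜ)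
    {x y : ℂ} (hx : x ∈ V) (hy : y ∈ U) (hxy : ¬ JoinedIn Aᶜ x y) : IsOpen ((U ∪ V)ᶜ \ A) := by
  rw [isOpen_iff_mem_nhds]
  rintro z ⟨hzC, hzA⟩
  set W := connectedComponentIn Aᶜ z
  have hWo : IsOpen W := hA.isOpen_compl.connectedComponentIn
  have hzW : z ∈ W := mem_connectedComponentIn hzA
  have hWA : W ⊆ Aᶜ := connectedComponentIn_subset _ _
  have hWp : IsPreconnected W := isPreconnected_connectedComponentIn
  have hUA : U ⊆ Aᶜ := fun w hw hwA => hAC hwA (Or.inl hw)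
  have hVA : V ⊆ Aᶜ := fun w hw hwA => hAC hwA (Or.inr hw)
  have hnot : ¬ ((W ∩ U).Nonempty ∧ (W ∩ V).Nonempty) := by
    rintro ⟨⟨a, haW, haU⟩, ⟨b, hbW, hbV⟩⟩
    have hp : IsPreconnected (U ∪ W ∪ V) :=
      (IsPreconnected.union a haU haW h.isPreconnected_lower hWp).union b (Or.inr hbW) hbV
        h.isPreconnected_upper
    have ho : IsOpen (U ∪ W ∪ V) := (h.isOpen_lower.union hWo).union h.isOpen_upper
    have hpc := ho.isConnected_iff_isPathConnected.1 ⟨⟨x, Or.inr hx⟩, hp⟩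
    exact hxy ((hpc.joinedIn x (Or.inr hx) y (Or.inl (Or.inl hy))).mono
      (Set.union_subset (Set.union_subset hUA hWA) hVA))
  have hWU : Disjoint W U := by
    by_contra hne
    rw [Set.not_disjoint_iff_nonempty_inter] at hne
    have hd : Disjoint W V := by
      by_contra hne'
      rw [Set.not_disjoint_iff_nonempty_inter] at hne'
      exact hnot ⟨hne, hne'⟩
    exact hzC (Or.inl (h.max_lower W hWo hWp hd hne hzW))
  have hWV : Disjoint W V := by
    by_contra hne
    rw [Set.not_disjoint_iff_nonempty_inter] at hne
    exact hzC (Or.inr (h.max_upper W hWo hWp hWU hne hzW))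
  refine Filter.mem_of_superset (hWo.mem_nhds hzW) fun w hw => ⟨?_, hWA hw⟩
  rintro (hwU | hwV)
  · exact Set.disjoint_left.1 hWU hw hwU
  · exact Set.disjoint_left.1 hWV hw hwV

/-- If the strip between the pair and its upward translate carries a horizontal translation, then
the pair and its translate cover the plane. -/
theorem mem_or_shift_mem (h : AnnularPair U V M) {D : Set ℂ} (hD : IsOpen D)
    (hDp : IsPreconnected D) (hDE : D ⊆ V ∩ {z | z - Complex.I ∈ U}) {z₀ : ℂ} {k : ℤ} (hk : k ≠ 0)
    (hz : z₀ ∈ D) (hzk : z₀ + k ∈ D) (z : ℂ) : z ∈ V ∨ z - Complex.I ∈ U := by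
  by_contra hcon
  push Not at hcon
  obtain ⟨γ, hγ⟩ := (hD.isConnected_iff_isPathConnected.1 ⟨⟨z₀, hz⟩, hDp⟩).joinedIn
    z₀ hz (z₀ + k) hzk
  have hK : IsCompact (Set.range γ) := isCompact_range γ.continuous
  let q : ℂ → ℂ := fun w => Complex.exp (2 * Real.pi * Complex.I * w)
  have hq : Continuous q := by fun_prop
  let A : Set ℂ := q ⁻¹' (q '' Set.range γ)
  have hAcl : IsClosed A := (hK.image hq).isClosed.preimage hq
  have hmemA : ∀ w, w ∈ A ↔ ∃ (t : unitInterval) (n : ℤ), w = γ t + n := by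
    intro w
    simp only [A, Set.mem_preimage, Set.mem_image, Set.exists_range_iff]
    constructor
    · rintro ⟨t, ht⟩
      obtain ⟨n, hn⟩ := Complex.exp_eq_exp_iff_exists_int.1 ht
      refine ⟨t, -n, ?_⟩
      have hpi : (2 * Real.pi * Complex.I : ℂ) ≠ 0 := Complex.two_pi_I_ne_zero
      apply mul_left_cancel₀ hpi
      push_cast
      linear_combination -hn
    · rintro ⟨t, n, rfl⟩
      refine ⟨t, ?_⟩
      simp only [q]
      rw [exp_two_pi_I_mul_add_int]
  have hAE : ∀ w ∈ A, w ∈ V ∧ w - Complex.I ∈ U := by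
    intro w hw
    obtain ⟨t, n, rfl⟩ := (hmemA w).1 hw
    obtain ⟨h1, h2⟩ := hDE (hγ t)
    refine ⟨(add_int_mem_iff h.upper_add_one n _).2 h1, ?_⟩
    have := (add_int_mem_iff h.lower_add_one n _).2 h2
    convert this using 1
    ring
  have hA1 : ∀ w, w + 1 ∈ A ↔ w ∈ A := by
    intro w
    rw [hmemA, hmemA]
    constructor
    · rintro ⟨t, n, hn⟩
      exact ⟨t, n - 1, by push_cast; linear_combination hn⟩
    · rintro ⟨t, n, hn⟩
      exact ⟨t, n + 1, by push_cast; linear_combination hn⟩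
  have hM : ∀ w ∈ A, |w.im| ≤ |M| + 1 := by
    intro w hw
    obtain ⟨h1, h2⟩ := hAE w hw
    have e1 : ¬ w.im < -M := fun hlt => Set.disjoint_left.1 h.disjoint (h.low w hlt) h1
    have e2 : ¬ M < w.im - 1 := fun hlt =>
      Set.disjoint_left.1 h.disjoint h2 (h.high _ (by simpa using hlt))
    have := le_abs_self M
    rw [abs_le]
    constructor <;> linarith
  refine not_joinedIn_compl_of_isPreconnected hA1 hM (x := ⟨0, |M| + 2⟩) (y := ⟨0, -(|M| + 2)⟩)
    (by simp only; linarith) (by simp only; linarith)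
    (isPreconnected_range γ.continuous) ?_ hk (z := z₀) ⟨0, γ.source⟩ ⟨1, γ.target⟩ ?_
  · rintro _ ⟨t, rfl⟩
    exact (hmemA _).2 ⟨t, 0, by simp⟩
  · have hshift : IsPreconnected {w | w - Complex.I ∈ Uᶜ} := by
      have : {w | w - Complex.I ∈ Uᶜ} = (fun w => w + Complex.I) '' Uᶜ := by
        ext w
        constructor
        · intro hw
          exact ⟨w - Complex.I, hw, by ring⟩
        · rintro ⟨w, hw, rfl⟩
          simpa using hw
      rw [this]
      exact h.isPreconnected_compl_lower.image _ (by fun_prop)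
    have hconn : IsPreconnected (Vᶜ ∪ {w | w - Complex.I ∈ Uᶜ}) :=
      IsPreconnected.union z hcon.1 hcon.2 h.isPreconnected_compl_upper hshift
    have hsub : Vᶜ ∪ {w | w - Complex.I ∈ Uᶜ} ⊆ Aᶜ := by
      rintro w (hw | hw) hwA
      · exact hw (hAE w hwA).1
      · exact hw (hAE w hwA).2
    have hMle := le_abs_self M
    have hlow : (⟨0, -(|M| + 2)⟩ : ℂ) ∈ Vᶜ ∪ {w | w - Complex.I ∈ Uᶜ} :=
      Or.inl fun hv => Set.disjoint_left.1 h.disjoint (h.low _ (by simp only; linarith)) hv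
    have hhigh : (⟨0, |M| + 2⟩ : ℂ) ∈ Vᶜ ∪ {w | w - Complex.I ∈ Uᶜ} :=
      Or.inr fun hv => Set.disjoint_left.1 h.disjoint hv (h.high _ (by simp; linarith))
    set W := connectedComponentIn Aᶜ z
    have hzA : z ∈ Aᶜ := hsub (Or.inl hcon.1)
    have hWo : IsOpen W := hAcl.isOpen_compl.connectedComponentIn
    have hWsub := hconn.subset_connectedComponentIn (Or.inl hcon.1) hsub
    have hpc := hWo.isConnected_iff_isPathConnected.1
      ⟨⟨z, mem_connectedComponentIn hzA⟩, isPreconnected_connectedComponentIn⟩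
    exact (hpc.joinedIn _ (hWsub hhigh) _ (hWsub hlow)).mono (connectedComponentIn_subset _ _)

end AnnularPair

section

/-- A continuous map which is injective on a compact set has a section over its image. -/
theorem IsCompact.exists_section {α β : Type*} [TopologicalSpace α] [TopologicalSpace β]
    [T2Space β] [Nonempty α] {p : α → β} {K : Set α} (hK : IsCompact K) (hp : Continuous p)
    (hinj : Set.InjOn p K) :
    ∃ s : β → α, ContinuousOn s (p '' K) ∧ ∀ x ∈ p '' K, s x ∈ K ∧ p (s x) = x := by
  have hs : ∀ x ∈ p '' K, Function.invFunOn p K x ∈ K ∧ p (Function.invFunOn p K x) = x :=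
    fun x hx => ⟨Function.invFunOn_mem hx, Function.invFunOn_eq hx⟩
  refine ⟨Function.invFunOn p K, ?_, hs⟩
  rw [continuousOn_iff_isClosed]
  intro t ht
  refine ⟨p '' (t ∩ K), ((hK.inter_left ht).image hp).isClosed, ?_⟩
  ext x
  constructor
  · rintro ⟨h1, h2⟩
    exact ⟨⟨_, ⟨h1, (hs x h2).1⟩, (hs x h2).2⟩, h2⟩
  · rintro ⟨⟨a, ⟨hat, haK⟩, rfl⟩, h2⟩
    refine ⟨?_, h2⟩
    rw [Set.mem_preimage, hinj (hs _ h2).1 haK (hs _ h2).2]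
    exact hat

/-- A one-periodic closed subset of a horizontal strip is the set of translates of a compact
set. -/
theorem isCompact_inter_re_mem_Icc {A : Set ℂ} (hA : IsClosed A) {M : ℝ}
    (hM : ∀ z ∈ A, |z.im| ≤ M) (a b : ℝ) : IsCompact (A ∩ {z | z.re ∈ Set.Icc a b}) := by
  have h : IsCompact (Set.Icc a b ×ℂ Set.Icc (-M) M) :=
    isCompact_Icc.reProdIm isCompact_Icc
  refine h.of_isClosed_subset (hA.inter (isClosed_Icc.preimage Complex.continuous_re)) ?_
  rintro z ⟨hz, hzr⟩
  exact ⟨hzr, abs_le.1 (hM z hz)⟩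

variable {X : Type*} [TopologicalSpace X] {p : ℂ → X}

theorem TorusCover.image_eq_image_strip (hp : TorusCover p) {A : Set ℂ}
    (hA1 : ∀ z, z + 1 ∈ A ↔ z ∈ A) : p '' A = p '' (A ∩ {z | z.re ∈ Set.Icc 0 1}) := by
  refine subset_antisymm ?_ (Set.image_mono Set.inter_subset_left)
  rintro _ ⟨z, hz, rfl⟩
  refine ⟨z + ((-⌊z.re⌋ : ℤ) : ℂ), ⟨(add_int_mem_iff hA1 _ _).2 hz, ?_⟩, ?_⟩
  · have h1 := Int.floor_le z.re
    have h2 := Int.lt_floor_add_one z.re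
    rw [Set.mem_ofPred_eq, Complex.add_re, Complex.intCast_re, Int.cast_neg, Set.mem_Icc]
    constructor <;> linarith
  · rw [show ((-⌊z.re⌋ : ℤ) : ℂ) = lat (-⌊z.re⌋, 0) by apply Complex.ext <;> simp,
      hp.apply_add_lat]

theorem TorusCover.isCompact_image (hp : TorusCover p) {A : Set ℂ} (hA : IsClosed A)
    (hA1 : ∀ z, z + 1 ∈ A ↔ z ∈ A) {M : ℝ} (hM : ∀ z ∈ A, |z.im| ≤ M) : IsCompact (p '' A) := by
  rw [hp.image_eq_image_strip hA1]
  exact (isCompact_inter_re_mem_Icc hA hM 0 1).image hp.continuous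

/-- A connected horizontal set whose lift does not separate the plane is inessential. -/
theorem TorusCover.inessential_of_joinedIn [T2Space X] (hp : TorusCover p) {A : Set ℂ}
    (hA : IsClosed A) (hA1 : ∀ z, z + 1 ∈ A ↔ z ∈ A) {M : ℝ} (hM : ∀ z ∈ A, |z.im| ≤ M)
    (hinj : ∀ z ∈ A, ∀ v, z + lat v ∈ A → v.2 = 0) (hc : IsConnected (p '' A)) {x y : ℂ}
    (hx : M < x.im) (hy : y.im < -M) (hxy : JoinedIn Aᶜ x y) : Inessential (p '' A) := by
  obtain ⟨τ, hτ, hτadd⟩ := exists_shift_coordinate hA1 hM hx hy hxy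
  let K : Set ℂ := A ∩ τ ⁻¹' {0}
  have hKcl : IsClosed K := hτ.preimage_isClosed_of_isClosed hA (isClosed_discrete _)
  have himg : p '' K = p '' A := by
    refine subset_antisymm (Set.image_mono Set.inter_subset_left) ?_
    rintro _ ⟨z, hz, rfl⟩
    refine ⟨z + ((-τ z : ℤ) : ℂ), ⟨(add_int_mem_iff hA1 _ _).2 hz, ?_⟩, ?_⟩
    · rw [Set.mem_preimage, hτadd z hz]
      simp
    · rw [show ((-τ z : ℤ) : ℂ) = lat (-τ z, 0) by apply Complex.ext <;> simp, hp.apply_add_lat]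
  have hbd : ∃ B : ℝ, ∀ z ∈ K, |z.re| ≤ B := by
    have hS := isCompact_inter_re_mem_Icc hA hM 0 1
    have hcont : ContinuousOn (fun z => (τ z : ℝ)) (A ∩ {z | z.re ∈ Set.Icc 0 1}) :=
      (continuous_of_discreteTopology (f := fun n : ℤ => (n : ℝ))).comp_continuousOn
        (hτ.mono Set.inter_subset_left)
    obtain ⟨B, hB⟩ := hS.exists_bound_of_continuousOn hcont
    refine ⟨B + 1, fun z hz => ?_⟩
    have h1 := Int.floor_le z.re
    have h2 := Int.lt_floor_add_one z.re
    have h3 := hB (z + ((-⌊z.re⌋ : ℤ) : ℂ)) ⟨(add_int_mem_iff hA1 _ _).2 hz.1, by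
      rw [Set.mem_ofPred_eq, Complex.add_re, Complex.intCast_re, Int.cast_neg, Set.mem_Icc]
      constructor <;> linarith⟩
    rw [hτadd z hz.1, show τ z = 0 from hz.2, zero_add, Int.cast_neg, norm_neg,
      Real.norm_eq_abs] at h3
    rw [abs_le] at h3 ⊢
    constructor <;> linarith
  obtain ⟨B, hB⟩ := hbd
  have hKc : IsCompact K := by
    have := isCompact_inter_re_mem_Icc hKcl (fun z hz => hM z hz.1) (-B) B
    have e : K ∩ {z | z.re ∈ Set.Icc (-B) B} = K :=
      Set.inter_eq_left.2 fun z hz => abs_le.1 (hB z hz)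
    rwa [e] at this
  have hKinj : Set.InjOn p K := by
    intro z hz w hw hzw
    obtain ⟨v, rfl⟩ := (hp.eq_iff _ _).1 hzw
    have hv2 := hinj z hz.1 v hw.1
    have hlat : lat v = (v.1 : ℂ) := by apply Complex.ext <;> simp [hv2]
    have h1 : τ (z + lat v) = 0 := hw.2
    rw [hlat, hτadd z hz.1, show τ z = 0 from hz.2, zero_add] at h1
    rw [hlat, h1]
    simp
  obtain ⟨s, hs, hps⟩ := hKc.exists_section hp.continuous hKinj
  rw [himg] at hs hps
  exact hp.inessential_of_section (hp.isCompact_image hA hA1 hM) hc hs fun x hx => (hps x hx).2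

/-- The defining properties of a circloid, except minimality, in a general space. -/
def CircloidProps (C : Set X) : Prop :=
  IsCompact C ∧ IsConnected C ∧ ¬ Inessential C ∧ IsConnected Cᶜ ∧
    ∃ Γ ⊆ Cᶜ, (∃ e : AddCircle (1 : ℝ) → X, IsEmbedding e ∧ Γ = Set.range e) ∧ ¬ Inessential Γ

namespace AnnularPair

variable {U V : Set ℂ} {M : ℝ}

theorem add_lat_mem_compl (h : AnnularPair U V M) (hstar : ∀ z, z ∈ V ∨ z - Complex.I ∈ U) {z : ℂ}
    (hz : z ∈ (U ∪ V)ᶜ) {v : ℤ × ℤ} (hv : z + lat v ∈ (U ∪ V)ᶜ) : v.2 = 0 := by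
  have key : ∀ w, w ∈ (U ∪ V)ᶜ → ∀ u : ℤ × ℤ, u.2 < 0 → w + lat u ∈ U := by
    intro w hw u hu
    have h1 : w - Complex.I ∈ U := (hstar w).resolve_left fun hV => hw (Or.inr hV)
    have h2 := h.lower_add_lat h1 (w := u + (0, 1)) (by simp; omega)
    convert h2 using 1
    apply Complex.ext <;> simp
  rcases lt_trichotomy v.2 0 with h1 | h1 | h1
  · exact absurd (Or.inl (key z hz v h1)) hv
  · exact h1
  · refine absurd (Or.inl ?_) hz
    have := key _ hv (-v) (by simpa using h1)
    rwa [lat_neg, add_neg_cancel_right] at this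

theorem isPreconnected_image [T2Space X] (h : AnnularPair U V M) (hp : TorusCover p) :
    IsPreconnected (p '' (U ∪ V)ᶜ) := by
  have hC : IsClosed (U ∪ V)ᶜ := (h.isOpen_lower.union h.isOpen_upper).isClosed_compl
  have hx : (⟨0, M + 1⟩ : ℂ) ∈ V := h.high _ (by simp only; linarith)
  have hy : (⟨0, -M - 1⟩ : ℂ) ∈ U := h.low _ (by simp only; linarith)
  have main : ∀ A B : Set ℂ, IsClosed A → IsClosed B → Disjoint A B → A ∪ B = (U ∪ V)ᶜ →
      B.Nonempty → JoinedIn Aᶜ ⟨0, M + 1⟩ ⟨0, -M - 1⟩ := by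
    intro A B hA hB hAB hun hBne
    by_contra hj
    have hop := h.isOpen_diff hA (hun ▸ Set.subset_union_left) hx hy hj
    have hBe : (U ∪ V)ᶜ \ A = B := by
      rw [← hun, Set.union_sdiff_left, hAB.symm.sdiff_eq_left]
    rw [hBe] at hop
    have := IsClopen.eq_univ ⟨hB, hop⟩ hBne
    have h1 : (⟨0, M + 1⟩ : ℂ) ∈ (U ∪ V)ᶜ := hun ▸ Or.inr (this ▸ Set.mem_univ _)
    exact h1 (Or.inr hx)
  rw [isPreconnected_closed_iff]
  intro t t' ht ht' hcov hne hne'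
  by_contra hemp
  rw [Set.not_nonempty_iff_eq_empty] at hemp
  set A := (U ∪ V)ᶜ ∩ p ⁻¹' t
  set B := (U ∪ V)ᶜ ∩ p ⁻¹' t'
  have hA : IsClosed A := hC.inter (ht.preimage hp.continuous)
  have hB : IsClosed B := hC.inter (ht'.preimage hp.continuous)
  have hAB : Disjoint A B := by
    rw [Set.disjoint_left]
    intro z hz hz'
    have : p z ∈ p '' (U ∪ V)ᶜ ∩ (t ∩ t') := ⟨⟨z, hz.1, rfl⟩, hz.2, hz'.2⟩
    rw [hemp] at this
    exact this
  have hun : A ∪ B = (U ∪ V)ᶜ := by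
    rw [← Set.inter_union_distrib_left]
    exact Set.inter_eq_left.2 fun z hz => hcov ⟨z, hz, rfl⟩
  have hAne : A.Nonempty := by
    obtain ⟨_, ⟨z, hz, rfl⟩, hzt⟩ := hne
    exact ⟨z, hz, hzt⟩
  have hBne : B.Nonempty := by
    obtain ⟨_, ⟨z, hz, rfl⟩, hzt⟩ := hne'
    exact ⟨z, hz, hzt⟩
  obtain ⟨γ, hγ⟩ := main A B hA hB hAB hun hBne
  obtain ⟨η, hη⟩ := main B A hB hA hAB.symm (by rw [Set.union_comm]; exact hun) hAne
  refine janiszewski hA hB hAB h.isOpen_lower h.isOpen_upper h.disjoint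
    (by rw [hun, compl_compl]) (isPreconnected_range γ.continuous)
    (isPreconnected_range η.continuous) ?_ ?_ hy hx ⟨1, γ.target⟩ ⟨0, γ.source⟩ ⟨1, η.target⟩
    ⟨0, η.source⟩
  · rw [Set.disjoint_left]
    rintro _ ⟨t, rfl⟩
    exact hγ t
  · rw [Set.disjoint_left]
    rintro _ ⟨t, rfl⟩
    exact hη t

theorem compl_image_eq (h : AnnularPair U V M) (hp : TorusCover p) :
    (p '' (U ∪ V)ᶜ)ᶜ = p '' (V ∩ {z | z - Complex.I ∈ U}) := by
  ext x
  constructor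
  · intro hx
    obtain ⟨z, rfl⟩ := hp.surj x
    have hz : ∀ n : ℤ, z - n * Complex.I ∈ U ∪ V := by
      intro n
      by_contra hn
      refine hx ⟨_, hn, ?_⟩
      rw [show z - n * Complex.I = z + lat (0, -n) by apply Complex.ext <;> simp [sub_eq_add_neg],
        hp.apply_add_lat]
    obtain ⟨n₀, hn₀⟩ := exists_int_lt (z.im - M)
    have hinh : z - n₀ * Complex.I ∈ V := h.high _ (by simp; linarith)
    obtain ⟨n₁, hn₁⟩ := exists_int_gt (z.im + M)
    have hbdd : ∀ n : ℤ, z - n * Complex.I ∈ V → n ≤ n₁ := by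
      intro n hn
      by_contra hlt
      push Not at hlt
      have : (n₁ : ℝ) < n := by exact_mod_cast hlt
      exact Set.disjoint_left.1 h.disjoint (h.low _ (by simp; linarith)) hn
    obtain ⟨n, hn, hmax⟩ := Int.exists_greatest_of_bdd ⟨n₁, hbdd⟩ ⟨n₀, hinh⟩
    refine ⟨z - n * Complex.I, ⟨hn, ?_⟩, ?_⟩
    · rcases hz (n + 1) with h1 | h1
      · rw [Set.mem_ofPred_eq]
        convert h1 using 1
        push_cast
        ring
      · have := hmax _ h1
        omega
    · rw [show z - n * Complex.I = z + lat (0, -n) by apply Complex.ext <;> simp [sub_eq_add_neg],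
        hp.apply_add_lat]
  · rintro ⟨z, ⟨hzV, hzU⟩, rfl⟩ ⟨w, hw, hwz⟩
    obtain ⟨v, rfl⟩ := (hp.eq_iff _ _).1 hwz.symm
    by_cases hv : 0 ≤ v.2
    · exact hw (Or.inr (h.upper_add_lat hzV hv))
    · refine hw (Or.inl ?_)
      have := h.lower_add_lat hzU (w := v + (0, 1)) (by simp; omega)
      convert this using 1
      apply Complex.ext <;> simp

/-- The separating set of an annular pair which, together with its translate, covers the plane,
projects to a circloid. -/
theorem isCircloid [T2Space X] (h : AnnularPair U V M)
    (hstar : ∀ z, z ∈ V ∨ z - Complex.I ∈ U) (hp : TorusCover p) :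
    CircloidProps (p '' (U ∪ V)ᶜ) ∧
      ∀ C' ⊆ p '' (U ∪ V)ᶜ, CircloidProps C' → C' = p '' (U ∪ V)ᶜ := by
  have hC : IsClosed (U ∪ V)ᶜ := (h.isOpen_lower.union h.isOpen_upper).isClosed_compl
  have hCcpt : IsCompact (p '' (U ∪ V)ᶜ) :=
    hp.isCompact_image hC h.add_one_mem_compl fun z hz => h.abs_im_le hz
  set E : Set ℂ := V ∩ {z | z - Complex.I ∈ U} with hEdef
  have hcomp : (p '' (U ∪ V)ᶜ)ᶜ = p '' E := h.compl_image_eq hp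
  have hUIo : IsOpen {z | z - Complex.I ∈ U} := h.isOpen_lower.preimage (by fun_prop)
  have hUIc : IsPreconnected {z | z - Complex.I ∈ U} := by
    have : {w | w - Complex.I ∈ U} = (fun w => w + Complex.I) '' U := by
      ext w
      constructor
      · intro hw
        exact ⟨w - Complex.I, hw, by ring⟩
      · rintro ⟨w, hw, rfl⟩
        simpa using hw
    rw [this]
    exact h.isPreconnected_lower.image _ (by fun_prop)
  have hEo : IsOpen E := h.isOpen_upper.inter hUIo
  have hEc : IsConnected E := ⟨h.inter_shift_nonempty,
    IsPreconnected.inter_of_union_eq_univ h.isOpen_upper hUIo h.isPreconnected_upper hUIc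
      (Set.eq_univ_of_forall hstar)⟩
  have hE1 : ∀ z, z + 1 ∈ E ↔ z ∈ E := by
    intro z
    simp only [hEdef, Set.mem_inter_iff, Set.mem_ofPred_eq, h.upper_add_one]
    rw [show z + 1 - Complex.I = z - Complex.I + 1 by ring, h.lower_add_one]
  have hEdisj : ∀ z ∈ E, ∀ v, z + lat v ∈ E → v.2 = 0 := by
    rintro z ⟨hzV, hzU⟩ v ⟨hvV, hvU⟩
    rcases lt_trichotomy v.2 0 with h1 | h1 | h1
    · refine absurd hvV (Set.disjoint_left.1 h.disjoint ?_)
      have := h.lower_add_lat hzU (w := v + (0, 1)) (by simp; omega)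
      convert this using 1
      apply Complex.ext <;> simp
    · exact h1
    · refine absurd ?_ (Set.disjoint_left.1 h.disjoint hvU)
      have := h.upper_add_lat hzV (w := v - (0, 1)) (by simp; omega)
      convert this using 1
      apply Complex.ext <;> simp
      ring
  have hess : ¬ Inessential (p '' (U ∪ V)ᶜ) := by
    intro hi
    obtain ⟨x, y, hx, hy, hxy⟩ := hp.exists_joinedIn_compl_of_inessential hCcpt hi M
    refine h.not_joinedIn (h.high x hx) (h.low y hy) (hxy.mono ?_)
    intro z hz
    by_contra hzC
    exact hz ⟨z, hzC, rfl⟩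
  have hCne : (p '' (U ∪ V)ᶜ).Nonempty := by
    by_contra hne
    rw [Set.not_nonempty_iff_eq_empty] at hne
    have : (U ∪ V)ᶜ = ∅ := Set.image_eq_empty.1 hne
    have hun : U ∪ V = Set.univ := Set.compl_empty_iff.1 this
    refine h.not_joinedIn (x := ⟨0, M + 1⟩) (y := ⟨0, -M - 1⟩) (h.high _ (by simp only; linarith))
      (h.low _ (by simp only; linarith)) ?_
    rw [hun]
    exact joinedIn_univ.2 (PathConnectedSpace.joined _ _)
  have hcompl : IsConnected (p '' (U ∪ V)ᶜ)ᶜ := by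
    rw [hcomp]
    exact hEc.image p hp.continuous.continuousOn
  refine ⟨⟨hCcpt, ⟨hCne, h.isPreconnected_image hp⟩, hess, hcompl, ?_⟩, ?_⟩
  · obtain ⟨e, he, heE, hne⟩ := hp.exists_essential_curve hEo hEc hE1 hEdisj
    exact ⟨Set.range e, by rwa [hcomp], ⟨e, he, rfl⟩, hne⟩
  · rintro C' hC' ⟨hc1, hc2, hc3, hc4, -⟩
    set A := (U ∪ V)ᶜ ∩ p ⁻¹' C' with hAdef
    have hA : IsClosed A := hC.inter (hc1.isClosed.preimage hp.continuous)
    have hpA : p '' A = C' := by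
      rw [hAdef, Set.image_inter_preimage]
      exact Set.inter_eq_right.2 hC'
    have hx : (⟨0, M + 1⟩ : ℂ) ∈ V := h.high _ (by simp only; linarith)
    have hy : (⟨0, -M - 1⟩ : ℂ) ∈ U := h.low _ (by simp only; linarith)
    by_cases hj : JoinedIn Aᶜ ⟨0, M + 1⟩ ⟨0, -M - 1⟩
    · refine absurd ?_ hc3
      rw [← hpA]
      refine hp.inessential_of_joinedIn hA (fun z => ?_) (fun z hz => h.abs_im_le hz.1)
        (fun z hz v hv => h.add_lat_mem_compl hstar hz.1 hv.1) (by rwa [hpA]) (x := ⟨0, M + 1⟩)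
        (y := ⟨0, -M - 1⟩) (by simp) (by simp) hj
      rw [hAdef, Set.mem_inter_iff, Set.mem_inter_iff, h.add_one_mem_compl, Set.mem_preimage,
        Set.mem_preimage, show z + 1 = z + lat (1, 0) by apply Complex.ext <;> simp,
        hp.apply_add_lat]
    · have hop := hp.isOpenMap _ (h.isOpen_diff hA Set.inter_subset_left hx hy hj)
      refine subset_antisymm hC' fun x hxC => ?_
      by_contra hxC'
      obtain ⟨z, hz, rfl⟩ := hxC
      obtain ⟨b, hb⟩ := hcompl.nonempty
      have hco : IsOpen (p '' (U ∪ V)ᶜ)ᶜ := hCcpt.isClosed.isOpen_compl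
      have hcov : C'ᶜ ⊆ p '' ((U ∪ V)ᶜ \ A) ∪ (p '' (U ∪ V)ᶜ)ᶜ := by
        intro y hy
        by_cases hyC : y ∈ p '' (U ∪ V)ᶜ
        · obtain ⟨w, hw, rfl⟩ := hyC
          exact Or.inl ⟨w, ⟨hw, fun hwA => hy hwA.2⟩, rfl⟩
        · exact Or.inr hyC
      obtain ⟨y, -, ⟨w, hw, rfl⟩, hy2⟩ := hc4.isPreconnected _ _ hop hco hcov
        ⟨p z, hxC', ⟨z, ⟨hz, fun hzA => hxC' hzA.2⟩, rfl⟩⟩ ⟨b, fun hb' => hb (hC' hb'), hb⟩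
      exact hy2 ⟨w, hw.1, rfl⟩

end AnnularPair

end

theorem isPreconnected_lt_im (c : ℝ) : IsPreconnected {z : ℂ | c < z.im} :=
  (convex_halfSpace_im_gt c).isPreconnected

theorem isPreconnected_im_lt (c : ℝ) : IsPreconnected {z : ℂ | z.im < c} :=
  (convex_halfSpace_im_lt c).isPreconnected

/-- A homeomorphism preserving a set up to inclusion in both directions preserves the component
of its complement which contains a half plane. -/
theorem connectedComponentIn_invariant {B S : Set ℂ} {x : ℂ}
    (hSB : S ⊆ connectedComponentIn B x) {H : ℂ → ℂ} (hH : Continuous H)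
    (hHB : ∀ z ∈ B, H z ∈ B) (hHS : ∃ y ∈ S, H y ∈ S) {z : ℂ}
    (hz : z ∈ connectedComponentIn B x) : H z ∈ connectedComponentIn B x := by
  obtain ⟨y, hy, hHy⟩ := hHS
  have hpre : IsPreconnected (H '' connectedComponentIn B x) :=
    isPreconnected_connectedComponentIn.image H hH.continuousOn
  have hsub : H '' connectedComponentIn B x ⊆ B := by
    rintro _ ⟨w, hw, rfl⟩
    exact hHB w (connectedComponentIn_subset _ _ hw)
  have h1 := hpre.subset_connectedComponentIn (x := H y) ⟨y, hSB hy, rfl⟩ hsub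
  rw [connectedComponentIn_eq (hSB hHy)]
  exact h1 ⟨z, hz, rfl⟩

/-- A group of homeomorphisms with uniformly bounded vertical displacement preserves an annular
pair. -/
theorem exists_annularPair (𝒢 : Subgroup (ℂ ≃ₜ ℂ)) {c : ℝ}
    (hc : ∀ H ∈ 𝒢, ∀ z, |(H z).im - z.im| ≤ c)
    (hI : ∀ H ∈ 𝒢, ∀ z, H (z + Complex.I) = H z + Complex.I)
    (h1 : Homeomorph.addRight (1 : ℂ) ∈ 𝒢) :
    ∃ (U V : Set ℂ) (M : ℝ), AnnularPair U V M ∧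
      ∀ H ∈ 𝒢, (∀ z, H z ∈ U ↔ z ∈ U) ∧ ∀ z, H z ∈ V ↔ z ∈ V := by
  have hc0 : 0 ≤ c := (abs_nonneg _).trans (hc 1 𝒢.one_mem 0)
  have hinv' : ∀ H ∈ 𝒢, ∀ z, H⁻¹ (H z) = z := fun H _ z => H.symm_apply_apply z
  -- the union of the images of the lower half plane
  let U₀ : Set ℂ := {z | ∃ H ∈ 𝒢, (H z).im < 0}
  have hU₀inv : ∀ H ∈ 𝒢, ∀ z, z ∈ U₀ → H z ∈ U₀ := by
    rintro H hH z ⟨K, hK, hKz⟩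
    refine ⟨K * H⁻¹, 𝒢.mul_mem hK (𝒢.inv_mem hH), ?_⟩
    change (K (H⁻¹ (H z))).im < 0
    rwa [hinv' H hH]
  have hclinv : ∀ H ∈ 𝒢, ∀ z, z ∈ (closure U₀)ᶜ → H z ∈ (closure U₀)ᶜ := by
    intro H hH z hz hHz
    apply hz
    have := map_mem_closure (H⁻¹).continuous hHz (hU₀inv _ (𝒢.inv_mem hH))
    rwa [hinv' H hH] at this
  have hU₀low : ∀ z : ℂ, z.im < 0 → z ∈ U₀ := fun z hz => ⟨1, 𝒢.one_mem, hz⟩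
  have hU₀high : ∀ z ∈ closure U₀, z.im ≤ c := by
    have hcl : IsClosed {z : ℂ | z.im ≤ c} := isClosed_le Complex.continuous_im continuous_const
    refine fun z hz => closure_minimal ?_ hcl hz
    rintro w ⟨H, hH, hw⟩
    have := (abs_le.1 (hc H hH w)).1
    rw [Set.mem_ofPred_eq]
    linarith
  have hU₀sub : ∀ z ∈ U₀, z - Complex.I ∈ U₀ := by
    rintro z ⟨H, hH, hz⟩
    refine ⟨H, hH, ?_⟩
    have := hI H hH (z - Complex.I)
    rw [sub_add_cancel] at this
    rw [this] at hz
    simp only [Complex.add_im, Complex.I_im] at hz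
    linarith
  let y₀ : ℂ := ⟨0, 3 * c + 2⟩
  let S : Set ℂ := {z | c < z.im}
  have hyS : y₀ ∈ S := by simp only [S, y₀, Set.mem_ofPred_eq]; linarith
  let V : Set ℂ := connectedComponentIn (closure U₀)ᶜ y₀
  have hSU : S ⊆ (closure U₀)ᶜ := fun z hz hz' => absurd (hU₀high z hz') (not_le.2 hz)
  have hSV : S ⊆ V := (isPreconnected_lt_im c).subset_connectedComponentIn hyS hSU
  have hVo : IsOpen V := isClosed_closure.isOpen_compl.connectedComponentIn
  have hVp : IsPreconnected V := isPreconnected_connectedComponentIn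
  have hVU₀ : ∀ z ∈ V, z ∉ closure U₀ := fun z hz => connectedComponentIn_subset _ _ hz
  have hVinv : ∀ H ∈ 𝒢, ∀ z ∈ V, H z ∈ V := by
    intro H hH z hz
    refine connectedComponentIn_invariant hSV H.continuous (hclinv H hH) ⟨y₀, hyS, ?_⟩ hz
    have := (abs_le.1 (hc H hH y₀)).1
    simp only [S, y₀, Set.mem_ofPred_eq] at this ⊢
    linarith
  have hVI : ∀ z ∈ V, z + Complex.I ∈ V := by
    intro z hz
    refine connectedComponentIn_invariant (H := fun z => z + Complex.I) hSV (by fun_prop)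
      ?_ ⟨y₀, hyS, ?_⟩ hz
    · intro w hw hw'
      apply hw
      have := map_mem_closure (f := fun z => z - Complex.I) (by fun_prop) hw' hU₀sub
      simpa using this
    · simp only [S, y₀, Set.mem_ofPred_eq, Complex.add_im, Complex.I_im]
      linarith
  have hVlow : ∀ z ∈ closure V, 0 ≤ z.im := by
    have hcl : IsClosed {z : ℂ | 0 ≤ z.im} := isClosed_le continuous_const Complex.continuous_im
    refine fun z hz => closure_minimal (fun w hw => ?_) hcl hz
    by_contra hlt
    exact hVU₀ w hw (subset_closure (hU₀low w (not_le.1 hlt)))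
  let x₀ : ℂ := ⟨0, -(3 * c) - 2⟩
  let S' : Set ℂ := {z | z.im < 0}
  have hxS : x₀ ∈ S' := by simp only [S', x₀, Set.mem_ofPred_eq]; linarith
  let U : Set ℂ := connectedComponentIn (closure V)ᶜ x₀
  have hSV' : S' ⊆ (closure V)ᶜ := fun z hz hz' => absurd (hVlow z hz') (not_le.2 hz)
  have hSU' : S' ⊆ U := (isPreconnected_im_lt 0).subset_connectedComponentIn hxS hSV'
  have hUo : IsOpen U := isClosed_closure.isOpen_compl.connectedComponentIn
  have hUp : IsPreconnected U := isPreconnected_connectedComponentIn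
  have hUV : ∀ z ∈ U, z ∉ closure V := fun z hz => connectedComponentIn_subset _ _ hz
  have hdisj : Disjoint U V := Set.disjoint_left.2 fun z hz hz' => hUV z hz (subset_closure hz')
  have hUinv : ∀ H ∈ 𝒢, ∀ z ∈ U, H z ∈ U := by
    intro H hH z hz
    refine connectedComponentIn_invariant hSU' H.continuous ?_ ⟨x₀, hxS, ?_⟩ hz
    · intro w hw hHw
      apply hw
      have := map_mem_closure (H⁻¹).continuous hHw (hVinv _ (𝒢.inv_mem hH))
      rwa [hinv' H hH] at this
    · have := (abs_le.1 (hc H hH x₀)).2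
      simp only [S', x₀, Set.mem_ofPred_eq] at this ⊢
      linarith
  have hUI : ∀ z ∈ U, z - Complex.I ∈ U := by
    intro z hz
    refine connectedComponentIn_invariant (H := fun z => z - Complex.I) hSU' (by fun_prop)
      ?_ ⟨x₀, hxS, ?_⟩ hz
    · intro w hw hw'
      apply hw
      have := map_mem_closure (f := fun z => z + Complex.I) (by fun_prop) hw' hVI
      simpa using this
    · simp only [S', x₀, Set.mem_ofPred_eq, Complex.sub_im, Complex.I_im]
      linarith
  have hU₀U : U₀ ⊆ U := by
    rintro z ⟨H, hH, hz⟩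
    have := hUinv _ (𝒢.inv_mem hH) _ (hSU' hz)
    rwa [hinv' H hH] at this
  have hUiff : ∀ H ∈ 𝒢, ∀ z, H z ∈ U ↔ z ∈ U := fun H hH z =>
    ⟨fun h => by simpa only [hinv' H hH] using hUinv _ (𝒢.inv_mem hH) _ h, hUinv H hH z⟩
  have hViff : ∀ H ∈ 𝒢, ∀ z, H z ∈ V ↔ z ∈ V := fun H hH z =>
    ⟨fun h => by simpa only [hinv' H hH] using hVinv _ (𝒢.inv_mem hH) _ h, hVinv H hH z⟩
  refine ⟨U, V, c, ?_, fun H hH => ⟨hUiff H hH, hViff H hH⟩⟩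
  refine ⟨hUo, hVo, hUp, hVp, hdisj, fun z hz => hSU' ?_, fun z hz => hSV hz, ?_, ?_,
    hUiff _ h1, hViff _ h1, hUI, hVI⟩
  · simp only [S', Set.mem_ofPred_eq]
    linarith
  · rintro W hW hWp hWV ⟨w, hwW, hwU⟩
    have hsub : W ⊆ (closure V)ᶜ := (hWV.closure_right hW).subset_compl_right
    have := hWp.subset_connectedComponentIn hwW hsub
    rwa [← connectedComponentIn_eq hwU] at this
  · rintro W hW hWp hWU ⟨w, hwW, hwV⟩
    have hsub : W ⊆ (closure U₀)ᶜ :=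
      ((hWU.closure_right hW).mono_right (closure_mono hU₀U)).subset_compl_right
    have := hWp.subset_connectedComponentIn hwW hsub
    rwa [← connectedComponentIn_eq hwV] at this

/-- A homeomorphism of the plane commuting with all lattice translations. -/
def LatEquivariant (F : ℂ ≃ₜ ℂ) : Prop := ∀ z v, F (z + lat v) = F z + lat v

theorem LatEquivariant.inv {F : ℂ ≃ₜ ℂ} (hF : LatEquivariant F) : LatEquivariant F⁻¹ := by
  intro z v
  apply F.injective
  have h : ∀ w, F (F⁻¹ w) = w := F.apply_symm_apply
  rw [h, hF, h]

theorem LatEquivariant.mul {F G : ℂ ≃ₜ ℂ} (hF : LatEquivariant F) (hG : LatEquivariant G) :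
    LatEquivariant (F * G) := fun z v => by
  change F (G (z + lat v)) = F (G z) + lat v
  rw [hG, hF]

theorem LatEquivariant.zpow {F : ℂ ≃ₜ ℂ} (hF : LatEquivariant F) (n : ℤ) :
    LatEquivariant (F ^ n) := by
  induction n with
  | zero => exact fun z v => rfl
  | succ n ih => rw [zpow_add_one]; exact ih.mul hF
  | pred n ih => rw [zpow_sub_one]; exact ih.mul hF.inv

theorem Homeomorph.zpow_add_apply (F : ℂ ≃ₜ ℂ) (m n : ℤ) (z : ℂ) :
    (F ^ (m + n)) z = (F ^ m) ((F ^ n) z) := by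
  rw [zpow_add]; rfl

theorem LatEquivariant.sub {F : ℂ ≃ₜ ℂ} (hF : LatEquivariant F) (z v) :
    F (z - lat v) = F z - lat v := by
  rw [eq_sub_iff_add_eq, ← hF, sub_add_cancel]

/-- A point is recurrent modulo the lattice. -/
def LatRecurrent (F : ℂ ≃ₜ ℂ) (z : ℂ) : Prop :=
  ∀ ε > 0, ∃ (n : ℤ) (v : ℤ × ℤ), 1 ≤ n ∧ ‖(F ^ n) z - lat v - z‖ < ε

theorem dense_latRecurrent {F : ℂ ≃ₜ ℂ}
    (hnw : ∀ O : Set ℂ, IsOpen O → O.Nonempty →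
      ∃ (n : ℤ) (v : ℤ × ℤ), 1 ≤ n ∧ ∃ z ∈ O, (F ^ n) z - lat v ∈ O) :
    Dense {z | LatRecurrent F z} := by
  let R : ℕ → Set ℂ := fun k =>
    ⋃ (n : ℤ) (v : ℤ × ℤ) (_ : 1 ≤ n), {z | ‖(F ^ n) z - lat v - z‖ < 1 / ((k : ℝ) + 1)}
  have hR : ∀ k, IsOpen (R k) := fun k =>
    isOpen_iUnion fun n => isOpen_iUnion fun v => isOpen_iUnion fun _ =>
      isOpen_lt ((((F ^ n).continuous.sub continuous_const).sub continuous_id).norm)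
        continuous_const
  have hd : ∀ k, Dense (R k) := by
    intro k
    rw [Metric.dense_iff]
    intro x r hr
    have hk : (0 : ℝ) < 1 / ((k : ℝ) + 1) := by positivity
    have hρ : 0 < min r (1 / ((k : ℝ) + 1) / 2) := by positivity
    obtain ⟨n, v, hn, z, hz, hz'⟩ := hnw _ Metric.isOpen_ball ⟨x, Metric.mem_ball_self hρ⟩
    refine ⟨z, Metric.ball_subset_ball (min_le_left _ _) hz, ?_⟩
    simp only [R, Set.mem_iUnion]
    refine ⟨n, v, hn, ?_⟩
    have h1 := (Metric.mem_ball.1 hz).trans_le (min_le_right _ _)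
    have h2 := (Metric.mem_ball.1 hz').trans_le (min_le_right _ _)
    have h3 := dist_triangle_right ((F ^ n) z - lat v) z x
    rw [Set.mem_ofPred_eq, ← dist_eq_norm]
    linarith
  refine (dense_iInter_of_isOpen_nat hR hd).mono fun z hz ε hε => ?_
  obtain ⟨k, hk⟩ := exists_nat_one_div_lt hε
  have := Set.mem_iInter.1 hz k
  simp only [R, Set.mem_iUnion] at this
  obtain ⟨n, v, hn, h⟩ := this
  exact ⟨n, v, hn, lt_trans h hk⟩

/-- Recurrence with prescribed drift `d = b * v.2 - n * a` at arbitrarily small scales. -/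
def DriftRecurrent (F : ℂ ≃ₜ ℂ) (a b : ℤ) (z : ℂ) (d : ℤ) : Prop :=
  ∀ ε > 0, ∃ (n : ℤ) (v : ℤ × ℤ), 1 ≤ n ∧ b * v.2 - n * a = d ∧ ‖(F ^ n) z - lat v - z‖ < ε

theorem DriftRecurrent.add {F : ℂ ≃ₜ ℂ} (hF : LatEquivariant F) {a b : ℤ} {z : ℂ} {d e : ℤ}
    (hd : DriftRecurrent F a b z d) (he : DriftRecurrent F a b z e) :
    DriftRecurrent F a b z (d + e) := by
  intro ε hε
  obtain ⟨n, v, hn, hv, h⟩ := hd (ε / 2) (half_pos hε)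
  obtain ⟨η, hη, hcont⟩ := Metric.continuous_iff.1 (F ^ n).continuous z (ε / 2) (half_pos hε)
  obtain ⟨n', v', hn', hv', h'⟩ := he η hη
  refine ⟨n + n', v + v', by linarith, ?_, ?_⟩
  · rw [← hv, ← hv', Prod.snd_add]; ring
  · rw [← dist_eq_norm] at h'
    have h2 := hcont _ h'
    rw [(hF.zpow n).sub, ← Homeomorph.zpow_add_apply, dist_eq_norm] at h2
    have : (F ^ (n + n')) z - lat (v + v') - z =
        ((F ^ (n + n')) z - lat v' - (F ^ n) z) + ((F ^ n) z - lat v - z) := by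
      rw [lat_add]; ring
    rw [this]
    refine (norm_add_le _ _).trans_lt ?_
    linarith

/-- Bounded deviation of vertical displacement from the rational speed `a / b`. -/
def BoundedDrift (F : ℂ ≃ₜ ℂ) (a b : ℤ) (c : ℝ) : Prop :=
  ∀ (n : ℤ) z, |b * (((F ^ n) z).im - z.im) - n * a| ≤ c

theorem LatRecurrent.driftRecurrent {F : ℂ ≃ₜ ℂ} (hF : LatEquivariant F) {a b : ℤ} {c : ℝ}
    (hb : 1 ≤ b) (hc : BoundedDrift F a b c) {z : ℂ} (hz : LatRecurrent F z) :
    DriftRecurrent F a b z 0 := by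
  have hb' : (1 : ℝ) ≤ b := by exact_mod_cast hb
  have key : ∀ (n : ℤ) (v : ℤ × ℤ), ‖(F ^ n) z - lat v - z‖ < 1 →
      |((b * v.2 - n * a : ℤ) : ℝ)| ≤ c + b := by
    intro n v h
    have h1 := (Complex.abs_im_le_norm _).trans h.le
    rw [Complex.sub_im, Complex.sub_im, lat_im, abs_le] at h1
    have h2 := abs_le.1 (hc n z)
    push_cast
    rw [abs_le]
    constructor <;> nlinarith [h1.1, h1.2, h2.1, h2.2]
  obtain ⟨N, hN⟩ := exists_nat_gt (c + b)
  have hex : ∃ d, DriftRecurrent F a b z d := by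
    by_contra hno
    push Not at hno
    have hno' : ∀ d, ∃ ε > 0, ∀ (n : ℤ) (v : ℤ × ℤ), 1 ≤ n → b * v.2 - n * a = d →
        ε ≤ ‖(F ^ n) z - lat v - z‖ := by
      intro d
      have := hno d
      unfold DriftRecurrent at this
      push Not at this
      exact this
    choose ε hε hε' using hno'
    obtain ⟨ε₀, hε₀, hmin⟩ : ∃ ε₀ > 0, ∀ d ∈ Finset.Icc (-(N : ℤ)) N, ε₀ ≤ ε d := by
      have hne : (Finset.Icc (-(N : ℤ)) N).Nonempty := ⟨0, by simp⟩
      obtain ⟨d, -, hd⟩ := Finset.exists_min_image _ ε hne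
      exact ⟨ε d, hε d, hd⟩
    obtain ⟨n, v, hn, h⟩ := hz (min ε₀ 1) (by positivity)
    have h1 := key n v (h.trans_le (min_le_right _ _))
    have h2 := abs_le.1 (h1.trans hN.le)
    have hmem : b * v.2 - n * a ∈ Finset.Icc (-(N : ℤ)) N :=
      Finset.mem_Icc.2 ⟨by exact_mod_cast h2.1, by exact_mod_cast h2.2⟩
    have h3 := hε' _ n v hn rfl
    have h4 := hmin _ hmem
    linarith [h.trans_le (min_le_left _ _)]
  obtain ⟨d, hd⟩ := hex
  have hmul : ∀ k : ℕ, DriftRecurrent F a b z ((k + 1) * d) := by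
    intro k
    induction k with
    | zero => simpa using hd
    | succ k ih =>
      have := ih.add hF hd
      push_cast
      convert this using 1
      ring
  have hd0 : d = 0 := by
    by_contra hne
    obtain ⟨n, v, -, hv, h⟩ := hmul N 1 one_pos
    have h1 := key n v h
    rw [hv] at h1
    push_cast at h1
    rw [abs_mul] at h1
    have h2 : (1 : ℝ) ≤ |(d : ℝ)| := by exact_mod_cast Int.one_le_abs hne
    have h3 : (N : ℝ) + 1 ≤ |(N : ℝ) + 1| := le_abs_self _
    nlinarith
  rwa [hd0] at hd

theorem LatEquivariant.bounded {F : ℂ ≃ₜ ℂ} (hF : LatEquivariant F) :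
    ∃ c, ∀ z, ‖F z - z‖ ≤ c := by
  have hK : IsCompact (Set.Icc (0 : ℝ) 1 ×ℂ Set.Icc (0 : ℝ) 1) := isCompact_Icc.reProdIm isCompact_Icc
  obtain ⟨c, hc⟩ := hK.exists_bound_of_continuousOn (f := fun z => F z - z)
    (F.continuous.sub continuous_id).continuousOn
  refine ⟨c, fun z => ?_⟩
  have h := hF (z - lat (⌊z.re⌋, ⌊z.im⌋)) (⌊z.re⌋, ⌊z.im⌋)
  rw [sub_add_cancel] at h
  rw [h, add_sub_assoc, ← neg_sub z, ← sub_eq_add_neg]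
  have h2 := hc (z - lat (⌊z.re⌋, ⌊z.im⌋)) ?_
  · exact h2
  · rw [Complex.mem_reProdIm, Complex.sub_re, Complex.sub_im, lat_re, lat_im]
    exact ⟨⟨Int.fract_nonneg _, (Int.fract_lt_one _).le⟩,
      ⟨Int.fract_nonneg _, (Int.fract_lt_one _).le⟩⟩

/-- The map `z ↦ F ^ n z - lat m`. -/
def latMap (F : ℂ ≃ₜ ℂ) (n : ℤ) (m : ℤ × ℤ) : ℂ ≃ₜ ℂ :=
  (F ^ n).trans (Homeomorph.addRight (-lat m))

theorem latMap_apply (F : ℂ ≃ₜ ℂ) (n : ℤ) (m : ℤ × ℤ) (z : ℂ) :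
    latMap F n m z = (F ^ n) z - lat m := (sub_eq_add_neg _ _).symm

theorem LatEquivariant.latMap {F : ℂ ≃ₜ ℂ} (hF : LatEquivariant F) (n : ℤ) (m : ℤ × ℤ) :
    LatEquivariant (latMap F n m) := by
  intro z v
  rw [latMap_apply, latMap_apply, hF.zpow]
  ring

theorem LatEquivariant.latMap_add {F : ℂ ≃ₜ ℂ} (hF : LatEquivariant F) (n n' : ℤ)
    (m m' : ℤ × ℤ) (z : ℂ) :
    _root_.latMap F (n + n') (m + m') z = _root_.latMap F n m (_root_.latMap F n' m' z) := by
  rw [latMap_apply, latMap_apply, latMap_apply, (hF.zpow n).sub, ← Homeomorph.zpow_add_apply,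
    lat_add]
  ring

theorem latMap_zero (F : ℂ ≃ₜ ℂ) (z : ℂ) : latMap F 0 0 z = z := by
  rw [latMap_apply, lat_zero, sub_zero, zpow_zero]
  rfl

theorem LatEquivariant.latMap_neg {F : ℂ ≃ₜ ℂ} (hF : LatEquivariant F) (n : ℤ) (m : ℤ × ℤ)
    (z : ℂ) : _root_.latMap F (-n) (-m) (_root_.latMap F n m z) = z := by
  rw [← hF.latMap_add, neg_add_cancel, neg_add_cancel, latMap_zero]

theorem LatEquivariant.latMap_nsmul {F : ℂ ≃ₜ ℂ} (hF : LatEquivariant F) (n : ℤ) (m : ℤ × ℤ)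
    (q : ℕ) (z : ℂ) :
    _root_.latMap F (q • n) (q • m) z = (_root_.latMap F n m)^[q] z := by
  induction q with
  | zero => rw [zero_smul, zero_smul, latMap_zero, Function.iterate_zero, id]
  | succ q ih =>
    rw [Function.iterate_succ_apply', ← ih, ← hF.latMap_add, succ_nsmul', succ_nsmul']

/-- The group of all maps `F ^ n - m` with vanishing vertical drift with respect to `a / b`. -/
def driftGroup {F : ℂ ≃ₜ ℂ} (hF : LatEquivariant F) (a b : ℤ) : Subgroup (ℂ ≃ₜ ℂ) where
  carrier := {H | ∃ n m, b * m.2 = n * a ∧ H = latMap F n m}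
  one_mem' := ⟨0, 0, by simp, by ext1 z; exact (latMap_zero F z).symm⟩
  mul_mem' := by
    rintro _ _ ⟨n, m, h, rfl⟩ ⟨n', m', h', rfl⟩
    refine ⟨n + n', m + m', ?_, ?_⟩
    · rw [Prod.snd_add, mul_add, h, h', add_mul]
    · ext1 z
      exact (hF.latMap_add n n' m m' z).symm
  inv_mem' := by
    rintro _ ⟨n, m, h, rfl⟩
    refine ⟨-n, -m, ?_, ?_⟩
    · rw [Prod.snd_neg, mul_neg, h, neg_mul]
    · refine inv_eq_of_mul_eq_one_left ?_
      ext1 z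
      exact hF.latMap_neg n m z

theorem exists_invariant_annularPair {F : ℂ ≃ₜ ℂ} (hF : LatEquivariant F) {a b : ℤ} {c : ℝ}
    (hb : 1 ≤ b) (hc : BoundedDrift F a b c)
    (hnw : ∀ O : Set ℂ, IsOpen O → O.Nonempty →
      ∃ (n : ℤ) (v : ℤ × ℤ), 1 ≤ n ∧ ∃ z ∈ O, (F ^ n) z - lat v ∈ O)
    (hnp : ∀ (n : ℤ) (v : ℤ × ℤ) z, 1 ≤ n → (F ^ n) z ≠ z + lat v) :
    ∃ (U V : Set ℂ) (M : ℝ), AnnularPair U V M ∧ (∀ z, z ∈ V ∨ z - Complex.I ∈ U) ∧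
      ∀ n m, b * m.2 = n * a →
        (∀ z, latMap F n m z ∈ U ↔ z ∈ U) ∧ ∀ z, latMap F n m z ∈ V ↔ z ∈ V := by
  have hb' : (1 : ℝ) ≤ b := by exact_mod_cast hb
  have hI : lat (0, 1) = Complex.I := by
    apply Complex.ext <;> simp [lat_re, lat_im]
  have hone : lat (1, 0) = 1 := by
    apply Complex.ext <;> simp [lat_re, lat_im]
  obtain ⟨U, V, M, h, hinv⟩ := exists_annularPair (driftGroup hF a b) (c := c)
    (by
      rintro _ ⟨n, m, hm, rfl⟩ z
      rw [latMap_apply, Complex.sub_im, lat_im]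
      have hm' : (b : ℝ) * m.2 = n * a := by exact_mod_cast hm
      have h1 := abs_le.1 (hc n z)
      rw [abs_le]
      constructor <;> nlinarith [abs_nonneg (b * (((F ^ n) z).im - z.im) - n * a), hc n z])
    (by
      rintro _ ⟨n, m, -, rfl⟩ z
      rw [← hI]
      exact hF.latMap n m z _)
    ⟨0, -(1, 0), by simp, by
      ext1 z
      rw [latMap_apply, lat_neg, hone, zpow_zero, sub_neg_eq_add]
      rfl⟩
  have hinv' : ∀ n m, b * m.2 = n * a →
      (∀ z, latMap F n m z ∈ U ↔ z ∈ U) ∧ ∀ z, latMap F n m z ∈ V ↔ z ∈ V :=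
    fun n m hnm => hinv _ ⟨n, m, hnm, rfl⟩
  refine ⟨U, V, M, h, ?_, hinv'⟩
  let E : Set ℂ := V ∩ {z | z - Complex.I ∈ U}
  have hE : IsOpen E := h.isOpen_upper.inter (h.isOpen_lower.preimage (by fun_prop))
  have hEinv : ∀ n m, b * m.2 = n * a → ∀ z ∈ E, latMap F n m z ∈ E := by
    rintro n m hnm z ⟨hz, hz'⟩
    refine ⟨((hinv' n m hnm).2 z).2 hz, ?_⟩
    have h1 := ((hinv' n m hnm).1 _).2 hz'
    rwa [← hI, (hF.latMap n m).sub, hI] at h1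
  obtain ⟨z, hz, hrec⟩ := (dense_latRecurrent hnw).inter_open_nonempty E hE h.inter_shift_nonempty
  have hdrift := LatRecurrent.driftRecurrent hF hb hc hrec
  let D := connectedComponentIn E z
  have hD : IsOpen D := hE.connectedComponentIn
  have hDE : D ⊆ E := connectedComponentIn_subset _ _
  have hDp : IsPreconnected D := isPreconnected_connectedComponentIn
  have hzD : z ∈ D := mem_connectedComponentIn hz
  by_cases hk : ∃ k : ℤ, k ≠ 0 ∧ z + k ∈ D
  · obtain ⟨k, hk, hkD⟩ := hk
    exact h.mem_or_shift_mem hD hDp hDE hk hzD hkD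
  exfalso
  push Not at hk
  have hmap : ∀ n m, b * m.2 = n * a → ∀ x ∈ D, latMap F n m x ∈ D → ∀ w ∈ D,
      latMap F n m w ∈ D := by
    intro n m hnm x hx hx' w hw
    have hpre : IsPreconnected (latMap F n m '' D) :=
      hDp.image _ (latMap F n m).continuous.continuousOn
    have hsub : latMap F n m '' D ⊆ E := by
      rintro _ ⟨y, hy, rfl⟩
      exact hEinv n m hnm y (hDE hy)
    have h1 := hpre.subset_connectedComponentIn ⟨x, hx, rfl⟩ hsub
    rw [← connectedComponentIn_eq hx'] at h1
    exact h1 ⟨w, hw, rfl⟩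
  let A : AddSubgroup (ℤ × (ℤ × ℤ)) :=
    { carrier := {s | b * s.2.2 = s.1 * a ∧ latMap F s.1 s.2 z ∈ D}
      zero_mem' := ⟨by simp, by rw [Prod.fst_zero, Prod.snd_zero, latMap_zero]; exact hzD⟩
      add_mem' := by
        rintro ⟨n, m⟩ ⟨n', m'⟩ ⟨hd, hs⟩ ⟨hd', hs'⟩
        refine ⟨?_, ?_⟩
        · simp only [Prod.fst_add, Prod.snd_add] at hd hd' ⊢
          rw [mul_add, hd, hd', add_mul]
        · change latMap F (n + n') (m + m') z ∈ D
          rw [hF.latMap_add]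
          exact hmap n m hd z hzD hs _ hs'
      neg_mem' := by
        rintro ⟨n, m⟩ ⟨hd, hs⟩
        have hd' : b * (-m).2 = -n * a := by
          simp only at hd
          rw [Prod.snd_neg, mul_neg, hd, neg_mul]
        refine ⟨hd', ?_⟩
        change latMap F (-n) (-m) z ∈ D
        refine hmap (-n) (-m) hd' _ hs ?_ z hzD
        rw [hF.latMap_neg]
        exact hzD }
  have hA : ∀ n m, (n, m) ∈ A ↔ b * m.2 = n * a ∧ latMap F n m z ∈ D := fun n m => Iff.rfl
  have hA0 : ∀ m, (0, m) ∈ A → m = 0 := by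
    intro m hm
    obtain ⟨h1, h2⟩ := (hA 0 m).1 hm
    have hm2 : m.2 = 0 := by
      rw [zero_mul] at h1
      rcases mul_eq_zero.1 h1 with h1 | h1
      · omega
      · exact h1
    by_contra hne
    have hm1 : m.1 ≠ 0 := fun h0 => hne (Prod.ext h0 hm2)
    refine hk (-m.1) (neg_ne_zero.2 hm1) ?_
    rw [latMap_apply, zpow_zero] at h2
    convert h2 using 1
    change z + ((-m.1 : ℤ) : ℂ) = z - lat m
    rw [sub_eq_add_neg, ← lat_neg]
    congr 1
    apply Complex.ext
    · rw [Complex.intCast_re, lat_re, Prod.fst_neg]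
    · rw [Complex.intCast_im, lat_im, Prod.snd_neg, hm2, neg_zero, Int.cast_zero]
  obtain ⟨g, hg⟩ := Int.subgroup_cyclic (A.map (AddMonoidHom.fst ℤ (ℤ × ℤ)))
  rw [← AddSubgroup.zmultiples_eq_closure] at hg
  obtain ⟨δ, hδ, hball⟩ := Metric.isOpen_iff.1 hD z hzD
  have hret : ∀ ε > 0, ∃ n m, 1 ≤ n ∧ (n, m) ∈ A ∧ ‖latMap F n m z - z‖ < ε := by
    intro ε hε
    obtain ⟨n, m, hn, hm, hclose⟩ := hdrift (min ε δ) (lt_min hε hδ)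
    rw [← latMap_apply] at hclose
    refine ⟨n, m, hn, (hA n m).2 ⟨sub_eq_zero.1 hm, hball ?_⟩, hclose.trans_le (min_le_left _ _)⟩
    rw [Metric.mem_ball, dist_eq_norm]
    exact hclose.trans_le (min_le_right _ _)
  obtain ⟨n₀, m₀, hn₀, hm₀, hgen⟩ : ∃ n₀ m₀, 1 ≤ n₀ ∧ (n₀, m₀) ∈ A ∧
      ∀ n m, (n, m) ∈ A → n₀ ∣ n := by
    have hdvd : ∀ n m, (n, m) ∈ A → g ∣ n := fun n m hnm => by
      have : n ∈ A.map (AddMonoidHom.fst ℤ (ℤ × ℤ)) := ⟨(n, m), hnm, rfl⟩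
      rw [hg] at this
      exact Int.mem_zmultiples_iff.1 this
    have hgA : g ∈ A.map (AddMonoidHom.fst ℤ (ℤ × ℤ)) := by
      rw [hg]
      exact AddSubgroup.mem_zmultiples g
    obtain ⟨⟨g', m⟩, hgm, hgg⟩ := hgA
    change g' = g at hgg
    subst hgg
    have hg0 : g' ≠ 0 := by
      rintro rfl
      obtain ⟨n, m, hn, hnm, -⟩ := hret 1 one_pos
      have := zero_dvd_iff.1 (hdvd n m hnm)
      omega
    rcases lt_or_gt_of_ne hg0 with hlt | hgt
    · exact ⟨-g', -m, by omega, A.neg_mem hgm, fun n m hnm => neg_dvd.2 (hdvd n m hnm)⟩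
    · exact ⟨g', m, by omega, hgm, hdvd⟩
  have hG : FreeHomeo (latMap F n₀ m₀) :=
    { bounded := (hF.latMap n₀ m₀).bounded
      ne_self := fun w hw => hnp n₀ m₀ w hn₀ (by rw [latMap_apply] at hw; linear_combination hw) }
  obtain ⟨ε, hε, hfar⟩ := hG.not_recurrent z
  obtain ⟨n, m, hn, hnm, hclose⟩ := hret ε hε
  obtain ⟨q, hq⟩ := hgen n m hnm
  have hq1 : 1 ≤ q := by
    by_contra hlt
    nlinarith
  obtain ⟨k, rfl⟩ := Int.eq_ofNat_of_zero_le (zero_le_one.trans hq1)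
  have hmem := A.sub_mem hnm (A.nsmul_mem hm₀ k)
  have hn' : n = k • n₀ := by rw [hq, nsmul_eq_mul, mul_comm]
  have hm' : m = k • m₀ := by
    have h1 : ((n, m) : ℤ × (ℤ × ℤ)) - k • (n₀, m₀) = (0, m - k • m₀) := by
      rw [Prod.smul_mk, Prod.mk_sub_mk, hn', sub_self]
    rw [h1] at hmem
    exact sub_eq_zero.1 (hA0 _ hmem)
  rw [hn', hm', hF.latMap_nsmul] at hclose
  exact absurd hclose (not_lt.2 (hfar k (by omega)))

section

theorem proj_zpow {X : Type*} {p : ℂ → X} {F : ℂ ≃ₜ ℂ} {f : X → X}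
    (hf : ∀ z, p (F z) = f (p z)) (n : ℕ) (z : ℂ) :
    p ((F ^ (n : ℤ)) z) = f^[n] (p z) := by
  induction n with
  | zero => rfl
  | succ n ih =>
    rw [Function.iterate_succ_apply', ← ih, ← hf, Nat.cast_succ, add_comm,
      zpow_add, zpow_one]
    rfl

variable {X : Type*} [TopologicalSpace X] {p : ℂ → X}

theorem TorusCover.exists_periodic_circloid [T2Space X] (hp : TorusCover p) {F : ℂ ≃ₜ ℂ}
    (hF : LatEquivariant F) {f : X → X} (hf : ∀ z, p (F z) = f (p z)) (hnw : NonWandering f)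
    (hnp : ¬ HasPeriodicPoint f) {a b : ℤ} {c : ℝ} (hb : 1 ≤ b) (hc : BoundedDrift F a b c) :
    ∃ (C : Set X) (q : ℕ), 1 ≤ q ∧
      (CircloidProps C ∧ ∀ C' ⊆ C, CircloidProps C' → C' = C) ∧ f^[q] '' C = C := by
  obtain ⟨U, V, M, h, hstar, hinv⟩ := exists_invariant_annularPair hF hb hc
    (by
      intro O hO ⟨x, hx⟩
      obtain ⟨n, hn, _, ⟨_, ⟨z, hz, rfl⟩, rfl⟩, ⟨w, hw, hzw⟩⟩ :=
        hnw (p '' O) (hp.isOpenMap O hO) ⟨_, x, hx, rfl⟩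
      rw [← proj_zpow hf, hp.eq_iff] at hzw
      obtain ⟨v, hv⟩ := hzw
      refine ⟨n, v, by exact_mod_cast hn, z, hz, ?_⟩
      rwa [hv, add_sub_cancel_right])
    (by
      intro n v z hn hz
      obtain ⟨k, rfl⟩ := Int.eq_ofNat_of_zero_le (zero_le_one.trans hn)
      refine hnp ⟨p z, k, by omega, ?_⟩
      rw [← proj_zpow hf, hz, hp.apply_add_lat])
  obtain ⟨k, rfl⟩ := Int.eq_ofNat_of_zero_le (zero_le_one.trans hb)
  refine ⟨p '' (U ∪ V)ᶜ, k, by omega, h.isCircloid hstar hp, ?_⟩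
  obtain ⟨hU, hV⟩ := hinv k (0, a) rfl
  have hmem : ∀ z, latMap F k (0, a) z ∈ (U ∪ V)ᶜ ↔ z ∈ (U ∪ V)ᶜ := fun z => by
    rw [Set.mem_compl_iff, Set.mem_compl_iff, Set.mem_union, Set.mem_union, hU, hV]
  have hpz : ∀ z, p (latMap F k (0, a) z) = f^[k] (p z) := fun z => by
    rw [latMap_apply, ← proj_zpow hf, sub_eq_add_neg, ← lat_neg, hp.apply_add_lat]
  apply Set.Subset.antisymm
  · rintro _ ⟨_, ⟨z, hz, rfl⟩, rfl⟩
    exact ⟨_, (hmem z).2 hz, hpz z⟩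
  · rintro _ ⟨w, hw, rfl⟩
    obtain ⟨z, rfl⟩ := (latMap F k (0, a)).surjective w
    exact ⟨p z, ⟨z, (hmem z).1 hw, rfl⟩, (hpz z).symm⟩

end

/-- A curve which is periodic up to a nontrivial horizontal translation cuts out an upper region
whose frontier consists of lattice translates of the curve. -/
theorem exists_upper_region {γ : ℝ → ℂ} (hγ : Continuous γ) {k : ℤ} (hk : k ≠ 0)
    (hper : ∀ s, γ (s + 1) = γ s + k) :
    ∃ (W : Set ℂ) (M : ℝ), IsOpen W ∧ (∀ z, z + 1 ∈ W ↔ z ∈ W) ∧ (∀ z ∈ W, z + Complex.I ∈ W) ∧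
      (∀ z : ℂ, M < z.im → z ∈ W) ∧ (∀ z ∈ W, -M ≤ z.im) ∧
      ∀ z ∈ closure W, z ∉ W → ∃ s v, z = γ s + lat v := by
  let E : ℂ → ℂ := fun z => Complex.exp (2 * Real.pi * Complex.I * z)
  have hE : Continuous E := by fun_prop
  have hEE : ∀ z w, E z = E w ↔ ∃ n : ℤ, z = w + n := by
    intro z w
    rw [Complex.exp_eq_exp_iff_exists_int]
    refine exists_congr fun n => ?_
    rw [mul_comm (n : ℂ), ← mul_add, mul_right_inj' Complex.two_pi_I_ne_zero]
  let A : Set ℂ := E ⁻¹' (E '' (γ '' Set.Icc 0 1))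
  have hcpt : IsCompact (γ '' Set.Icc (0 : ℝ) 1) := isCompact_Icc.image hγ
  have hA : IsClosed A := (hcpt.image hE).isClosed.preimage hE
  have hmem : ∀ z, z ∈ A ↔ ∃ s ∈ Set.Icc (0 : ℝ) 1, ∃ n : ℤ, z = γ s + n := by
    intro z
    constructor
    · rintro ⟨_, ⟨s, hs, rfl⟩, h⟩
      exact ⟨s, hs, (hEE _ _).1 h.symm⟩
    · rintro ⟨s, hs, h⟩
      exact ⟨_, ⟨s, hs, rfl⟩, ((hEE _ _).2 h).symm⟩
  have hA1 : ∀ z, z + 1 ∈ A ↔ z ∈ A := by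
    intro z
    have : E (z + 1) = E z := (hEE _ _).2 ⟨1, by push_cast; rfl⟩
    rw [Set.mem_preimage, this, Set.mem_preimage]
  obtain ⟨M₀, hM₀⟩ := hcpt.exists_bound_of_continuousOn (f := fun z => z.im)
    Complex.continuous_im.continuousOn
  let M := max M₀ 0
  have hM0 : 0 ≤ M := le_max_right _ _
  have hM : ∀ z ∈ A, |z.im| ≤ M := by
    intro z hz
    obtain ⟨s, hs, n, rfl⟩ := (hmem z).1 hz
    rw [Complex.add_im, Complex.intCast_im, add_zero]
    exact (hM₀ _ ⟨s, hs, rfl⟩).trans (le_max_left _ _)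
  have hγint : ∀ (n : ℤ) s, γ (s + n) = γ s + (n * k : ℤ) := by
    intro n
    induction n with
    | zero => intro s; simp
    | succ n ih =>
      intro s
      have := hper (s + n)
      push_cast at ih this ⊢
      rw [← add_assoc, this, ih]
      ring
    | pred n ih =>
      intro s
      have := hper (s + (-n - 1))
      push_cast at ih this ⊢
      rw [show s + (-(n : ℝ) - 1) + 1 = s + -n by ring, ih] at this
      linear_combination -this
  have hγA : Set.range γ ⊆ A := by
    rintro _ ⟨s, rfl⟩
    refine (hmem _).2 ⟨Int.fract s, ⟨Int.fract_nonneg _, (Int.fract_lt_one _).le⟩, ⌊s⌋ * k, ?_⟩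
    rw [← hγint, Int.fract_add_floor]
  have hsep : ∀ x y : ℂ, M < x.im → y.im < -M → ¬ JoinedIn Aᶜ x y := fun x y hx hy =>
    not_joinedIn_compl_of_isPreconnected hA1 hM hx hy (isPreconnected_range hγ) hγA hk
      (z := γ 0) ⟨0, rfl⟩ ⟨0 + 1, hper 0⟩
  let y₀ : ℂ := ⟨0, M + 1⟩
  let S : Set ℂ := {z | M < z.im}
  have hyS : y₀ ∈ S := by simp only [S, y₀, Set.mem_ofPred_eq]; linarith
  let V : Set ℂ := connectedComponentIn Aᶜ y₀
  have hSA : S ⊆ Aᶜ := fun z hz hz' => absurd ((le_abs_self _).trans (hM z hz')) (not_le.2 hz)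
  have hSV : S ⊆ V := (isPreconnected_lt_im M).subset_connectedComponentIn hyS hSA
  have hV : IsOpen V := hA.isOpen_compl.connectedComponentIn
  have hVlow : ∀ z ∈ V, -M ≤ z.im := by
    intro z hz
    by_contra hlt
    have hVc : IsConnected V := isConnected_connectedComponentIn_iff.2 (hSA hyS)
    exact hsep y₀ z hyS (not_le.1 hlt) (((hV.isConnected_iff_isPathConnected.1 hVc).joinedIn y₀
      (hSV hyS) z hz).mono (connectedComponentIn_subset _ _))
  have hVtrans : ∀ n : ℤ, ∀ z ∈ V, z + n ∈ V := by
    intro n z hz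
    refine connectedComponentIn_invariant (H := fun z => z + n) hSV (by fun_prop) ?_
      ⟨y₀, hyS, ?_⟩ hz
    · intro w hw hw'
      exact hw ((add_int_mem_iff hA1 n w).1 hw')
    · simp only [S, y₀, Set.mem_ofPred_eq, Complex.add_im, Complex.intCast_im]
      linarith
  have hVA : ∀ z ∈ closure V, z ∉ V → z ∈ A := by
    intro z hz hzV
    by_contra hzA
    have hpre : IsPreconnected (insert z V) :=
      isPreconnected_connectedComponentIn.subset_closure (Set.subset_insert _ _)
        (Set.insert_subset hz subset_closure)
    have hsub : insert z V ⊆ Aᶜ := Set.insert_subset hzA (connectedComponentIn_subset _ _)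
    exact hzV (hpre.subset_connectedComponentIn (Set.mem_insert_of_mem _ (hSV hyS)) hsub
      (Set.mem_insert _ _))
  let Vj : ℕ → Set ℂ := fun j => {z | z - j * Complex.I ∈ V}
  have him : ∀ (z : ℂ) (j : ℕ), (z - j * Complex.I).im = z.im - j := by
    intro z j
    simp
  obtain ⟨J, hJ⟩ := exists_nat_gt (2 * M)
  have hW : (⋃ j, Vj j) = ⋃ j ∈ Finset.range (J + 1), Vj j := by
    apply Set.Subset.antisymm
    · intro z hz
      obtain ⟨j, hj⟩ := Set.mem_iUnion.1 hz
      by_cases hjJ : j < J + 1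
      · exact Set.mem_biUnion (Finset.mem_coe.2 (Finset.mem_range.2 hjJ)) hj
      · have h1 := hVlow _ hj
        rw [him] at h1
        have h2 : (J : ℝ) + 1 ≤ j := by exact_mod_cast not_lt.1 hjJ
        refine Set.mem_biUnion (x := 0) (Finset.mem_coe.2 (Finset.mem_range.2 (by omega))) ?_
        change z - ((0 : ℕ) : ℂ) * Complex.I ∈ V
        refine hSV ?_
        rw [Set.mem_ofPred_eq, him]
        push_cast
        linarith
    · exact Set.iUnion₂_subset fun j _ => Set.subset_iUnion Vj j
  refine ⟨⋃ j, Vj j, M, isOpen_iUnion fun j => hV.preimage (by fun_prop), ?_, ?_, ?_, ?_, ?_⟩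
  · intro z
    simp only [Set.mem_iUnion]
    refine exists_congr fun j => ⟨fun h => ?_, fun h => ?_⟩
    · have := hVtrans (-1) _ h
      change z - j * Complex.I ∈ V
      convert this using 1
      push_cast
      ring
    · have := hVtrans 1 _ h
      change z + 1 - j * Complex.I ∈ V
      convert this using 1
      push_cast
      ring
  · intro z hz
    obtain ⟨j, hj⟩ := Set.mem_iUnion.1 hz
    refine Set.mem_iUnion.2 ⟨j + 1, ?_⟩
    change z + Complex.I - ((j + 1 : ℕ) : ℂ) * Complex.I ∈ V
    rwa [Nat.cast_succ, add_mul, one_mul, add_sub_add_right_eq_sub]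
  · intro z hz
    refine Set.mem_iUnion.2 ⟨0, ?_⟩
    change z - ((0 : ℕ) : ℂ) * Complex.I ∈ V
    rw [Nat.cast_zero, zero_mul, sub_zero]
    exact hSV hz
  · intro z hz
    obtain ⟨j, hj⟩ := Set.mem_iUnion.1 hz
    have h1 := hVlow _ hj
    rw [him] at h1
    have : (0 : ℝ) ≤ j := Nat.cast_nonneg j
    linarith
  · intro z hz hzW
    rw [hW, Finset.closure_biUnion] at hz
    obtain ⟨j, -, hj⟩ := Set.mem_iUnion₂.1 hz
    have hjV : z - j * Complex.I ∈ closure V :=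
      map_mem_closure (f := fun z => z - j * Complex.I) (by fun_prop) hj fun w hw => hw
    have hjA := hVA _ hjV fun h => hzW (Set.mem_iUnion.2 ⟨j, h⟩)
    obtain ⟨s, -, n, hs⟩ := (hmem _).1 hjA
    refine ⟨s, (n, j), ?_⟩
    have hlat : lat (n, j) = n + j * Complex.I := by
      apply Complex.ext <;> simp [lat_re, lat_im]
    rw [hlat]
    linear_combination hs

section

variable {X : Type*} [TopologicalSpace X] {p : ℂ → X}

/-- A set `A` in the plane is an annular lift of `C` if it is a bounded horizontal strip-like
set whose vertical integer translates are disjoint and make up the full preimage of `C`. -/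
structure AnnularLift (p : ℂ → X) (C : Set X) (A : Set ℂ) (M : ℝ) : Prop where
  isClosed : IsClosed A
  isClosed_diff : IsClosed (p ⁻¹' C \ A)
  abs_im_le : ∀ z ∈ A, |z.im| ≤ M
  eq_zero : ∀ z ∈ A, ∀ v, z + lat v ∈ A → v.2 = 0
  add_mem : ∀ z ∈ A, ∀ v : ℤ × ℤ, v.2 = 0 → z + lat v ∈ A
  mem_iff : ∀ z, p z ∈ C ↔ ∃ n : ℤ, z - lat (0, n) ∈ A

theorem TorusCover.exists_annularLift (hp : TorusCover p) {γ : ℝ → ℂ} (hγ : Continuous γ) {k : ℤ}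
    (hk : k ≠ 0) (hper : ∀ s, γ (s + 1) = γ s + k) {C : Set X} (hC : IsClosed C)
    (hγC : ∀ s, p (γ s) ∉ C) : ∃ A M, AnnularLift p C A M := by
  obtain ⟨W, M, hWo, hW1, hWI, hWhigh, hWlow, hWcl⟩ := exists_upper_region hγ hk hper
  have hCt : IsClosed (p ⁻¹' C) := hC.preimage hp.continuous
  have hCadd : ∀ z v, p (z + lat v) ∈ C ↔ p z ∈ C := fun z v => by rw [hp.apply_add_lat]
  have hclW : ∀ z ∈ closure W, p z ∈ C → z ∈ W := by
    intro z hz hzC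
    by_contra hzW
    obtain ⟨s, v, rfl⟩ := hWcl z hz hzW
    exact hγC s ((hCadd _ _).1 hzC)
  have hI : lat (0, 1) = Complex.I := by
    apply Complex.ext <;> simp [lat_re, lat_im]
  have hWup : ∀ z ∈ W, ∀ v : ℤ × ℤ, 0 ≤ v.2 → z + lat v ∈ W := by
    rintro z hz ⟨a, b⟩ hb
    obtain ⟨j, rfl⟩ := Int.eq_ofNat_of_zero_le hb
    have hj : z + j * Complex.I ∈ W := by
      clear hb
      induction j with
      | zero => simpa using hz
      | succ j ih =>
        have := hWI _ ih
        push_cast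
        convert this using 1
        ring
    have := (add_int_mem_iff hW1 a _).2 hj
    convert this using 1
    rw [add_assoc]
    congr 1
    apply Complex.ext <;> simp [lat_re, lat_im]
  have hWupI : ∀ z ∈ W, ∀ v : ℤ × ℤ, 1 ≤ v.2 → z + lat v - Complex.I ∈ W := by
    intro z hz v hv
    have := hWup z hz (v - (0, 1)) (by rw [Prod.snd_sub]; omega)
    rw [lat_sub, hI] at this
    rwa [add_sub_assoc]
  let A : Set ℂ := (p ⁻¹' C ∩ W) ∩ {z | z - Complex.I ∉ W}
  have hCI : ∀ z, p (z - Complex.I) ∈ C ↔ p z ∈ C := fun z => by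
    rw [← hCadd (z - Complex.I) (0, 1), hI, sub_add_cancel]
  have hCW : IsClosed (p ⁻¹' C ∩ W) := by
    have : p ⁻¹' C ∩ W = p ⁻¹' C ∩ closure W :=
      Set.Subset.antisymm (Set.inter_subset_inter_right _ subset_closure)
        fun z hz => ⟨hz.1, hclW z hz.2 hz.1⟩
    rw [this]
    exact hCt.inter isClosed_closure
  refine ⟨A, |M| + 1, ?_, ?_, ?_, ?_, ?_, ?_⟩
  · exact hCW.inter (hWo.preimage (by fun_prop : Continuous fun z => z - Complex.I)).isClosed_compl
  · have : p ⁻¹' C \ A = (p ⁻¹' C ∩ Wᶜ) ∪ (fun z => z - Complex.I) ⁻¹' (p ⁻¹' C ∩ W) := by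
      ext z
      simp only [A, Set.mem_sdiff, Set.mem_inter_iff, Set.mem_union, Set.mem_preimage,
        Set.mem_compl_iff, Set.mem_ofPred_eq, hCI]
      tauto
    rw [this]
    exact (hCt.inter hWo.isClosed_compl).union (hCW.preimage (by fun_prop))
  · rintro z ⟨⟨-, hz⟩, hz'⟩
    have h1 := hWlow z hz
    have h2 : (z - Complex.I).im ≤ M := not_lt.1 fun h => hz' (hWhigh _ h)
    rw [Complex.sub_im, Complex.I_im] at h2
    have := le_abs_self M
    rw [abs_le]
    constructor <;> linarith
  · rintro z ⟨⟨-, hz⟩, hz'⟩ v ⟨⟨-, hv⟩, hv'⟩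
    by_contra hne
    rcases lt_or_gt_of_ne hne with hlt | hgt
    · apply hz'
      have := hWupI _ hv (-v) (by rw [Prod.snd_neg]; omega)
      rwa [lat_neg, add_neg_cancel_right] at this
    · exact hv' (hWupI z hz v hgt)
  · rintro z ⟨⟨hzC, hz⟩, hz'⟩ v hv
    refine ⟨⟨(hCadd _ _).2 hzC, hWup z hz v hv.ge⟩, fun h => hz' ?_⟩
    have := hWup _ h (-v) (by rw [Prod.snd_neg]; omega)
    rw [lat_neg] at this
    convert this using 1
    ring
  · intro z
    constructor
    · intro hz
      obtain ⟨n, hn, hmax⟩ := Int.exists_greatest_of_bdd (P := fun n => z - lat (0, n) ∈ W)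
        ⟨⌈z.im + M⌉, fun n hn => by
          have := hWlow _ hn
          rw [Complex.sub_im, lat_im] at this
          have h2 := Int.le_ceil (z.im + M)
          exact_mod_cast (by linarith : (n : ℝ) ≤ ⌈z.im + M⌉)⟩
        ⟨⌊z.im - M⌋ - 1, hWhigh _ (by
          rw [Complex.sub_im, lat_im]
          have := Int.floor_le (z.im - M)
          push_cast
          linarith)⟩
      refine ⟨n, ⟨?_, hn⟩, fun h => ?_⟩
      · rw [Set.mem_preimage, ← hCadd _ (0, n), sub_add_cancel]
        exact hz
      · have h1 : z - lat (0, n + 1) ∈ W := by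
          rw [show ((0, n + 1) : ℤ × ℤ) = (0, n) + (0, 1) by simp, lat_add, hI, ← sub_sub]
          exact h
        have := hmax _ h1
        omega
    · rintro ⟨n, ⟨hn, -⟩, -⟩
      rw [Set.mem_preimage, ← hCadd _ (0, n), sub_add_cancel] at hn
      exact hn

namespace AnnularLift

variable {C : Set X} {A : Set ℂ} {M : ℝ}

theorem subset {X : Type*} {p : ℂ → X} {C : Set X} (h : AnnularLift p C A M) {z : ℂ}
    (hz : z ∈ A) : p z ∈ C := by
  refine (h.mem_iff z).2 ⟨0, ?_⟩
  rwa [show ((0, 0) : ℤ × ℤ) = 0 from rfl, lat_zero, sub_zero]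

theorem image_eq (h : AnnularLift p C A M) (hp : TorusCover p) : p '' A = C := by
  refine Set.Subset.antisymm (by rintro _ ⟨z, hz, rfl⟩; exact h.subset hz) fun x hx => ?_
  obtain ⟨z, rfl⟩ := hp.surj x
  obtain ⟨n, hn⟩ := (h.mem_iff z).1 hx
  refine ⟨_, hn, ?_⟩
  rw [sub_eq_add_neg, ← lat_neg, hp.apply_add_lat]

theorem add_one_mem {X : Type*} {p : ℂ → X} {C : Set X} (h : AnnularLift p C A M) (z : ℂ) :
    z + 1 ∈ A ↔ z ∈ A := by
  have h1 : lat (1, 0) = 1 := by apply Complex.ext <;> simp [lat_re, lat_im]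
  have h2 : lat (-1, 0) = -1 := by apply Complex.ext <;> simp [lat_re, lat_im]
  constructor
  · intro hz
    have := h.add_mem _ hz (-1, 0) rfl
    rwa [h2, add_neg_cancel_right] at this
  · intro hz
    have := h.add_mem _ hz (1, 0) rfl
    rwa [h1] at this

/-- An equivariant homeomorphism preserving `C` acts on the vertical translates of an annular lift
by a constant shift. -/
theorem exists_shift [T2Space X] (h : AnnularLift p C A M) (hp : TorusCover p)
    (hC : IsConnected C) {G : ℂ ≃ₜ ℂ} (hG : LatEquivariant G)
    (hGC : ∀ z, p (G z) ∈ C ↔ p z ∈ C) :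
    ∃ j : ℤ, ∀ z, G z - lat (0, j) ∈ A ↔ z ∈ A := by
  have hne : A.Nonempty := by
    rw [← h.image_eq hp] at hC
    exact hC.nonempty.of_image
  obtain ⟨z₀, hz₀⟩ := hne
  obtain ⟨j, hj⟩ := (h.mem_iff (G z₀)).1 ((hGC z₀).2 (h.subset hz₀))
  have hG1 : ∀ z, G (z + 1) - lat (0, j) = G z - lat (0, j) + 1 := by
    intro z
    have h1 : lat (1, 0) = 1 := by apply Complex.ext <;> simp [lat_re, lat_im]
    rw [← h1, hG]
    ring
  have hcont : Continuous fun z => G z - lat (0, j) := G.continuous.sub continuous_const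
  let P : Set ℂ := A ∩ {z | G z - lat (0, j) ∈ A}
  let Q : Set ℂ := A ∩ {z | G z - lat (0, j) ∈ p ⁻¹' C \ A}
  have hshift : ∀ z, p (G z - lat (0, j)) ∈ C ↔ p z ∈ C := fun z => by
    rw [sub_eq_add_neg, ← lat_neg, hp.apply_add_lat, hGC]
  have hPcl : IsClosed (p '' P) := (hp.isCompact_image (A := P)
    (h.isClosed.inter (h.isClosed.preimage hcont))
    (fun z => by simp only [P, Set.mem_inter_iff, Set.mem_ofPred_eq, h.add_one_mem, hG1])
    fun z hz => h.abs_im_le z hz.1).isClosed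
  have hp1 : ∀ z, p (z + 1) = p z := fun z => by
    have h1 : lat (1, 0) = 1 := by apply Complex.ext <;> simp [lat_re, lat_im]
    rw [← h1, hp.apply_add_lat]
  have hQcl : IsClosed (p '' Q) := (hp.isCompact_image (A := Q)
    (h.isClosed.inter (h.isClosed_diff.preimage hcont))
    (fun z => by simp only [Q, Set.mem_inter_iff, Set.mem_ofPred_eq, h.add_one_mem, hG1,
      Set.mem_sdiff, Set.mem_preimage, hp1])
    fun z hz => h.abs_im_le z hz.1).isClosed
  have hPQ : C ⊆ p '' P ∪ p '' Q := by
    rw [← h.image_eq hp]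
    rintro _ ⟨z, hz, rfl⟩
    by_cases hGz : G z - lat (0, j) ∈ A
    · exact Or.inl ⟨z, ⟨hz, hGz⟩, rfl⟩
    · exact Or.inr ⟨z, ⟨hz, (hshift z).2 (h.subset hz), hGz⟩, rfl⟩
  have hQ : ∀ z ∈ A, G z - lat (0, j) ∈ A := by
    intro z hz
    by_contra hGz
    obtain ⟨x, -, ⟨z₁, ⟨hz₁, hz₁'⟩, rfl⟩, ⟨z₂, ⟨hz₂, hz₂'⟩, heq⟩⟩ :=
      isPreconnected_closed_iff.1 hC.isPreconnected _ _ hPcl hQcl hPQ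
        ⟨_, h.subset hz₀, z₀, ⟨hz₀, hj⟩, rfl⟩
        ⟨_, h.subset hz, z, ⟨hz, (hshift z).2 (h.subset hz), hGz⟩, rfl⟩
    obtain ⟨v, rfl⟩ := (hp.eq_iff _ _).1 heq.symm
    apply hz₂'.2
    have := h.add_mem _ hz₁' v (h.eq_zero _ hz₁ v hz₂)
    rw [hG]
    convert this using 1
    ring
  refine ⟨j, fun z => ⟨fun hz => ?_, hQ z⟩⟩
  obtain ⟨n, hn⟩ := (h.mem_iff z).1 ((hshift z).1 (h.subset hz))
  have h1 := hQ _ hn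
  have h2 : G z - lat (0, j) + lat (0, -n) ∈ A := by
    rw [hG.sub] at h1
    have h3 : lat (0, -n) = -lat (0, n) := by rw [← lat_neg]; simp
    rw [h3]
    convert h1 using 1
    ring
  have h4 : n = 0 := neg_eq_zero.1 (h.eq_zero _ hz _ h2)
  rwa [h4, show ((0, 0) : ℤ × ℤ) = 0 from rfl, lat_zero, sub_zero] at hn

end AnnularLift

end

section

variable {X : Type*} [TopologicalSpace X] {p : ℂ → X} {C : Set X} {A : Set ℂ} {M : ℝ}

namespace AnnularLift

theorem boundedDrift_of_shift [T2Space X] (h : AnnularLift p C A M) (hp : TorusCover p)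
    (hC : IsConnected C) (hCi : ¬ Inessential C) {F : ℂ ≃ₜ ℂ} (hF : LatEquivariant F) {q j : ℤ}
    (hq : 1 ≤ q) (hj : ∀ z, latMap F q (0, j) z ∈ A ↔ z ∈ A) : ∃ c, BoundedDrift F j q c := by
  have hM0 : 0 ≤ M := by
    have hne : A.Nonempty := by
      rw [← h.image_eq hp] at hC
      exact hC.nonempty.of_image
    obtain ⟨z, hz⟩ := hne
    exact (abs_nonneg _).trans (h.abs_im_le z hz)
  have hsep : ∀ x y : ℂ, M < x.im → y.im < -M → ¬ JoinedIn Aᶜ x y := fun x y hx hy hxy =>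
    hCi (by
      rw [← h.image_eq hp]
      exact hp.inessential_of_joinedIn h.isClosed h.add_one_mem h.abs_im_le h.eq_zero
        (by rwa [h.image_eq hp]) hx hy hxy)
  let y₀ : ℂ := ⟨0, M + 1⟩
  let S : Set ℂ := {z | M < z.im}
  have hyS : y₀ ∈ S := by simp only [S, y₀, Set.mem_ofPred_eq]; linarith
  let V : Set ℂ := connectedComponentIn Aᶜ y₀
  have hSA : S ⊆ Aᶜ := fun z hz hz' =>
    absurd ((le_abs_self _).trans (h.abs_im_le z hz')) (not_le.2 hz)
  have hSV : S ⊆ V := (isPreconnected_lt_im M).subset_connectedComponentIn hyS hSA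
  have hV : IsOpen V := h.isClosed.isOpen_compl.connectedComponentIn
  have hVlow : ∀ z ∈ V, -M ≤ z.im := by
    intro z hz
    by_contra hlt
    have hVc : IsConnected V := isConnected_connectedComponentIn_iff.2 (hSA hyS)
    exact hsep y₀ z hyS (not_le.1 hlt) (((hV.isConnected_iff_isPathConnected.1 hVc).joinedIn y₀
      (hSV hyS) z hz).mono (connectedComponentIn_subset _ _))
  let Φ : ℤ → ℂ ≃ₜ ℂ := fun n => latMap F (n * q) (0, n * j)
  have hΦ : ∀ n z, Φ (n + 1) z = latMap F q (0, j) (Φ n z) := by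
    intro n z
    rw [← hF.latMap_add, Prod.mk_add_mk, add_zero]
    simp only [Φ]
    rw [add_mul, one_mul, add_comm, add_mul, one_mul, add_comm (n * j)]
  have hΦA : ∀ n z, Φ n z ∈ A ↔ z ∈ A := by
    intro n z
    induction n with
    | zero =>
      have : Φ 0 z = z := by
        simp only [Φ]
        rw [zero_mul, zero_mul]
        exact latMap_zero F z
      rw [this]
    | succ n ih => rw [hΦ, hj, ih]
    | pred n ih =>
      have := hΦ (-n - 1) z
      rw [sub_add_cancel] at this
      rw [← ih, this, hj]
  have hΦV : ∀ n, ∀ z ∈ V, Φ n z ∈ V := by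
    intro n z hz
    obtain ⟨d, hd⟩ := (hF.latMap (n * q) (0, n * j)).bounded
    refine connectedComponentIn_invariant (H := Φ n) hSV (Φ n).continuous
      (fun w hw hw' => hw ((hΦA n w).1 hw')) ⟨⟨0, M + 1 + d⟩, ?_, ?_⟩ hz
    · have := (norm_nonneg _).trans (hd 0)
      simp only [S, Set.mem_ofPred_eq]
      linarith
    · have h1 := (abs_le.1 ((Complex.abs_im_le_norm _).trans (hd ⟨0, M + 1 + d⟩))).1
      simp only [Complex.sub_im] at h1
      simp only [S, Set.mem_ofPred_eq, Φ]
      linarith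
  have hlow : ∀ n z, -(2 * M + 1) ≤ (Φ n z).im - z.im := by
    intro n z
    have h1 := Int.lt_floor_add_one (M - z.im)
    have h2 := Int.floor_le (M - z.im)
    have h3 : z + lat (0, ⌊M - z.im⌋ + 1) ∈ V := hSV (by
      rw [Set.mem_ofPred_eq, Complex.add_im, lat_im]
      push_cast
      linarith)
    have h4 := hVlow _ (hΦV n _ h3)
    rw [show Φ n (z + lat (0, ⌊M - z.im⌋ + 1)) = Φ n z + lat (0, ⌊M - z.im⌋ + 1) from
      hF.latMap _ _ _ _, Complex.add_im, lat_im] at h4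
    push_cast at h4
    linarith
  have habs : ∀ n z, |(Φ n z).im - z.im| ≤ 2 * M + 1 := by
    intro n z
    rw [abs_le]
    refine ⟨hlow n z, ?_⟩
    have h1 := hlow (-n) (Φ n z)
    have h2 : Φ (-n) (Φ n z) = z := by
      have := hF.latMap_neg (n * q) (0, n * j) z
      simp only [Φ]
      rw [neg_mul, neg_mul]
      simpa using this
    rw [h2] at h1
    linarith
  obtain ⟨d, hd⟩ := hF.bounded
  have hd0 : 0 ≤ d := (norm_nonneg _).trans (hd 0)
  have hr : ∀ (r : ℕ) z, |((F ^ (r : ℤ)) z).im - z.im| ≤ r * d := by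
    intro r z
    induction r with
    | zero => simp
    | succ r ih =>
      have h1 : (F ^ ((r + 1 : ℕ) : ℤ)) z = F ((F ^ (r : ℤ)) z) := by
        rw [Nat.cast_succ, add_comm, zpow_add, zpow_one]
        rfl
      have h2 := (Complex.abs_im_le_norm _).trans (hd ((F ^ (r : ℤ)) z))
      rw [Complex.sub_im] at h2
      rw [h1]
      have := abs_sub_le (F ((F ^ (r : ℤ)) z)).im ((F ^ (r : ℤ)) z).im z.im
      push_cast
      linarith
  have hq' : (1 : ℝ) ≤ q := by exact_mod_cast hq
  refine ⟨q * (2 * M + 1) + q * (q * d) + q * |(j : ℝ)|, fun N z => ?_⟩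
  obtain ⟨r, hr'⟩ := Int.eq_ofNat_of_zero_le (Int.emod_nonneg N (by omega : q ≠ 0))
  have hrq : (r : ℝ) ≤ q := by
    have := (Int.emod_lt_of_pos N (by omega : 0 < q)).le
    rw [hr'] at this
    exact_mod_cast this
  have hN : N = r + (N / q) * q := by
    have := Int.emod_add_mul_ediv N q
    rw [hr'] at this
    rw [mul_comm]
    exact this.symm
  have hNr : (N : ℝ) = r + ((N / q : ℤ) : ℝ) * q := by exact_mod_cast hN
  have h1 := habs (N / q) z
  simp only [Φ] at h1
  rw [latMap_apply, Complex.sub_im, lat_im] at h1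
  have h2 := hr r ((F ^ (N / q * q)) z)
  rw [← Homeomorph.zpow_add_apply, ← hN] at h2
  push_cast at h1
  have hj0 := abs_nonneg (j : ℝ)
  have hr0 : (0 : ℝ) ≤ r := Nat.cast_nonneg r
  have h3 : (q : ℝ) * (((F ^ N) z).im - z.im) - N * j =
      q * (((F ^ (N / q * q)) z).im - ((N / q : ℤ) : ℝ) * j - z.im) +
        q * (((F ^ N) z).im - ((F ^ (N / q * q)) z).im) - r * j := by
    rw [hNr]
    ring
  rw [h3]
  refine (abs_sub _ _).trans (add_le_add ((abs_add_le _ _).trans (add_le_add ?_ ?_)) ?_)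
  · rw [abs_mul, abs_of_pos (by linarith)]
    exact mul_le_mul_of_nonneg_left h1 (by linarith)
  · rw [abs_mul, abs_of_pos (by linarith)]
    exact mul_le_mul_of_nonneg_left (h2.trans (mul_le_mul_of_nonneg_right hrq hd0)) (by linarith)
  · rw [abs_mul, abs_of_nonneg hr0]
    exact mul_le_mul_of_nonneg_right hrq hj0

end AnnularLift

theorem TorusCover.exists_boundedDrift [T2Space X] (hp : TorusCover p) {F : ℂ ≃ₜ ℂ}
    (hF : LatEquivariant F) {f : X → X} (hf : ∀ z, p (F z) = f (p z)) (hfi : Function.Injective f)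
    (hCc : IsCompact C) (hC : IsConnected C) (hCi : ¬ Inessential C) {q : ℕ} (hq : 1 ≤ q)
    (hfC : f^[q] '' C = C) {γ : ℝ → ℂ} (hγ : Continuous γ) {k : ℤ} (hk : k ≠ 0)
    (hper : ∀ s, γ (s + 1) = γ s + k) (hγC : ∀ s, p (γ s) ∉ C) :
    ∃ (a b : ℤ) (c : ℝ), 1 ≤ b ∧ BoundedDrift F a b c := by
  obtain ⟨A, M, h⟩ := hp.exists_annularLift hγ hk hper hCc.isClosed hγC
  obtain ⟨j, hj⟩ := h.exists_shift hp hC (hF.zpow q) fun z => by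
    rw [proj_zpow hf]
    nth_rewrite 1 [← hfC]
    exact (hfi.iterate q).mem_set_image
  have hq' : (1 : ℤ) ≤ q := by exact_mod_cast hq
  obtain ⟨c, hc⟩ := h.boundedDrift_of_shift hp hC hCi hF hq' (j := j) fun z => by
    rw [latMap_apply, hj]
  exact ⟨j, q, c, hq', hc⟩

end

section

variable {X : Type*} [TopologicalSpace X] {p : ℂ → X}

/-- An essential simple closed curve lifts to a path with a nonzero integer period. -/
theorem TorusCover.exists_lift_circle [T2Space X] (hp : TorusCover p) {e : AddCircle (1 : ℝ) → X}
    (he : IsEmbedding e) (hi : ¬ Inessential (Set.range e)) :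
    ∃ (γ : ℝ → ℂ) (m : ℤ × ℤ), Continuous γ ∧ m ≠ 0 ∧ (∀ s, γ (s + 1) = γ s + lat m) ∧
      ∀ s : ℝ, p (γ s) = e s := by
  obtain ⟨γ, hγ, hγe⟩ := hp.exists_lift_real (e := fun s : ℝ => e s)
    (he.continuous.comp (AddCircle.continuous_mk' 1))
  have hval : ∀ s : ℝ, ∃ v, γ (s + 1) - γ s = lat v := by
    intro s
    have h1 : p (γ s) = p (γ (s + 1)) := by
      rw [hγe, hγe, AddCircle.coe_add_period]
    obtain ⟨v, hv⟩ := (hp.eq_iff _ _).1 h1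
    exact ⟨v, by rw [hv]; ring⟩
  obtain ⟨m, hm⟩ := hval 0
  have hstep : ∀ s, γ (s + 1) = γ s + lat m := by
    intro s
    have := isPreconnected_univ.eq_of_lat_valued
      (g := fun s : ℝ => γ (s + 1) - γ s) (by fun_prop) (fun x _ => hval x) (Set.mem_univ s)
      (Set.mem_univ 0)
    simp only [hm] at this
    rw [← this]
    ring
  refine ⟨γ, m, hγ, ?_, hstep, hγe⟩
  rintro rfl
  have hper : Function.Periodic γ 1 := fun s => by rw [hstep, lat_zero, add_zero]
  have hcont : Continuous (hper.lift : AddCircle (1 : ℝ) → ℂ) :=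
    QuotientAddGroup.isOpenQuotientMap_mk.isQuotientMap.continuous_iff.2 hγ
  apply hi
  refine hp.inessential_of_section (isCompact_range he.continuous)
    (isConnected_range he.continuous)
    (s := fun x => hper.lift (Function.invFun e x)) ?_ ?_
  · refine hcont.comp_continuousOn (continuousOn_iff_continuous_domRestrict.2 ?_)
    convert he.toHomeomorph.symm.continuous using 1
    ext x
    obtain ⟨t, rfl⟩ := he.toHomeomorph.surjective x
    rw [Homeomorph.symm_apply_apply]
    exact Function.leftInverse_invFun he.injective t
  · rintro _ ⟨t, rfl⟩
    rw [Function.leftInverse_invFun he.injective t]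
    induction t using QuotientAddGroup.induction_on with
    | H s => exact hγe s

end

/-- The linear isomorphism from the complex plane to `Rd 2` sending `1` and `I` to the vectors of
an oriented basis of the integer lattice. -/
def latticeBasis (w u : ℤ × ℤ) (h : w.1 * u.2 - w.2 * u.1 = 1) : ℂ ≃ₜ Rd 2 where
  toFun z := !₂[z.re * w.1 + z.im * u.1, z.re * w.2 + z.im * u.2]
  invFun x := ⟨x 0 * u.2 - x 1 * u.1, w.1 * x 1 - w.2 * x 0⟩
  left_inv z := by
    have h' : (w.1 * u.2 - w.2 * u.1 : ℝ) = 1 := by exact_mod_cast h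
    apply Complex.ext
    · simp
      linear_combination z.re * h'
    · simp
      linear_combination z.im * h'
  right_inv x := by
    have h' : (w.1 * u.2 - w.2 * u.1 : ℝ) = 1 := by exact_mod_cast h
    ext i
    fin_cases i
    · simp
      linear_combination x 0 * h'
    · simp
      linear_combination x 1 * h'
  continuous_toFun := by
    refine (PiLp.continuous_toLp 2 _).comp (continuous_pi fun i => ?_)
    fin_cases i
    · simp
      fun_prop
    · simp
      fun_prop
  continuous_invFun := by
    have : (fun x : Rd 2 => (⟨x 0 * u.2 - x 1 * u.1, w.1 * x 1 - w.2 * x 0⟩ : ℂ)) =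
        fun x => Complex.equivRealProdCLM.symm
          (x 0 * u.2 - x 1 * u.1, w.1 * x 1 - w.2 * x 0) := by
      ext x
      apply Complex.ext <;> rfl
    rw [this]
    fun_prop

namespace latticeBasis

variable {w u : ℤ × ℤ} (h : w.1 * u.2 - w.2 * u.1 = 1)

@[simp] theorem apply_zero (z : ℂ) : latticeBasis w u h z 0 = z.re * w.1 + z.im * u.1 := rfl

@[simp] theorem apply_one (z : ℂ) : latticeBasis w u h z 1 = z.re * w.2 + z.im * u.2 := rfl

@[simp] theorem symm_re (x : Rd 2) : ((latticeBasis w u h).symm x).re = x 0 * u.2 - x 1 * u.1 :=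
  rfl

@[simp] theorem symm_im (x : Rd 2) : ((latticeBasis w u h).symm x).im = w.1 * x 1 - w.2 * x 0 :=
  rfl

theorem map_add (z z' : ℂ) :
    latticeBasis w u h (z + z') = latticeBasis w u h z + latticeBasis w u h z' := by
  ext i
  fin_cases i
  · simp
    ring
  · simp
    ring

theorem map_lat (v : ℤ × ℤ) : latticeBasis w u h (lat v) =
    intVec ![v.1 * w.1 + v.2 * u.1, v.1 * w.2 + v.2 * u.2] := by
  ext i
  fin_cases i <;> simp [intVec]

theorem map_add_lat (z : ℂ) (v : ℤ × ℤ) : latticeBasis w u h (z + lat v) =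
    latticeBasis w u h z + intVec ![v.1 * w.1 + v.2 * u.1, v.1 * w.2 + v.2 * u.2] := by
  rw [map_add, map_lat]

theorem symm_add_intVec (x : Rd 2) (m : Fin 2 → ℤ) : (latticeBasis w u h).symm (x + intVec m) =
    (latticeBasis w u h).symm x + lat (m 0 * u.2 - m 1 * u.1, w.1 * m 1 - w.2 * m 0) := by
  apply Complex.ext
  · simp [intVec]
    ring
  · simp [intVec]
    ring

end latticeBasis

theorem projT_eq_iff {d : ℕ} {x y : Rd d} : projT x = projT y ↔ ∃ m, y = x + intVec m := by
  constructor
  · intro hxy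
    have : ∀ i, ∃ n : ℤ, y i = x i + n := by
      intro i
      have h1 : ((y i - x i : ℝ) : AddCircle (1 : ℝ)) = 0 := by
        rw [AddCircle.coe_sub, sub_eq_zero]
        exact (congrFun hxy i).symm
      obtain ⟨n, hn⟩ := (AddCircle.coe_eq_zero_iff 1).1 h1
      exact ⟨n, by simp at hn; linarith⟩
    choose m hm using this
    exact ⟨m, by ext i; simp [intVec, hm]⟩
  · rintro ⟨m, rfl⟩
    funext i
    simp [projT, intVec]

theorem continuous_projT {d : ℕ} : Continuous (projT (d := d)) := by
  refine continuous_pi fun i => (AddCircle.continuous_mk' 1).comp ?_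
  fun_prop

theorem surjective_projT {d : ℕ} : Function.Surjective (projT (d := d)) := by
  intro x
  choose y hy using fun i => QuotientAddGroup.mk_surjective (x i)
  exact ⟨WithLp.toLp 2 y, funext hy⟩

theorem isOpenMap_projT {d : ℕ} : IsOpenMap (projT (d := d)) :=
  (IsOpenMap.piMap (fun _ => QuotientAddGroup.isOpenMap_coe)
    (Eventually.of_forall fun _ => QuotientAddGroup.mk_surjective)).comp
    (PiLp.homeomorph 2 (fun _ : Fin d => ℝ)).isOpenMap

/-- The quotient map to the torus, in the coordinates of a basis of the integer lattice. -/
theorem torusCover_latticeBasis {w u : ℤ × ℤ} (h : w.1 * u.2 - w.2 * u.1 = 1) :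
    TorusCover (fun z => projT (latticeBasis w u h z)) := by
  have heq : ∀ z z' : ℂ, projT (latticeBasis w u h z) = projT (latticeBasis w u h z') ↔
      ∃ v : ℤ × ℤ, z' = z + lat v := by
    intro z z'
    rw [projT_eq_iff]
    constructor
    · rintro ⟨m, hm⟩
      refine ⟨(m 0 * u.2 - m 1 * u.1, w.1 * m 1 - w.2 * m 0), ?_⟩
      rw [← (latticeBasis w u h).symm_apply_apply z', hm, latticeBasis.symm_add_intVec,
        Homeomorph.symm_apply_apply]
    · rintro ⟨v, rfl⟩
      exact ⟨_, latticeBasis.map_add_lat h z v⟩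
  have hsurj : Function.Surjective (fun z => projT (latticeBasis w u h z)) :=
    surjective_projT.comp (latticeBasis w u h).surjective
  refine ⟨?_, hsurj, heq⟩
  let φ : ℂ →+ Torus 2 :=
    { toFun := fun z => projT (latticeBasis w u h z)
      map_zero' := by
        funext i
        fin_cases i <;> simp [projT]
      map_add' := fun z z' => by
        rw [latticeBasis.map_add]
        funext i
        simp [projT] }
  have hq : IsQuotientMap φ := (isOpenMap_projT.comp (latticeBasis w u h).isOpenMap).isQuotientMap
    (continuous_projT.comp (latticeBasis w u h).continuous) hsurj
  have hd : IsDiscrete (φ.ker : Set ℂ) := by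
    rw [SetLike.isDiscrete_iff_discreteTopology]
    refine DiscreteTopology.of_forall_le_norm one_pos ?_
    rintro ⟨x, hx⟩ hne
    obtain ⟨v, hv⟩ := (heq 0 x).1 (by
      have h1 : φ x = φ 0 := by rw [map_zero]; exact hx
      exact h1.symm)
    rw [zero_add] at hv
    subst hv
    refine one_le_norm_lat ?_
    rintro rfl
    exact hne (Subtype.ext lat_zero)
  exact (hq.isAddQuotientCoveringMap_of_isDiscrete_ker_addMonoidHom hd).isCoveringMap

theorem isEssentialT2_iff {C : Set (Torus 2)} : IsEssentialT2 C ↔ ¬ Inessential C := by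
  let L := latticeBasis (1, 0) (0, 1) (by norm_num)
  refine not_congr ⟨?_, ?_⟩
  · rintro ⟨e, he, hC⟩
    exact ⟨e ∘ L, he.comp L.isOpenEmbedding, by rwa [L.surjective.range_comp]⟩
  · rintro ⟨e, he, hC⟩
    exact ⟨e ∘ L.symm, he.comp L.symm.isOpenEmbedding, by rwa [L.symm.surjective.range_comp]⟩

theorem circloidPropsT2_iff {C : Set (Torus 2)} : CircloidPropsT2 C ↔ CircloidProps C := by
  simp only [CircloidPropsT2, CircloidProps, isEssentialT2_iff, IsSimpleClosedCurveT2]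

theorem exists_lattice_basis {x y : ℤ} (h : x ≠ 0 ∨ y ≠ 0) :
    ∃ (g : ℤ) (w u : ℤ × ℤ), g ≠ 0 ∧ x = g * w.1 ∧ y = g * w.2 ∧ w.1 * u.2 - w.2 * u.1 = 1 := by
  have hg : (Int.gcd x y : ℤ) ≠ 0 := by
    intro h0
    have := Int.gcd_eq_zero_iff.1 (by exact_mod_cast h0 : Int.gcd x y = 0)
    tauto
  obtain ⟨a, ha⟩ := Int.gcd_dvd_left x y
  obtain ⟨b, hb⟩ := Int.gcd_dvd_right x y
  refine ⟨Int.gcd x y, (a, b), (-Int.gcdB x y, Int.gcdA x y), hg, ha, hb, ?_⟩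
  apply mul_left_cancel₀ hg
  simp only
  linear_combination -Int.gcd_eq_gcd_ab x y - Int.gcdA x y * ha - Int.gcdB x y * hb

section

variable {w u : ℤ × ℤ} (h : w.1 * u.2 - w.2 * u.1 = 1) (F : Rd 2 ≃ₜ Rd 2)

/-- A homeomorphism of the plane, in the coordinates of a basis of the integer lattice. -/
def latticeConj : ℂ ≃ₜ ℂ :=
  ((latticeBasis w u h).trans F).trans (latticeBasis w u h).symm

theorem latticeBasis_latticeConj (z : ℂ) :
    latticeBasis w u h (latticeConj h F z) = F (latticeBasis w u h z) := by
  simp [latticeConj]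

theorem latticeBasis_latticeConj_zpow (n : ℤ) (z : ℂ) :
    latticeBasis w u h ((latticeConj h F ^ n) z) = iterZ F n (latticeBasis w u h z) := by
  have hsymm : ∀ z, latticeBasis w u h ((latticeConj h F).symm z) =
      F.symm (latticeBasis w u h z) := by
    intro z
    rw [Homeomorph.eq_symm_apply, ← latticeBasis_latticeConj, Homeomorph.apply_symm_apply]
  induction n using Int.induction_on generalizing z with
  | zero => rfl
  | succ n ih =>
    have h1 : ∀ x, iterZ F (n + 1) x = iterZ F n (F x) := fun x => by
      simp only [iterZ, zpow_add_one, Equiv.Perm.coe_mul, Function.comp_apply]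
      rfl
    rw [h1, ← latticeBasis_latticeConj, ← ih, zpow_add_one]
    rfl
  | pred n ih =>
    have h1 : ∀ x, iterZ F (-n - 1) x = iterZ F (-n) (F.symm x) := fun x => by
      simp only [iterZ, zpow_sub_one, Equiv.Perm.coe_mul, Function.comp_apply]
      rfl
    rw [h1, ← hsymm, ← ih, zpow_sub_one]
    rfl

theorem IsLift.latEquivariant {f : Torus 2 ≃ₜ Torus 2} {F : Rd 2 ≃ₜ Rd 2} (hF : IsLift f F) :
    LatEquivariant (latticeConj h F) := by
  intro z v
  apply (latticeBasis w u h).injective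
  rw [latticeBasis_latticeConj, latticeBasis.map_add_lat, latticeBasis.map_add_lat, hF.2,
    latticeBasis_latticeConj]

theorem IsLift.projT_latticeConj {f : Torus 2 ≃ₜ Torus 2} {F : Rd 2 ≃ₜ Rd 2} (hF : IsLift f F)
    (z : ℂ) :
    projT (latticeBasis w u h (latticeConj h F z)) = f (projT (latticeBasis w u h z)) := by
  rw [latticeBasis_latticeConj, hF.1]

theorem inner_latticeBasis (g : ℤ) (z : ℂ) :
    ⟪latticeBasis w u h z, intVec ![-(g * w.2), g * w.1]⟫ = g * z.im := by
  have h' : (w.1 * u.2 - w.2 * u.1 : ℝ) = 1 := by exact_mod_cast h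
  simp [intVec, PiLp.inner_apply, Fin.sum_univ_two]
  linear_combination g * z.im * h'

/-- The mean motion in the direction of an integer vector, in adapted coordinates. -/
theorem inner_iterZ_sub (g : ℤ) (lam : ℝ) (n : ℤ) (z : ℂ) :
    ⟪iterZ F n (latticeBasis w u h z) - latticeBasis w u h z -
        (n : ℝ) • (lam • intVec ![-(g * w.2), g * w.1]), intVec ![-(g * w.2), g * w.1]⟫ =
      g * (((latticeConj h F ^ n) z).im - z.im) - n * (lam * (g ^ 2 * (w.1 ^ 2 + w.2 ^ 2))) := by
  rw [inner_sub_left, inner_sub_left, ← latticeBasis_latticeConj_zpow, inner_latticeBasis,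
    inner_latticeBasis, inner_smul_left, inner_smul_left, real_inner_self_eq_norm_sq,
    EuclideanSpace.real_norm_sq_eq]
  simp [intVec, Fin.sum_univ_two]
  ring

end

theorem rotSetOn_subset_affHyp {d : ℕ} {F : Rd d ≃ₜ Rd d} {v : Rd d} {lam : ℝ}
    {K : Set (Torus d)} (hb : BddMeanMotionParallelOn F v lam K) :
    rotSetOn F K ⊆ affHyp v lam := by
  obtain ⟨c, -, hc⟩ := hb
  rintro ρ ⟨n, x, hn, hx, hρ⟩
  refine ⟨ρ - lam • v, ?_, by abel⟩
  have hlim : Tendsto (fun i => ⟪(n i : ℝ)⁻¹ • ((⇑F)^[n i] (x i) - x i) - lam • v, v⟫) atTop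
      (𝓝 ⟪ρ - lam • v, v⟫) := (hρ.sub_const _).inner tendsto_const_nhds
  have hzero : Tendsto (fun i => ⟪(n i : ℝ)⁻¹ • ((⇑F)^[n i] (x i) - x i) - lam • v, v⟫) atTop
      (𝓝 0) := by
    have hn' : Tendsto (fun i => (n i : ℝ)) atTop atTop :=
      tendsto_natCast_atTop_atTop.comp hn.tendsto_atTop
    refine squeeze_zero_norm' ?_ (hn'.const_div_atTop c)
    filter_upwards [hn'.eventually_gt_atTop 0] with i hi
    have hit : (⇑F)^[n i] (x i) = iterZ F (n i) (x i) := by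
      simp only [iterZ, zpow_natCast]
      rw [← Equiv.Perm.iterate_eq_pow]
      rfl
    have h1 : (n i : ℝ)⁻¹ • ((⇑F)^[n i] (x i) - x i) - lam • v =
        (n i : ℝ)⁻¹ • (iterZ F (n i) (x i) - x i - ((n i : ℤ) : ℝ) • (lam • v)) := by
      rw [hit, smul_sub _ _ (((n i : ℤ) : ℝ) • (lam • v)), smul_smul _ ((n i : ℤ) : ℝ),
        Int.cast_natCast, inv_mul_cancel₀ hi.ne', one_smul]
    rw [h1, inner_smul_left, Real.norm_eq_abs, abs_mul, div_eq_inv_mul]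
    refine mul_le_mul ?_ (hc _ _ (hx i)) (abs_nonneg _) (by positivity)
    simp [abs_of_pos hi]
  exact tendsto_nhds_unique hlim hzero

/-- **Proposition 3.9.**  A non-wandering homeomorphism of `𝕋²` homotopic to the
identity and without periodic points is rationally bounded if and only if it has a
periodic circloid. -/
theorem statement17 (f : Torus 2 ≃ₜ Torus 2) (F : Rd 2 ≃ₜ Rd 2) (hF : IsLift f F)
    (hnw : NonWandering (⇑f)) (hnp : ¬ HasPeriodicPoint (⇑f)) :
    RationallyBounded F ↔
      ∃ (C : Set (Torus 2)) (q : ℕ), 1 ≤ q ∧ IsCircloidT2 C ∧ (⇑f)^[q] '' C = C := by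
  constructor
  · rintro ⟨v, lam, hv, -, c, hc0, hc⟩
    obtain ⟨g, w, u, hg, h1, h2, h⟩ := exists_lattice_basis (x := v 1) (y := -v 0) (by
      by_contra! h0
      exact hv (by ext i; fin_cases i <;> simp <;> omega))
    obtain rfl : v = ![-(g * w.2), g * w.1] := by
      ext i
      fin_cases i
      · simp
        omega
      · exact h1
    have hdrift : BoundedDrift (latticeConj h F) (lam.num * g * (w.1 ^ 2 + w.2 ^ 2)) lam.den
        (lam.den / |(g : ℝ)| * c) := by
      intro n z
      have := hc n (latticeBasis w u h z) (Set.mem_univ _)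
      rw [inner_iterZ_sub] at this
      have hg' : (g : ℝ) ≠ 0 := by exact_mod_cast hg
      have hden : (lam.den : ℝ) ≠ 0 := by exact_mod_cast lam.den_nz
      have hlam : (lam : ℝ) = lam.num / lam.den := Rat.cast_def lam
      have heq : ((lam.den : ℤ) : ℝ) * (((latticeConj h F ^ n) z).im - z.im) -
          n * (lam.num * g * (w.1 ^ 2 + w.2 ^ 2) : ℤ) = lam.den / g *
          (g * (((latticeConj h F ^ n) z).im - z.im) -
            n * (lam * (g ^ 2 * (w.1 ^ 2 + w.2 ^ 2)))) := by
        rw [hlam]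
        push_cast
        field_simp
      rw [heq, abs_mul, abs_div, Nat.abs_cast]
      gcongr
    obtain ⟨C, q, hq, ⟨hC, hmin⟩, hfC⟩ := (torusCover_latticeBasis h).exists_periodic_circloid
      (hF.latEquivariant h) (hF.projT_latticeConj h) hnw hnp
      (by exact_mod_cast lam.pos) hdrift
    exact ⟨C, q, hq, ⟨circloidPropsT2_iff.2 hC, fun C' hC' hp =>
      hmin C' hC' (circloidPropsT2_iff.1 hp)⟩, hfC⟩
  · rintro ⟨C, q, hq, ⟨⟨hCc, hC, hCi, -, Γ, hΓ, ⟨e, he, rfl⟩, hΓi⟩, -⟩, hfC⟩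
    have h₀ : ((1, 0) : ℤ × ℤ).1 * ((0, 1) : ℤ × ℤ).2 -
        ((1, 0) : ℤ × ℤ).2 * ((0, 1) : ℤ × ℤ).1 = 1 := by norm_num
    obtain ⟨γ, m, hγ, hm, hper, hγe⟩ := (torusCover_latticeBasis h₀).exists_lift_circle he
      (isEssentialT2_iff.1 hΓi)
    obtain ⟨g, w, u, hg, h1, h2, h⟩ := exists_lattice_basis (x := m.1) (y := m.2) (by
      by_contra! h0
      exact hm (Prod.ext h0.1 h0.2))
    obtain ⟨a, b, c, hb, hdrift⟩ := (torusCover_latticeBasis h).exists_boundedDrift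
      (hF.latEquivariant h) (hF.projT_latticeConj h) f.injective hCc hC
      (isEssentialT2_iff.1 hCi) hq hfC
      (γ := fun s => (latticeBasis w u h).symm (latticeBasis _ _ h₀ (γ s)))
      (by fun_prop) hg (fun s => by
        rw [hper, latticeBasis.map_add_lat, latticeBasis.symm_add_intVec]
        congr 1
        apply Complex.ext
        · simp [h1, h2]
          have h' : (w.1 * u.2 - w.2 * u.1 : ℝ) = 1 := by exact_mod_cast h
          linear_combination g * h'
        · simp [h1, h2]
          ring)
      (fun s hs => by
        rw [Homeomorph.apply_symm_apply, hγe] at hs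
        exact hΓ (Set.mem_range_self _) hs)
    have hw : 0 < w.1 ^ 2 + w.2 ^ 2 := by
      by_contra! h0
      have h3 : w.1 = 0 := by nlinarith [sq_nonneg w.1, sq_nonneg w.2]
      have h4 : w.2 = 0 := by nlinarith [sq_nonneg w.1, sq_nonneg w.2]
      simp [h3, h4] at h
    have hbdd : BddMeanMotionParallelOn F (intVec ![-(1 * w.2), 1 * w.1])
        ((a / (b * (w.1 ^ 2 + w.2 ^ 2)) : ℚ) : ℝ) Set.univ := by
      refine ⟨|c| + 1, by positivity, fun n x _ => ?_⟩
      obtain ⟨z, rfl⟩ := (latticeBasis w u h).surjective x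
      rw [inner_iterZ_sub]
      have hb' : (1 : ℝ) ≤ b := by exact_mod_cast hb
      have hw' : (w.1 ^ 2 + w.2 ^ 2 : ℝ) ≠ 0 := by exact_mod_cast hw.ne'
      have heq : ((1 : ℤ) : ℝ) * (((latticeConj h F ^ n) z).im - z.im) -
          n * (((a / (b * (w.1 ^ 2 + w.2 ^ 2)) : ℚ) : ℝ) *
            (((1 : ℤ) : ℝ) ^ 2 * (w.1 ^ 2 + w.2 ^ 2))) =
          (b : ℝ)⁻¹ * (b * (((latticeConj h F ^ n) z).im - z.im) - n * a) := by
        push_cast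
        field_simp
      rw [heq, abs_mul, abs_of_pos (by positivity)]
      calc (b : ℝ)⁻¹ * |b * (((latticeConj h F ^ n) z).im - z.im) - n * a| ≤ 1 * |c| := by
            exact mul_le_mul (inv_le_one_of_one_le₀ hb') ((hdrift n z).trans (le_abs_self c))
              (abs_nonneg _) zero_le_one
        _ ≤ |c| + 1 := by linarith
    refine ⟨_, _, ?_, rotSetOn_subset_affHyp hbdd, hbdd⟩
    intro h0
    have h3 := congrFun h0 0
    have h4 := congrFun h0 1
    simp at h3 h4
    simp [h3, h4] at hw
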